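/- There exist absolute constants C, c > 0 such that for every n ≥ 2 and every normed space X = (ℝⁿ, ‖·‖) there exists an invertible linear map S : ℝⁿ → ℝⁿ such that for all t > 0, P( | ‖SG‖ − E‖SG‖ | > t · E‖SG‖ ) ≤ C exp( −c · max{t², t} · log n ), where G is a standard n-dimensional Gaussian vector. -/

import Mathlib

open MeasureTheory ProbabilityTheory Real

/-- The standard Gaussian measure `γₙ` on `ℝⁿ`. -/
noncomputable def stdGaussian (n : ℕ) : Measure (Fin n → ℝ) :=
  Measure.pi fun _ => gaussianReal 0 1

section

open Finset BigOperators

/-- The point of the discrete cube obtained from `x` by flipping the `i`-th bit. -/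
def flipAt {ι : Type*} [DecidableEq ι] (x : ι → Bool) (i : ι) : ι → Bool :=
  Function.update x i (!x i)

theorem flipAt_flipAt {ι : Type*} [DecidableEq ι] (x : ι → Bool) (i : ι) :
    flipAt (flipAt x i) i = x := by
  simp [flipAt]

theorem expect_flipAt {ι : Type*} [DecidableEq ι] [Fintype ι] (F : (ι → Bool) → ℝ) (i : ι) :
    𝔼 x, F (flipAt x i) = 𝔼 x, F x :=
  Fintype.expect_equiv (Function.Involutive.toPerm (fun x => flipAt x i)
    (fun x => flipAt_flipAt x i)) _ _ (fun _ => rfl)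

theorem expect_cube_succ {d : ℕ} (F : (Fin (d + 1) → Bool) → ℝ) :
    𝔼 x, F x = (𝔼 y : Fin d → Bool, F (Fin.cons true y) +
      𝔼 y : Fin d → Bool, F (Fin.cons false y)) / 2 := by
  rw [Fintype.expect_equiv (Fin.consEquiv (fun _ => Bool)).symm F
    (fun p : Bool × (Fin d → Bool) => F (Fin.cons p.1 p.2))]
  · rw [← Finset.univ_product_univ, Finset.expect_product]
    rw [Fintype.expect_eq_sum_div_card, Fintype.sum_bool]
    simp
  · intro x
    simp [Fin.consEquiv]

theorem flipAt_cons_zero {d : ℕ} (b : Bool) (y : Fin d → Bool) :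
    flipAt (Fin.cons b y : Fin (d + 1) → Bool) 0 = Fin.cons (!b) y := by
  simp [flipAt]

theorem flipAt_cons_succ {d : ℕ} (b : Bool) (y : Fin d → Bool) (i : Fin d) :
    flipAt (Fin.cons b y : Fin (d + 1) → Bool) i.succ = Fin.cons b (flipAt y i) := by
  simp [flipAt, Fin.cons_update]

/-- The (unnormalised) Dirichlet energy on the discrete cube. -/
noncomputable def cubeEnergy {ι : Type*} [DecidableEq ι] [Fintype ι] (F : (ι → Bool) → ℝ) : ℝ :=
  ∑ i, 𝔼 x, (F x - F (flipAt x i)) ^ 2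

theorem cubeEnergy_succ {d : ℕ} (F : (Fin (d + 1) → Bool) → ℝ) :
    cubeEnergy F = 𝔼 y : Fin d → Bool, (F (Fin.cons true y) - F (Fin.cons false y)) ^ 2 +
      (cubeEnergy (fun y => F (Fin.cons true y)) +
        cubeEnergy (fun y => F (Fin.cons false y))) / 2 := by
  unfold cubeEnergy
  rw [Fin.sum_univ_succ, expect_cube_succ, ← Finset.sum_add_distrib, Finset.sum_div]
  congr 1
  · simp only [flipAt_cons_zero, Bool.not_true, Bool.not_false]
    have : 𝔼 y : Fin d → Bool, (F (Fin.cons false y) - F (Fin.cons true y)) ^ 2 =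
      𝔼 y : Fin d → Bool, (F (Fin.cons true y) - F (Fin.cons false y)) ^ 2 :=
        Finset.expect_congr rfl fun y _ => by ring
    rw [this]; ring
  · refine Finset.sum_congr rfl fun i _ => ?_
    rw [expect_cube_succ]
    simp only [flipAt_cons_succ]

theorem two_point_entropy_le {P Q : ℝ} (hP : 0 ≤ P) (hQ : 0 ≤ Q) :
    (P * log P + Q * log Q) / 2 - (P + Q) / 2 * log ((P + Q) / 2) ≤ (√P - √Q) ^ 2 := by
  rcases eq_or_lt_of_le (add_nonneg hP hQ) with h | h
  · have h1 : P = 0 := by linarith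
    have h2 : Q = 0 := by linarith
    simp [h1, h2]
  set m := (P + Q) / 2 with hm
  have hm0 : 0 < m := by positivity
  have key : ∀ R : ℝ, 0 ≤ R → R * log R - R * log m ≤ R * (R / m - 1) := by
    intro R hR
    rcases eq_or_lt_of_le hR with h0 | h0
    · simp [← h0]
    rw [← mul_sub, ← Real.log_div h0.ne' hm0.ne']
    exact mul_le_mul_of_nonneg_left (Real.log_le_sub_one_of_pos (by positivity)) hR
  have h1 := key P hP
  have h2 := key Q hQ
  have h3 : P * (P / m - 1) + Q * (Q / m - 1) ≤ 2 * (√P - √Q) ^ 2 := by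
    have e : P * (P / m - 1) + Q * (Q / m - 1) = (P - Q) ^ 2 / (2 * m) := by
      have : m ≠ 0 := hm0.ne'
      field_simp
      rw [hm]; ring
    rw [e, div_le_iff₀ (by positivity)]
    obtain ⟨a, ha, rfl⟩ : ∃ a, 0 ≤ a ∧ P = a ^ 2 := ⟨√P, by positivity, (Real.sq_sqrt hP).symm⟩
    obtain ⟨b, hb, rfl⟩ : ∃ a, 0 ≤ a ∧ Q = a ^ 2 := ⟨√Q, by positivity, (Real.sq_sqrt hQ).symm⟩
    rw [Real.sqrt_sq ha, Real.sqrt_sq hb, hm]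
    have : (a ^ 2 - b ^ 2) ^ 2 = (a - b) ^ 2 * (a + b) ^ 2 := by ring
    rw [this]
    have : 2 * (a - b) ^ 2 * (2 * ((a ^ 2 + b ^ 2) / 2)) = (a - b) ^ 2 * (2 * (a ^ 2 + b ^ 2)) := by
      ring
    rw [this]
    apply mul_le_mul_of_nonneg_left _ (sq_nonneg _)
    nlinarith [sq_nonneg (a - b)]
  have : (P + Q) / 2 = m := rfl
  rw [show P * log m = (P * log m) from rfl] at h1
  have e2 : m * log m = (P * log m + Q * log m) / 2 := by rw [hm]; ring
  rw [e2]
  linarith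

theorem expect_mul_sq_le {α : Type*} [Fintype α] (f g : α → ℝ) :
    (𝔼 x, f x * g x) ^ 2 ≤ (𝔼 x, f x ^ 2) * 𝔼 x, g x ^ 2 := by
  simp only [Fintype.expect_eq_sum_div_card]
  rw [div_pow, div_mul_div_comm, ← sq]
  gcongr
  exact Finset.sum_mul_sq_le_sq_mul_sq _ _ _

theorem expect_mul_le_sqrt {α : Type*} [Fintype α] (f g : α → ℝ) :
    𝔼 x, f x * g x ≤ √(𝔼 x, f x ^ 2) * √(𝔼 x, g x ^ 2) := by
  rw [← Real.sqrt_mul (Finset.expect_nonneg fun _ _ => sq_nonneg _)]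
  exact Real.le_sqrt_of_sq_le (expect_mul_sq_le f g)

theorem log_sobolev_fin (d : ℕ) (F : (Fin d → Bool) → ℝ) :
    𝔼 x, F x ^ 2 * log (F x ^ 2) - (𝔼 x, F x ^ 2) * log (𝔼 x, F x ^ 2) ≤ cubeEnergy F := by
  induction d with
  | zero => simp [cubeEnergy]
  | succ d ih =>
    have h1 := ih fun y => F (Fin.cons true y)
    have h2 := ih fun y => F (Fin.cons false y)
    rw [cubeEnergy_succ, expect_cube_succ, expect_cube_succ]
    set P := 𝔼 y : Fin d → Bool, F (Fin.cons true y) ^ 2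
    set Q := 𝔼 y : Fin d → Bool, F (Fin.cons false y) ^ 2
    have hP : 0 ≤ P := Finset.expect_nonneg fun _ _ => sq_nonneg _
    have hQ : 0 ≤ Q := Finset.expect_nonneg fun _ _ => sq_nonneg _
    have h3 := two_point_entropy_le hP hQ
    have h4 : (√P - √Q) ^ 2 ≤
        𝔼 y : Fin d → Bool, (F (Fin.cons true y) - F (Fin.cons false y)) ^ 2 := by
      have h5 := expect_mul_le_sqrt (fun y : Fin d → Bool => F (Fin.cons true y))
        (fun y => F (Fin.cons false y))
      have h6 : 𝔼 y : Fin d → Bool, (F (Fin.cons true y) - F (Fin.cons false y)) ^ 2 =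
          P + Q - 2 * 𝔼 y : Fin d → Bool, F (Fin.cons true y) * F (Fin.cons false y) := by
        rw [Finset.mul_expect, ← Finset.expect_add_distrib, ← Finset.expect_sub_distrib]
        exact Finset.expect_congr rfl fun y _ => by ring
      rw [h6, sub_sq, Real.sq_sqrt hP, Real.sq_sqrt hQ]
      linarith
    linarith

theorem mul_sq_le_entropy {α : Type*} [Fintype α] [Nonempty α] (g : α → ℝ) (L : ℝ) :
    (1 + L) * 𝔼 x, g x ^ 2 ≤
      (𝔼 x, g x ^ 2 * log (g x ^ 2) - (𝔼 x, g x ^ 2) * log (𝔼 x, g x ^ 2)) +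
        exp L * (𝔼 x, |g x|) ^ 2 := by
  set m := 𝔼 x, g x ^ 2 with hm
  have hm0 : 0 ≤ m := Finset.expect_nonneg fun _ _ => sq_nonneg _
  rcases eq_or_lt_of_le hm0 with h | h
  · rw [← h]
    have : ∀ x, g x = 0 := by
      intro x
      rw [hm, eq_comm, Finset.expect_eq_zero_iff_of_nonneg
        (fun _ _ => sq_nonneg _)] at h
      simpa using h x (Finset.mem_univ x)
    simp [this]
  set κ := exp (-L / 2) / √m with hκ
  have hκ0 : 0 < κ := by positivity
  have hlogκ : log κ = -L / 2 - log m / 2 := by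
    rw [hκ, Real.log_div (by positivity) (by positivity), Real.log_exp, Real.log_sqrt hm0]
  have hpt : ∀ x, 2 * g x ^ 2 - 2 * |g x| / κ + (L + log m) * g x ^ 2 ≤
      g x ^ 2 * log (g x ^ 2) := by
    intro x
    rcases eq_or_ne (g x) 0 with h0 | h0
    · simp [h0]
    have ha : 0 < |g x| := abs_pos.2 h0
    have h1 := Real.one_sub_inv_le_log_of_pos (mul_pos ha hκ0)
    rw [Real.log_mul ha.ne' hκ0.ne', hlogκ] at h1
    have h2 : log (g x ^ 2) = 2 * log |g x| := by
      rw [← sq_abs, Real.log_pow]; norm_num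
    rw [h2, ← sq_abs]
    have h3 : |g x| ^ 2 * (1 - (|g x| * κ)⁻¹) = |g x| ^ 2 - |g x| / κ := by
      field_simp
    have h4 := mul_le_mul_of_nonneg_left h1 (sq_nonneg |g x|)
    rw [h3] at h4
    have : 2 * |g x| / κ = 2 * (|g x| / κ) := by ring
    rw [this]
    nlinarith
  have h1 := Finset.expect_le_expect (s := Finset.univ) fun x _ => hpt x
  rw [Finset.expect_add_distrib, Finset.expect_sub_distrib, ← Finset.mul_expect,
    ← Finset.mul_expect, ← Finset.expect_div, ← Finset.mul_expect, ← hm] at h1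
  set a := 𝔼 x, |g x|
  have h2 : 2 * a / κ = 2 * (√m * (exp (L / 2) * a)) := by
    rw [hκ, neg_div, Real.exp_neg]
    field_simp
  have h3 : 2 * (√m * (exp (L / 2) * a)) ≤ m + exp L * a ^ 2 := by
    have := two_mul_le_add_sq (√m) (exp (L / 2) * a)
    rw [Real.sq_sqrt hm0, mul_pow, ← Real.exp_nat_mul] at this
    have e : ((2 : ℕ) : ℝ) * (L / 2) = L := by push_cast; ring
    rw [e] at this
    linarith
  rw [h2] at h1
  nlinarith

theorem falik_samorodnitsky_fin (d : ℕ) (F : (Fin d → Bool) → ℝ) (L : ℝ) :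
    (1 + L) * (𝔼 x, F x ^ 2 - (𝔼 x, F x) ^ 2) ≤
      cubeEnergy F + exp L * ∑ i, (𝔼 x, |F x - F (flipAt x i)| / 2) ^ 2 := by
  induction d with
  | zero => simp [cubeEnergy]
  | succ d ih =>
    set F₁ : (Fin d → Bool) → ℝ := fun y => F (Fin.cons true y) with hF₁
    set F₂ : (Fin d → Bool) → ℝ := fun y => F (Fin.cons false y) with hF₂
    set M : (Fin d → Bool) → ℝ := fun y => (F₁ y + F₂ y) / 2 with hM
    set H : (Fin d → Bool) → ℝ := fun y => (F₁ y - F₂ y) / 2 with hH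
    have h1 := ih M
    have h2 := (mul_sq_le_entropy H L).trans (add_le_add_left (log_sobolev_fin d H) _)
    have e1 : 𝔼 x, F x ^ 2 = 𝔼 y, M y ^ 2 + 𝔼 y, H y ^ 2 := by
      rw [expect_cube_succ, ← Finset.expect_add_distrib, ← Finset.expect_add_distrib,
        Finset.expect_div]
      exact Finset.expect_congr rfl fun y _ => by simp only [hM, hH, hF₁, hF₂]; ring
    have e2 : 𝔼 x, F x = 𝔼 y, M y := by
      rw [expect_cube_succ, ← Finset.expect_add_distrib, Finset.expect_div]
    have e3 : cubeEnergy M + cubeEnergy H = (cubeEnergy F₁ + cubeEnergy F₂) / 2 := by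
      unfold cubeEnergy
      rw [← Finset.sum_add_distrib, ← Finset.sum_add_distrib, Finset.sum_div]
      refine Finset.sum_congr rfl fun i _ => ?_
      rw [← Finset.expect_add_distrib, ← Finset.expect_add_distrib, Finset.expect_div]
      exact Finset.expect_congr rfl fun y _ => by simp only [hM, hH]; ring
    have e4 : ∑ i, (𝔼 y, |M y - M (flipAt y i)| / 2) ^ 2 + (𝔼 y, |H y|) ^ 2 ≤
        ∑ i, (𝔼 x, |F x - F (flipAt x i)| / 2) ^ 2 := by
      rw [Fin.sum_univ_succ, add_comm]
      refine add_le_add (le_of_eq ?_) (Finset.sum_le_sum fun i _ => ?_)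
      · congr 1
        rw [expect_cube_succ, ← Finset.expect_add_distrib, Finset.expect_div]
        refine Finset.expect_congr rfl fun y _ => ?_
        simp only [flipAt_cons_zero, Bool.not_true, Bool.not_false, hH, hF₁, hF₂]
        rw [abs_sub_comm (F (Fin.cons false y)), abs_div, abs_two]
        ring
      · refine pow_le_pow_left₀ (Finset.expect_nonneg fun _ _ => by positivity) ?_ 2
        rw [expect_cube_succ, ← Finset.expect_add_distrib, Finset.expect_div]
        refine Finset.expect_le_expect fun y _ => ?_
        simp only [flipAt_cons_succ, hM, hF₁, hF₂]
        rw [show ∀ a b c e : ℝ, (a + b) / 2 - (c + e) / 2 = ((a - c) + (b - e)) / 2 from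
          fun a b c e => by ring, abs_div, abs_two]
        have := abs_add_le (F (Fin.cons true y) - F (Fin.cons true (flipAt y i)))
          (F (Fin.cons false y) - F (Fin.cons false (flipAt y i)))
        linarith
    have e5 : cubeEnergy F₁ / 2 + cubeEnergy F₂ / 2 ≤ cubeEnergy F := by
      rw [cubeEnergy_succ]
      have : 0 ≤ 𝔼 y : Fin d → Bool, (F (Fin.cons true y) - F (Fin.cons false y)) ^ 2 :=
        Finset.expect_nonneg fun _ _ => sq_nonneg _
      linarith
    rw [e1, e2]
    have e6 := mul_le_mul_of_nonneg_left e4 (Real.exp_pos L).le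
    nlinarith

theorem flipAt_comp_equiv {ι κ : Type*} [DecidableEq ι] [DecidableEq κ] (e : ι ≃ κ) (y : κ → Bool) (i : ι) :
    flipAt (y ∘ e) i = flipAt y (e i) ∘ e := by
  ext j
  by_cases h : j = i
  · subst h; simp [flipAt]
  · simp [flipAt, h]

theorem expect_comp_equiv {ι κ : Type*} [DecidableEq ι] [Fintype ι] [DecidableEq κ] [Fintype κ]
    (e : ι ≃ κ)
    (F : (ι → Bool) → ℝ) : 𝔼 y : κ → Bool, F (y ∘ e) = 𝔼 x, F x :=
  Fintype.expect_equiv (Equiv.arrowCongr e (Equiv.refl Bool)).symm _ _ (fun _ => rfl)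

theorem log_sobolev_cube {ι : Type*} [DecidableEq ι] [Fintype ι] (F : (ι → Bool) → ℝ) :
    𝔼 x, F x ^ 2 * log (F x ^ 2) - (𝔼 x, F x ^ 2) * log (𝔼 x, F x ^ 2) ≤ cubeEnergy F := by
  have e := Fintype.equivFin ι
  have h := log_sobolev_fin _ fun y => F (y ∘ e)
  rw [expect_comp_equiv e fun x => F x ^ 2 * log (F x ^ 2),
    expect_comp_equiv e fun x => F x ^ 2] at h
  refine h.trans_eq ?_
  unfold cubeEnergy
  rw [← Equiv.sum_comp e]
  refine Finset.sum_congr rfl fun i _ => ?_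
  rw [← expect_comp_equiv e]
  simp only [flipAt_comp_equiv]

theorem falik_samorodnitsky_cube {ι : Type*} [DecidableEq ι] [Fintype ι] (F : (ι → Bool) → ℝ) (L : ℝ) :
    (1 + L) * (𝔼 x, F x ^ 2 - (𝔼 x, F x) ^ 2) ≤
      cubeEnergy F + exp L * ∑ i, (𝔼 x, |F x - F (flipAt x i)| / 2) ^ 2 := by
  have e := Fintype.equivFin ι
  have h := falik_samorodnitsky_fin _ (fun y => F (y ∘ e)) L
  rw [expect_comp_equiv e fun x => F x ^ 2, expect_comp_equiv e F] at h
  refine h.trans_eq ?_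
  unfold cubeEnergy
  rw [← Equiv.sum_comp e, ← Equiv.sum_comp e fun i => (𝔼 x, |F (x ∘ e) - _| / 2) ^ 2]
  congr 1
  · refine Finset.sum_congr rfl fun i _ => ?_
    rw [← expect_comp_equiv e]
    simp only [flipAt_comp_equiv]
  · congr 1
    refine Finset.sum_congr rfl fun i _ => ?_
    rw [← expect_comp_equiv e]
    simp only [flipAt_comp_equiv]

/-- The positive part of the discrete derivative. -/
noncomputable def posDiff {ι : Type*} [DecidableEq ι] (f : (ι → Bool) → ℝ) (i : ι)
    (x : ι → Bool) : ℝ :=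
  max (f x - f (flipAt x i)) 0

theorem posDiff_nonneg {ι : Type*} [DecidableEq ι] (f : (ι → Bool) → ℝ) (i : ι)
    (x : ι → Bool) : 0 ≤ posDiff f i x :=
  le_max_right _ _

theorem posDiff_flipAt {ι : Type*} [DecidableEq ι] (f : (ι → Bool) → ℝ) (i : ι)
    (x : ι → Bool) : posDiff f i (flipAt x i) = max (f (flipAt x i) - f x) 0 := by
  rw [posDiff, flipAt_flipAt]

theorem sq_sub_flipAt {ι : Type*} [DecidableEq ι] (f : (ι → Bool) → ℝ) (i : ι)
    (x : ι → Bool) :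
    (f x - f (flipAt x i)) ^ 2 = posDiff f i x ^ 2 + posDiff f i (flipAt x i) ^ 2 := by
  rw [posDiff_flipAt, posDiff]
  rcases le_total (f x) (f (flipAt x i)) with h | h
  · rw [max_eq_right (by linarith), max_eq_left (by linarith)]; ring
  · rw [max_eq_left (by linarith), max_eq_right (by linarith)]; ring

theorem abs_sub_flipAt {ι : Type*} [DecidableEq ι] (f : (ι → Bool) → ℝ) (i : ι)
    (x : ι → Bool) :
    |f x - f (flipAt x i)| = posDiff f i x + posDiff f i (flipAt x i) := by
  rw [posDiff_flipAt, posDiff]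
  rcases le_total (f x) (f (flipAt x i)) with h | h
  · rw [max_eq_right (by linarith), max_eq_left (by linarith), abs_of_nonpos (by linarith)]; ring
  · rw [max_eq_left (by linarith), max_eq_right (by linarith), abs_of_nonneg (by linarith)]; ring

theorem cubeEnergy_le_of_posDiff {ι : Type*} [DecidableEq ι] [Fintype ι]
    (f F : (ι → Bool) → ℝ) {K B : ℝ} (hK : 0 ≤ K) (hB : ∀ x, ∑ i, posDiff f i x ^ 2 ≤ B)
    (h : ∀ i x, (F x - F (flipAt x i)) ^ 2 ≤ K * (posDiff f i x ^ 2 * F x ^ 2 +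
      posDiff f i (flipAt x i) ^ 2 * F (flipAt x i) ^ 2)) :
    cubeEnergy F ≤ 2 * K * B * 𝔼 x, F x ^ 2 := by
  have h1 : ∀ i, 𝔼 x, (F x - F (flipAt x i)) ^ 2 ≤
      2 * K * 𝔼 x, posDiff f i x ^ 2 * F x ^ 2 := by
    intro i
    refine (Finset.expect_le_expect fun x _ => h i x).trans_eq ?_
    rw [← Finset.mul_expect, Finset.expect_add_distrib,
      expect_flipAt (fun x => posDiff f i x ^ 2 * F x ^ 2) i]
    ring
  calc cubeEnergy F ≤ ∑ i, 2 * K * 𝔼 x, posDiff f i x ^ 2 * F x ^ 2 :=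
        Finset.sum_le_sum fun i _ => h1 i
    _ = 2 * K * 𝔼 x, (∑ i, posDiff f i x ^ 2) * F x ^ 2 := by
        rw [← Finset.mul_sum, ← Finset.expect_sum_comm]
        simp only [Finset.sum_mul]
    _ ≤ 2 * K * 𝔼 x, B * F x ^ 2 := by
        refine mul_le_mul_of_nonneg_left (Finset.expect_le_expect fun x _ => ?_) (by positivity)
        exact mul_le_mul_of_nonneg_right (hB x) (sq_nonneg _)
    _ = 2 * K * B * 𝔼 x, F x ^ 2 := by
        rw [← Finset.mul_expect]; ring

theorem abs_exp_sub_exp_le (a b : ℝ) : |exp a - exp b| ≤ |a - b| * max (exp a) (exp b) := by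
  wlog h : b ≤ a generalizing a b
  · rw [abs_sub_comm, abs_sub_comm a, max_comm]
    exact this b a (le_of_not_ge h)
  have h1 := Real.add_one_le_exp (b - a)
  have h2 : exp b = exp (b - a) * exp a := by rw [← Real.exp_add]; ring_nf
  have h3 : exp b ≤ exp a := Real.exp_le_exp.2 h
  rw [abs_of_nonneg (by linarith), abs_of_nonneg (by linarith), max_eq_left h3]
  nlinarith [Real.exp_pos a]

theorem cube_variance_le {ι : Type*} [DecidableEq ι] [Fintype ι] (f : (ι → Bool) → ℝ) {B : ℝ}
    (hB : ∀ x, ∑ i, posDiff f i x ^ 2 ≤ B) :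
    𝔼 x, f x ^ 2 - (𝔼 x, f x) ^ 2 ≤ 5 / 2 * B := by
  have h1 : cubeEnergy f ≤ 2 * B := by
    unfold cubeEnergy
    simp only [sq_sub_flipAt, Finset.expect_add_distrib]
    have : ∀ i, 𝔼 x, posDiff f i (flipAt x i) ^ 2 = 𝔼 x, posDiff f i x ^ 2 := fun i =>
      expect_flipAt (fun x => posDiff f i x ^ 2) i
    simp only [this, ← two_mul]
    rw [← Finset.mul_sum, ← Finset.expect_sum_comm]
    have := Finset.expect_le_expect (s := Finset.univ) fun x _ => hB x
    rw [Fintype.expect_const] at this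
    linarith
  have h2 := falik_samorodnitsky_cube f 0
  have h3 : ∑ i, (𝔼 x, |f x - f (flipAt x i)| / 2) ^ 2 ≤ cubeEnergy f / 4 := by
    unfold cubeEnergy
    rw [Finset.sum_div]
    refine Finset.sum_le_sum fun i _ => ?_
    have := expect_mul_sq_le (fun x => |f x - f (flipAt x i)| / 2) fun _ => 1
    simp only [mul_one, one_pow, Fintype.expect_const, div_pow, sq_abs,
      ← Finset.expect_div] at this ⊢
    linarith
  rw [Real.exp_zero] at h2
  linarith

theorem cubeEnergy_exp_half_le {ι : Type*} [DecidableEq ι] [Fintype ι] (f : (ι → Bool) → ℝ) {B s : ℝ}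
    (hB : ∀ x, ∑ i, posDiff f i x ^ 2 ≤ B) (hs : 0 ≤ s) :
    cubeEnergy (fun x => exp (s * f x / 2)) ≤ s ^ 2 / 2 * B * 𝔼 x, exp (s * f x / 2) ^ 2 := by
  refine (cubeEnergy_le_of_posDiff f _ (K := s ^ 2 / 4) (by positivity) hB
    fun i x => ?_).trans_eq (by ring)
  wlog h : f (flipAt x i) ≤ f x generalizing x
  · have := this (flipAt x i) (by rw [flipAt_flipAt]; exact le_of_not_ge h)
    rw [flipAt_flipAt] at this
    rw [← neg_sq, neg_sub, add_comm]
    exact this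
  have h1 := abs_exp_sub_exp_le (s * f x / 2) (s * f (flipAt x i) / 2)
  have h2 : exp (s * f (flipAt x i) / 2) ≤ exp (s * f x / 2) := Real.exp_le_exp.2 (by gcongr)
  rw [max_eq_left h2] at h1
  have h3 := pow_le_pow_left₀ (abs_nonneg _) h1 2
  rw [sq_abs, mul_pow, sq_abs] at h3
  have h4 : (s * f x / 2 - s * f (flipAt x i) / 2) ^ 2 =
      s ^ 2 / 4 * posDiff f i x ^ 2 := by
    rw [posDiff, max_eq_left (by linarith)]; ring
  rw [h4] at h3
  refine h3.trans ?_
  have : 0 ≤ posDiff f i (flipAt x i) ^ 2 * exp (s * f (flipAt x i) / 2) ^ 2 := by positivity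
  nlinarith [sq_nonneg s]

theorem abs_exp_sub_exp_flipAt_le {ι : Type*} [DecidableEq ι] (f : (ι → Bool) → ℝ) {ρ s : ℝ}
    (hρ : ∀ i x, |f x - f (flipAt x i)| ≤ ρ) (hs : |s| * ρ ≤ 1) (i : ι) (x : ι → Bool) :
    |exp (s * f x / 2) - exp (s * f (flipAt x i) / 2)| ≤
      |s| / 2 * exp (1 / 2) * (posDiff f i x * exp (s * f x / 2) +
        posDiff f i (flipAt x i) * exp (s * f (flipAt x i) / 2)) := by
  have h1 := abs_exp_sub_exp_le (s * f x / 2) (s * f (flipAt x i) / 2)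
  have h2 : |s * f x / 2 - s * f (flipAt x i) / 2| = |s| / 2 * |f x - f (flipAt x i)| := by
    rw [← mul_div_right_comm, ← abs_mul, ← abs_two, ← abs_div, abs_two]
    congr 1; ring
  have h3 : ∀ a b : ℝ, |a - b| ≤ ρ → exp (s * a / 2) ≤ exp (1 / 2) * exp (s * b / 2) := by
    intro a b hab
    rw [← Real.exp_add]
    refine Real.exp_le_exp.2 ?_
    have : s * (a - b) ≤ 1 := (le_abs_self _).trans
      (by rw [abs_mul]; exact (mul_le_mul_of_nonneg_left hab (abs_nonneg _)).trans hs)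
    linarith
  have h4 := h3 _ _ (hρ i x)
  have h5 := h3 _ _ ((abs_sub_comm _ _).trans_le (hρ i x))
  have h6 : (1 : ℝ) ≤ exp (1 / 2) := Real.one_le_exp (by norm_num)
  have h7 : max (exp (s * f x / 2)) (exp (s * f (flipAt x i) / 2)) ≤
      exp (1 / 2) * exp (s * f x / 2) :=
    max_le (le_mul_of_one_le_left (exp_pos _).le h6) h5
  have h8 : max (exp (s * f x / 2)) (exp (s * f (flipAt x i) / 2)) ≤
      exp (1 / 2) * exp (s * f (flipAt x i) / 2) :=
    max_le h4 (le_mul_of_one_le_left (exp_pos _).le h6)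
  rw [h2, abs_sub_flipAt] at h1
  have h9 := mul_le_mul_of_nonneg_left h7 (posDiff_nonneg f i x)
  have h10 := mul_le_mul_of_nonneg_left h8 (posDiff_nonneg f i (flipAt x i))
  refine h1.trans ?_
  have : 0 ≤ |s| / 2 := by positivity
  calc _ = |s| / 2 * (posDiff f i x * max (exp (s * f x / 2)) (exp (s * f (flipAt x i) / 2)) +
        posDiff f i (flipAt x i) *
          max (exp (s * f x / 2)) (exp (s * f (flipAt x i) / 2))) := by ring
    _ ≤ |s| / 2 * (posDiff f i x * (exp (1 / 2) * exp (s * f x / 2)) +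
        posDiff f i (flipAt x i) * (exp (1 / 2) * exp (s * f (flipAt x i) / 2))) := by gcongr
    _ = _ := by ring

theorem posDiff_mul_posDiff_flipAt {ι : Type*} [DecidableEq ι] (f : (ι → Bool) → ℝ) (i : ι)
    (x : ι → Bool) : posDiff f i x * posDiff f i (flipAt x i) = 0 := by
  rw [posDiff_flipAt, posDiff]
  rcases le_total (f x) (f (flipAt x i)) with h | h
  · rw [max_eq_right (by linarith)]; ring
  · rw [max_eq_right (b := (0 : ℝ)) (a := f (flipAt x i) - f x) (by linarith)]; ring

theorem exp_variance_le {ι : Type*} [DecidableEq ι] [Fintype ι] (f : (ι → Bool) → ℝ)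
    {ρ s τ L : ℝ} (hB : ∀ x, ∑ i, posDiff f i x ^ 2 ≤ 4)
    (hρ : ∀ i x, |f x - f (flipAt x i)| ≤ ρ) (hs : |s| * ρ ≤ 1)
    (hτ : ∀ g : (ι → Bool) → ℝ, (∀ x, 0 ≤ g x) →
      ∑ i, (𝔼 x, g x * posDiff f i x) ^ 2 ≤ τ * 𝔼 x, g x ^ 2) :
    (1 + L) * (𝔼 x, exp (s * f x / 2) ^ 2 - (𝔼 x, exp (s * f x / 2)) ^ 2) ≤
      (6 + exp L * τ) * s ^ 2 * 𝔼 x, exp (s * f x / 2) ^ 2 := by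
  have he : exp (1 / 2) ^ 2 ≤ 3 := by
    rw [← Real.exp_nat_mul]; norm_num
    linarith [Real.exp_one_lt_d9]
  have hpt := abs_exp_sub_exp_flipAt_le f hρ hs
  set F : (ι → Bool) → ℝ := fun x => exp (s * f x / 2) with hF
  have h1 : cubeEnergy F ≤ 6 * s ^ 2 * 𝔼 x, F x ^ 2 := by
    refine (cubeEnergy_le_of_posDiff f F (K := s ^ 2 * 3 / 4) (by positivity) hB
      fun i x => ?_).trans_eq (by ring)
    have h2 := pow_le_pow_left₀ (abs_nonneg _) (hpt i x) 2
    rw [sq_abs, mul_pow, mul_pow, div_pow, sq_abs] at h2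
    have h3 : (posDiff f i x * exp (s * f x / 2) +
        posDiff f i (flipAt x i) * exp (s * f (flipAt x i) / 2)) ^ 2 =
        posDiff f i x ^ 2 * F x ^ 2 + posDiff f i (flipAt x i) ^ 2 * F (flipAt x i) ^ 2 := by
      have := posDiff_mul_posDiff_flipAt f i x
      simp only [hF]
      linear_combination 2 * exp (s * f x / 2) * exp (s * f (flipAt x i) / 2) * this
    rw [h3] at h2
    refine h2.trans (mul_le_mul_of_nonneg_right ?_ (by positivity))
    nlinarith [sq_nonneg s]
  have h2 : ∀ i, (𝔼 x, |F x - F (flipAt x i)| / 2) ^ 2 ≤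
      s ^ 2 * (𝔼 x, F x * posDiff f i x) ^ 2 := by
    intro i
    have h3 : 𝔼 x, |F x - F (flipAt x i)| / 2 ≤
        |s| / 2 * exp (1 / 2) * 𝔼 x, F x * posDiff f i x := by
      calc 𝔼 x, |F x - F (flipAt x i)| / 2
          ≤ 𝔼 x, |s| / 4 * exp (1 / 2) * (F x * posDiff f i x +
            F (flipAt x i) * posDiff f i (flipAt x i)) := by
              refine Finset.expect_le_expect fun x _ => ?_
              have := hpt i x
              simp only [hF]
              linarith
        _ = |s| / 2 * exp (1 / 2) * 𝔼 x, F x * posDiff f i x := by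
          rw [← Finset.mul_expect, Finset.expect_add_distrib,
            expect_flipAt (fun x => F x * posDiff f i x) i]
          ring
    have h0 : 0 ≤ 𝔼 x, |F x - F (flipAt x i)| / 2 :=
      Finset.expect_nonneg fun _ _ => by positivity
    have h4 := pow_le_pow_left₀ h0 h3 2
    rw [mul_pow, mul_pow, div_pow, sq_abs] at h4
    refine h4.trans (mul_le_mul_of_nonneg_right ?_ (sq_nonneg _))
    nlinarith [sq_nonneg s]
  have h3 : ∑ i, (𝔼 x, |F x - F (flipAt x i)| / 2) ^ 2 ≤ s ^ 2 * (τ * 𝔼 x, F x ^ 2) := by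
    refine (Finset.sum_le_sum fun i _ => h2 i).trans ?_
    rw [← Finset.mul_sum]
    exact mul_le_mul_of_nonneg_left (hτ F fun x => (exp_pos _).le) (sq_nonneg _)
  have h4 := falik_samorodnitsky_cube F L
  have h5 := mul_le_mul_of_nonneg_left h3 (exp_pos L).le
  linarith

theorem exp_neg_two_mul_le_one_sub {x : ℝ} (h0 : 0 ≤ x) (h1 : x ≤ 1 / 2) :
    exp (-(2 * x)) ≤ 1 - x := by
  rw [Real.exp_neg]
  have h2 := Real.add_one_le_exp (2 * x)
  rw [inv_le_comm₀ (exp_pos _) (by linarith)]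
  refine le_trans ?_ h2
  rw [inv_le_iff_one_le_mul₀ (by linarith)]
  nlinarith

/-- Exponential moments of a mean-zero function satisfying a self-improving inequality. -/
theorem le_exp_of_iterate {M : ℝ → ℝ} {A V s : ℝ} (hM0 : ∀ s, 0 ≤ M s) (hA : 0 ≤ A)
    (hV : ∀ᶠ j : ℕ in Filter.atTop, M (s / 2 ^ j) ≤ exp ((s / 2 ^ j) ^ 2 * V))
    (hstep : ∀ r, |r| ≤ |s| → M r * (1 - A * r ^ 2) ≤ M (r / 2) ^ 2) (hs : A * s ^ 2 ≤ 1 / 2) :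
    M s ≤ exp (4 * A * s ^ 2) := by
  have h1 : ∀ r, |r| ≤ |s| → M r ≤ exp (2 * A * r ^ 2) * M (r / 2) ^ 2 := by
    intro r hr
    have hr2 : r ^ 2 ≤ s ^ 2 := sq_le_sq.2 hr
    have h2 : A * r ^ 2 ≤ 1 / 2 := (mul_le_mul_of_nonneg_left hr2 hA).trans hs
    have h3 := exp_neg_two_mul_le_one_sub (by positivity) h2
    have h4 := (mul_le_mul_of_nonneg_left h3 (hM0 r)).trans (hstep r hr)
    have h5 := mul_le_mul_of_nonneg_left h4 (exp_pos (2 * A * r ^ 2)).le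
    refine le_trans (le_of_eq ?_) h5
    rw [mul_left_comm, ← Real.exp_add]
    ring_nf; simp
  have h2 : ∀ j : ℕ, M s ≤ exp (4 * A * s ^ 2 * (1 - (1 / 2) ^ j)) * M (s / 2 ^ j) ^ (2 ^ j) := by
    intro j
    induction j with
    | zero => simp
    | succ j ih =>
      refine ih.trans ?_
      have h3 := h1 (s / 2 ^ j) (by
        rw [abs_div]
        refine div_le_self (abs_nonneg _) ?_
        rw [abs_of_pos (by positivity)]
        exact one_le_pow₀ (by norm_num))
      have h4 := pow_le_pow_left₀ (hM0 _) h3 (2 ^ j)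
      refine (mul_le_mul_of_nonneg_left h4 (exp_pos _).le).trans_eq ?_
      rw [mul_pow, ← Real.exp_nat_mul, ← mul_assoc, ← Real.exp_add, ← pow_mul, div_div,
        ← pow_succ, ← pow_succ']
      congr 2
      have : (2 : ℝ) ^ j ≠ 0 := by positivity
      push_cast
      rw [one_div, inv_pow, inv_pow, pow_succ]
      field_simp
      ring
  have h3 : ∀ᶠ j : ℕ in Filter.atTop, M s ≤ exp (4 * A * s ^ 2 + s ^ 2 * V * (1 / 2) ^ j) := by
    filter_upwards [hV] with j hj
    refine (h2 j).trans ?_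
    have h4 := pow_le_pow_left₀ (hM0 _) hj (2 ^ j)
    have h5 := mul_le_mul_of_nonneg_left h4 (exp_pos (4 * A * s ^ 2 * (1 - (1 / 2) ^ j))).le
    refine h5.trans ?_
    rw [← Real.exp_nat_mul, ← Real.exp_add]
    refine Real.exp_le_exp.2 ?_
    have h6 : (0 : ℝ) ≤ 4 * A * s ^ 2 * (1 / 2) ^ j := by positivity
    have h7 : ((2 ^ j : ℕ) : ℝ) * ((s / 2 ^ j) ^ 2 * V) = s ^ 2 * V * (1 / 2) ^ j := by
      have : (2 : ℝ) ^ j ≠ 0 := by positivity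
      push_cast
      rw [one_div, inv_pow]
      field_simp
    rw [h7]
    linarith
  have h4 : Filter.Tendsto (fun j : ℕ => exp (4 * A * s ^ 2 + s ^ 2 * V * (1 / 2) ^ j))
      Filter.atTop (nhds (exp (4 * A * s ^ 2 + s ^ 2 * V * 0))) := by
    refine (Real.continuous_exp.tendsto _).comp ?_
    exact ((tendsto_pow_atTop_nhds_zero_of_lt_one (by norm_num) (by norm_num)).const_mul
      _).const_add _
  have := ge_of_tendsto h4 h3
  simpa using this

theorem expect_exp_centered_le {α : Type*} [Fintype α] [Nonempty α] (f : α → ℝ) :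
    ∃ V δ : ℝ, 0 < δ ∧ ∀ r, |r| ≤ δ → 𝔼 x, exp (r * (f x - 𝔼 y, f y)) ≤ exp (r ^ 2 * V) := by
  set m := 𝔼 y, f y with hm
  obtain ⟨B, hB⟩ := (Set.finite_range fun x => |f x - m|).bddAbove
  have hB' : ∀ x, |f x - m| ≤ |B| + 1 := fun x =>
    (hB ⟨x, rfl⟩).trans ((le_abs_self B).trans (by linarith))
  refine ⟨(|B| + 1) ^ 2, 1 / (|B| + 1), by positivity, fun r hr => ?_⟩
  rw [le_div_iff₀ (by positivity)] at hr
  have h1 : ∀ x, exp (r * (f x - m)) ≤ 1 + r * (f x - m) + r ^ 2 * (|B| + 1) ^ 2 := by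
    intro x
    have h2 : |r * (f x - m)| ≤ 1 := by
      rw [abs_mul]; exact (mul_le_mul_of_nonneg_left (hB' x) (abs_nonneg _)).trans hr
    have h3 := (abs_le.1 (Real.abs_exp_sub_one_sub_id_le h2)).2
    have h4 : (r * (f x - m)) ^ 2 ≤ r ^ 2 * (|B| + 1) ^ 2 := by
      rw [mul_pow]
      exact mul_le_mul_of_nonneg_left (sq_le_sq' (by linarith [(abs_le.1 (hB' x)).1])
        ((le_abs_self _).trans (hB' x))) (sq_nonneg _)
    linarith
  refine (Finset.expect_le_expect fun x _ => h1 x).trans ?_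
  rw [Finset.expect_add_distrib, Finset.expect_add_distrib, Fintype.expect_const,
    Fintype.expect_const, ← Finset.mul_expect, Finset.expect_sub_distrib, Fintype.expect_const,
    ← hm, sub_self, mul_zero, add_zero]
  linarith [Real.add_one_le_exp (r ^ 2 * (|B| + 1) ^ 2)]

theorem expect_exp_le_of_posDiff {ι : Type*} [DecidableEq ι] [Fintype ι] (f : (ι → Bool) → ℝ)
    {ρ s τ L : ℝ} (hB : ∀ x, ∑ i, posDiff f i x ^ 2 ≤ 4)
    (hρ : ∀ i x, |f x - f (flipAt x i)| ≤ ρ) (hρ0 : 0 ≤ ρ) (hτ0 : 0 ≤ τ) (hL : 0 ≤ L)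
    (hs : |s| * ρ ≤ 1)
    (hτ : ∀ g : (ι → Bool) → ℝ, (∀ x, 0 ≤ g x) →
      ∑ i, (𝔼 x, g x * posDiff f i x) ^ 2 ≤ τ * 𝔼 x, g x ^ 2)
    (hsA : (6 + exp L * τ) / (1 + L) * s ^ 2 ≤ 1 / 2) :
    𝔼 x, exp (s * f x) ≤
      exp (s * (𝔼 x, f x) + 4 * ((6 + exp L * τ) / (1 + L)) * s ^ 2) := by
  set A := (6 + exp L * τ) / (1 + L) with hA
  set m := 𝔼 x, f x with hm
  obtain ⟨V, δ, hδ, hV⟩ := expect_exp_centered_le f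
  have hA0 : 0 ≤ A := by positivity
  have key : 𝔼 x, exp (s * (f x - m)) ≤ exp (4 * A * s ^ 2) := by
    refine le_exp_of_iterate (M := fun s => 𝔼 x, exp (s * (f x - m)))
      (fun s => Finset.expect_nonneg fun _ _ => (exp_pos _).le) hA0 (V := V) ?_ ?_ hsA
    · have h1 : Filter.Tendsto (fun j : ℕ => |s / 2 ^ j|) Filter.atTop (nhds 0) := by
        have : Filter.Tendsto (fun j : ℕ => |s * (1 / 2) ^ j|) Filter.atTop (nhds |s * 0|) :=
          ((tendsto_pow_atTop_nhds_zero_of_lt_one (by norm_num) (by norm_num)).const_mul s).abs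
        simpa [div_eq_mul_inv] using this
      filter_upwards [h1.eventually (gt_mem_nhds hδ)] with j hj
      exact hV _ hj.le
    · intro r hr
      have h1 := exp_variance_le f (s := r) (L := L) hB hρ
        ((mul_le_mul_of_nonneg_right hr hρ0).trans hs) hτ
      have h2 : ∀ x, exp (r * f x / 2) ^ 2 = exp (r * m) * exp (r * (f x - m)) := by
        intro x
        rw [← Real.exp_nat_mul, ← Real.exp_add]; congr 1; push_cast; ring
      have h3 : ∀ x, exp (r * f x / 2) = exp (r * m / 2) * exp (r / 2 * (f x - m)) := by
        intro x
        rw [← Real.exp_add]; congr 1; ring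
      simp only [h2] at h1
      simp only [h3, ← Finset.mul_expect] at h1
      have h4 : exp (r * m / 2) ^ 2 = exp (r * m) := by
        rw [← Real.exp_nat_mul]; congr 1; push_cast; ring
      rw [mul_pow, h4] at h1
      have h5 : (6 + exp L * τ) = A * (1 + L) := by rw [hA]; field_simp
      rw [h5] at h1
      have h6 : 0 < (1 + L) * exp (r * m) := by positivity
      refine le_of_mul_le_mul_left ?_ h6
      linarith
  have e : ∀ x, exp (s * f x) = exp (s * m) * exp (s * (f x - m)) := by
    intro x
    rw [← Real.exp_add]; congr 1; ring
  simp only [e, ← Finset.mul_expect]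
  rw [Real.exp_add]
  gcongr

theorem hasDerivAt_expect_exp {α : Type*} [Fintype α] (f : α → ℝ) (s : ℝ) :
    HasDerivAt (fun s => 𝔼 x, exp (s * f x)) (𝔼 x, f x * exp (s * f x)) s := by
  simp only [Fintype.expect_eq_sum_div_card]
  refine HasDerivAt.div_const (HasDerivAt.fun_sum fun x _ => ?_) _
  have := ((hasDerivAt_id s).mul_const (f x)).exp
  simpa [mul_comm] using this

theorem expect_exp_le_herbst {ι : Type*} [DecidableEq ι] [Fintype ι] (f : (ι → Bool) → ℝ)
    {B s : ℝ} (hB : ∀ x, ∑ i, posDiff f i x ^ 2 ≤ B) (hs : 0 ≤ s) :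
    𝔼 x, exp (s * f x) ≤ exp (s * (𝔼 x, f x) + B / 2 * s ^ 2) := by
  rcases eq_or_lt_of_le hs with h0 | h0
  · simp [← h0]
  set M : ℝ → ℝ := fun s => 𝔼 x, exp (s * f x) with hM
  have hMpos : ∀ s, 0 < M s := fun s => Finset.expect_pos (fun _ _ => exp_pos _)
    Finset.univ_nonempty
  have hder : ∀ s, HasDerivAt (fun s => log (M s)) ((𝔼 x, f x * exp (s * f x)) / M s) s :=
    fun s => (hasDerivAt_expect_exp f s).log (hMpos s).ne'
  have hent : ∀ s, 0 ≤ s → s * (𝔼 x, f x * exp (s * f x)) - M s * log (M s) ≤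
      B / 2 * s ^ 2 * M s := by
    intro s hs
    have h1 := (log_sobolev_cube fun x => exp (s * f x / 2)).trans (cubeEnergy_exp_half_le f hB hs)
    have h2 : ∀ x, exp (s * f x / 2) ^ 2 = exp (s * f x) := by
      intro x
      rw [← Real.exp_nat_mul]; congr 1; push_cast; ring
    simp only [h2, Real.log_exp] at h1
    have h3 : 𝔼 x, exp (s * f x) * (s * f x) = s * 𝔼 x, f x * exp (s * f x) := by
      rw [Finset.mul_expect]
      exact Finset.expect_congr rfl fun x _ => by ring
    rw [h3] at h1
    simp only [hM]
    linarith
  have hψ : ∀ s ∈ Set.Ioi (0 : ℝ), HasDerivAt (fun s => log (M s) / s - B / 2 * s)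
      (((𝔼 x, f x * exp (s * f x)) / M s * s - log (M s) * 1) / s ^ 2 - B / 2 * 1) s :=
    fun s hs => ((hder s).div (hasDerivAt_id s) (ne_of_gt hs)).sub
      ((hasDerivAt_id s).const_mul _)
  have hanti : AntitoneOn (fun s => log (M s) / s - B / 2 * s) (Set.Ioi 0) := by
    refine antitoneOn_of_deriv_nonpos (convex_Ioi 0)
      (fun s hs => (hψ s hs).continuousAt.continuousWithinAt)
      (fun s hs => (hψ s (interior_subset hs)).differentiableAt.differentiableWithinAt)
      fun s hs => ?_
    have hs' := interior_subset hs
    have hs0 : 0 < s := hs'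
    rw [(hψ s hs').deriv, sub_nonpos, div_le_iff₀ (by positivity)]
    have h1 := hent s hs0.le
    have h2 := hMpos s
    have h3 : (𝔼 x, f x * exp (s * f x)) / M s * s - log (M s) * 1 =
        (s * (𝔼 x, f x * exp (s * f x)) - M s * log (M s)) / M s := by
      rw [sub_div, mul_div_cancel_left₀ _ h2.ne', mul_one, mul_comm s, mul_div_right_comm]
    rw [h3, div_le_iff₀ h2]
    linarith
  have hlim : Filter.Tendsto (fun s => log (M s) / s - B / 2 * s)
      (nhdsWithin 0 (Set.Ioi 0)) (nhds (𝔼 x, f x)) := by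
    have hM0 : M 0 = 1 := by simp [hM]
    have h1 := (hder 0).tendsto_slope_zero_right
    simp only [zero_add, hM0, Real.log_one, sub_zero, smul_eq_mul, zero_mul, Real.exp_zero,
      mul_one, div_one] at h1
    have h2 : Filter.Tendsto (fun s : ℝ => B / 2 * s) (nhdsWithin 0 (Set.Ioi 0)) (nhds 0) := by
      have : Filter.Tendsto (fun s : ℝ => B / 2 * s) (nhds 0) (nhds (B / 2 * 0)) :=
        Filter.Tendsto.const_mul _ Filter.tendsto_id
      rw [mul_zero] at this
      exact this.mono_left nhdsWithin_le_nhds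
    have := h1.sub h2
    rw [sub_zero] at this
    refine this.congr fun s => ?_
    simp only [div_eq_inv_mul]
  have h1 : log (M s) / s - B / 2 * s ≤ 𝔼 x, f x := by
    refine ge_of_tendsto hlim ?_
    filter_upwards [Ioo_mem_nhdsGT h0] with r hr
    exact hanti (Set.mem_Ioi.2 hr.1) (Set.mem_Ioi.2 h0) hr.2.le
  rw [← Real.log_le_iff_le_exp (hMpos s)]
  rw [sub_le_iff_le_add, div_le_iff₀ h0] at h1
  linarith

/-- `N` is a norm on `ℝⁿ`. -/
structure IsNormFun {n : ℕ} (N : (Fin n → ℝ) → ℝ) : Prop where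
  add_le : ∀ x y, N (x + y) ≤ N x + N y
  smul_eq : ∀ (r : ℝ) (x), N (r • x) = |r| * N x
  eq_zero : ∀ x, N x = 0 → x = 0

namespace IsNormFun

variable {n : ℕ} {N : (Fin n → ℝ) → ℝ}

theorem zero (hN : IsNormFun N) : N 0 = 0 := by
  have := hN.smul_eq 0 0
  simpa using this

theorem neg (hN : IsNormFun N) (x : Fin n → ℝ) : N (-x) = N x := by
  have := hN.smul_eq (-1) x
  simpa using this

theorem nonneg (hN : IsNormFun N) (x : Fin n → ℝ) : 0 ≤ N x := by
  have h := hN.add_le x (-x)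
  rw [add_neg_cancel, hN.zero, hN.neg] at h
  linarith

theorem sub_le (hN : IsNormFun N) (x y : Fin n → ℝ) : N x - N y ≤ N (x - y) := by
  have h := hN.add_le (x - y) y
  rw [sub_add_cancel] at h
  linarith

theorem abs_sub_le (hN : IsNormFun N) (x y : Fin n → ℝ) : |N x - N y| ≤ N (x - y) := by
  refine abs_le.2 ⟨?_, hN.sub_le x y⟩
  have := hN.sub_le y x
  rw [← hN.neg (y - x), neg_sub] at this
  linarith

theorem sum_le (hN : IsNormFun N) {α : Type*} (s : Finset α) (v : α → Fin n → ℝ) :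
    N (∑ i ∈ s, v i) ≤ ∑ i ∈ s, N (v i) := by
  classical
  induction s using Finset.induction_on with
  | empty => simp [hN.zero]
  | insert a s ha ih =>
    rw [Finset.sum_insert ha, Finset.sum_insert ha]
    exact (hN.add_le _ _).trans (by linarith)

theorem expect_le (hN : IsNormFun N) {α : Type*} [Fintype α] (v : α → Fin n → ℝ) :
    N (fun j => 𝔼 i, v i j) ≤ 𝔼 i, N (v i) := by
  rw [Fintype.expect_eq_sum_div_card]
  have : (fun j => 𝔼 i, v i j) = (1 / (Fintype.card α : ℝ)) • ∑ i, v i := by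
    ext j
    rw [Fintype.expect_eq_sum_div_card]
    simp [Finset.sum_apply, div_eq_inv_mul]
  rw [this, hN.smul_eq, abs_of_nonneg (by positivity), div_eq_inv_mul (∑ i, _), one_div]
  exact mul_le_mul_of_nonneg_left (hN.sum_le _ _) (by positivity)

theorem le_sum_single (hN : IsNormFun N) (x : Fin n → ℝ) :
    N x ≤ ∑ j, |x j| * N (Pi.single j 1) := by
  conv_lhs => rw [pi_eq_sum_univ' x]
  refine (hN.sum_le _ _).trans (le_of_eq ?_)
  exact Finset.sum_congr rfl fun j _ => hN.smul_eq _ _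

theorem continuous (hN : IsNormFun N) : Continuous N := by
  rw [continuous_iff_continuousAt]
  intro x
  rw [ContinuousAt, tendsto_iff_dist_tendsto_zero]
  have h : Filter.Tendsto (fun y => ∑ j, |y j - x j| * N (Pi.single j 1)) (nhds x) (nhds 0) := by
    have : Continuous fun y : Fin n → ℝ => ∑ j, |y j - x j| * N (Pi.single j 1) := by fun_prop
    have := this.tendsto x
    simpa using this
  refine squeeze_zero (fun _ => dist_nonneg) (fun y => ?_) h
  rw [Real.dist_eq]
  exact (hN.abs_sub_le y x).trans (hN.le_sum_single (y - x))

theorem exists_norming (hN : IsNormFun N) (x : Fin n → ℝ) :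
    ∃ θ : Fin n → ℝ, (∀ y, ∑ j, θ j * y j ≤ N y) ∧ ∑ j, θ j * x j = N x := by
  rcases eq_or_ne x 0 with rfl | hx
  · exact ⟨0, fun y => by simpa using hN.nonneg y, by simp [hN.zero]⟩
  obtain ⟨g, hg1, hg2⟩ := exists_extension_of_le_sublinear
    (LinearPMap.mkSpanSingleton (K := ℝ) x (N x) hx) N
    (fun c hc y => by rw [hN.smul_eq, abs_of_pos hc]) hN.add_le (by
      rintro ⟨y, hy⟩
      obtain ⟨c, rfl⟩ := Submodule.mem_span_singleton.1 hy
      rw [LinearPMap.mkSpanSingleton'_apply, hN.smul_eq, smul_eq_mul]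
      exact mul_le_mul_of_nonneg_right (le_abs_self c) (hN.nonneg x))
  have h1 : g x = N x := by
    have := hg1 ⟨x, Submodule.mem_span_singleton_self x⟩
    rw [this]
    exact LinearPMap.mkSpanSingleton_apply ℝ ℝ hx (N x)
  have h2 : ∀ y, ∑ j, g (Pi.single j 1) * y j = g y := by
    intro y
    conv_rhs => rw [pi_eq_sum_univ' y]
    rw [map_sum]
    exact Finset.sum_congr rfl fun j _ => by rw [map_smul, smul_eq_mul, mul_comm]
  exact ⟨fun j => g (Pi.single j 1), fun y => (h2 y).trans_le (hg2 y), (h2 x).trans h1⟩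

theorem sum_sq_le_one (hE : ∀ x, N x ^ 2 ≤ ∑ j, x j ^ 2)
    {θ : Fin n → ℝ} (hθ : ∀ y, ∑ j, θ j * y j ≤ N y) : ∑ j, θ j ^ 2 ≤ 1 := by
  have h1 := hθ θ
  have h2 := hE θ
  simp only [← sq] at h1
  have h3 : 0 ≤ ∑ j, θ j ^ 2 := Finset.sum_nonneg fun _ _ => sq_nonneg _
  nlinarith

end IsNormFun

/-- The sign `±1` of a bit. -/
def bitSign (b : Bool) : ℝ := if b then 1 else -1

theorem abs_bitSign (b : Bool) : |bitSign b| = 1 := by cases b <;> simp [bitSign]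

theorem bitSign_not (b : Bool) : bitSign (!b) = -bitSign b := by cases b <;> simp [bitSign]

theorem bitSign_sq (b : Bool) : bitSign b ^ 2 = 1 := by cases b <;> simp [bitSign]

/-- Weighted normalised sums of signs, `k` signs for every coordinate. -/
noncomputable def signVec {n k : ℕ} (a : Fin n × Fin k → ℝ) (x : Fin n × Fin k → Bool) :
    Fin n → ℝ :=
  fun j => (∑ l, bitSign (x (j, l)) * a (j, l)) / √k

theorem signVec_sub_flipAt {n k : ℕ} (a : Fin n × Fin k → ℝ) (x : Fin n × Fin k → Bool)
    (i : Fin n × Fin k) :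
    signVec a x - signVec a (flipAt x i) =
      (2 * bitSign (x i) * a i / √k) • Pi.single i.1 1 := by
  ext j
  simp only [signVec, Pi.sub_apply, Pi.smul_apply, smul_eq_mul]
  rw [← sub_div, ← Finset.sum_sub_distrib]
  by_cases h : j = i.1
  · subst h
    rw [Finset.sum_eq_single i.2]
    · simp [flipAt, bitSign_not]; ring
    · intro l _ hl
      have : (i.1, l) ≠ i := fun h => hl (by rw [← h])
      simp [flipAt, this]
    · simp
  · rw [Finset.sum_eq_zero]
    · simp [h]
    · intro l _
      have : (j, l) ≠ i := fun h' => h (by rw [← h'])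
      simp [flipAt, this]

theorem IsNormFun.posDiff_signVec_le {n k : ℕ} {N : (Fin n → ℝ) → ℝ}
    (a : Fin n × Fin k → ℝ) (x : Fin n × Fin k → Bool) {θ : Fin n → ℝ}
    (h1 : ∀ y, ∑ j, θ j * y j ≤ N y) (h2 : ∑ j, θ j * signVec a x j = N (signVec a x))
    (i : Fin n × Fin k) :
    posDiff (fun x => N (signVec a x)) i x ≤ 2 * |θ i.1| * |a i| / √k := by
  refine max_le ?_ (by positivity)
  have h3 := h1 (signVec a (flipAt x i))
  have h4 : ∑ j, θ j * signVec a x j - ∑ j, θ j * signVec a (flipAt x i) j =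
      θ i.1 * (2 * bitSign (x i) * a i / √k) := by
    rw [← Finset.sum_sub_distrib]
    have := signVec_sub_flipAt a x i
    have h5 : ∀ j, θ j * signVec a x j - θ j * signVec a (flipAt x i) j =
        θ j * ((2 * bitSign (x i) * a i / √k) • (Pi.single i.1 1 : Fin n → ℝ)) j := by
      intro j
      rw [← this, Pi.sub_apply]; ring
    simp only [h5]
    rw [Finset.sum_eq_single i.1]
    · simp
    · intro j _ hj; simp [hj]
    · simp
  calc N (signVec a x) - N (signVec a (flipAt x i))
      ≤ θ i.1 * (2 * bitSign (x i) * a i / √k) := by linarith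
    _ ≤ |θ i.1 * (2 * bitSign (x i) * a i / √k)| := le_abs_self _
    _ = 2 * |θ i.1| * |a i| / √k := by
      rw [abs_mul, abs_div, abs_mul, abs_mul, abs_bitSign, abs_two,
        abs_of_nonneg (Real.sqrt_nonneg _)]
      ring

theorem IsNormFun.sum_posDiff_sq_le {n k : ℕ} {N : (Fin n → ℝ) → ℝ} (hN : IsNormFun N)
    (hE : ∀ x, N x ^ 2 ≤ ∑ j, x j ^ 2) {a : Fin n × Fin k → ℝ} (ha : ∀ i, |a i| ≤ 1)
    (x : Fin n × Fin k → Bool) :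
    ∑ i, posDiff (fun x => N (signVec a x)) i x ^ 2 ≤ 4 := by
  obtain ⟨θ, h1, h2⟩ := hN.exists_norming (signVec a x)
  have h3 := IsNormFun.sum_sq_le_one hE h1
  rcases Nat.eq_zero_or_pos k with rfl | hk
  · simp
  calc ∑ i, posDiff (fun x => N (signVec a x)) i x ^ 2
      ≤ ∑ i : Fin n × Fin k, 4 * θ i.1 ^ 2 / k := by
        refine Finset.sum_le_sum fun i _ => ?_
        have h4 := pow_le_pow_left₀ (posDiff_nonneg _ _ _)
          (IsNormFun.posDiff_signVec_le a x h1 h2 i) 2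
        rw [div_pow, Real.sq_sqrt (by positivity), mul_pow, mul_pow, sq_abs] at h4
        refine h4.trans ?_
        have h5 : |a i| ^ 2 ≤ 1 := pow_le_one₀ (abs_nonneg _) (ha i)
        have h6 : (2 : ℝ) ^ 2 * θ i.1 ^ 2 * |a i| ^ 2 ≤ 4 * θ i.1 ^ 2 := by
          nlinarith [sq_nonneg (θ i.1)]
        gcongr
    _ = 4 * ∑ j, θ j ^ 2 := by
        have : (k : ℝ) ≠ 0 := by positivity
        rw [Fintype.sum_prod_type, Finset.mul_sum]
        refine Finset.sum_congr rfl fun j _ => ?_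
        simp
        field_simp
    _ ≤ 4 := by linarith

theorem IsNormFun.abs_sub_flipAt_signVec_le {n k : ℕ} {N : (Fin n → ℝ) → ℝ} (hN : IsNormFun N)
    (hE : ∀ x, N x ^ 2 ≤ ∑ j, x j ^ 2) (a : Fin n × Fin k → ℝ)
    (i : Fin n × Fin k) (x : Fin n × Fin k → Bool) :
    |N (signVec a x) - N (signVec a (flipAt x i))| ≤ 2 * |a i| / √k := by
  refine (hN.abs_sub_le _ _).trans ?_
  rw [signVec_sub_flipAt, hN.smul_eq]
  have h1 : N (Pi.single i.1 1) ≤ 1 := by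
    have := hE (Pi.single i.1 1)
    rw [Finset.sum_eq_single i.1 (by intro j _ hj; simp [hj]) (by simp)] at this
    simp only [Pi.single_eq_same] at this
    nlinarith [hN.nonneg (Pi.single i.1 1)]
  rw [abs_div, abs_mul, abs_mul, abs_bitSign, abs_two, abs_of_nonneg (Real.sqrt_nonneg _), mul_one]
  exact mul_le_of_le_one_right (by positivity) h1

instance (n : ℕ) : IsProbabilityMeasure (stdGaussian n) := by
  unfold _root_.stdGaussian; infer_instance

theorem abs_prod_sub_prod_le {α : Type*} (s : Finset α) (f g : α → ℝ) (hf : ∀ i, |f i| ≤ 1)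
    (hg : ∀ i, |g i| ≤ 1) : |∏ i ∈ s, f i - ∏ i ∈ s, g i| ≤ ∑ i ∈ s, |f i - g i| := by
  classical
  induction s using Finset.induction_on with
  | empty => simp
  | insert a s ha ih =>
    rw [Finset.prod_insert ha, Finset.prod_insert ha, Finset.sum_insert ha]
    have h1 : |∏ i ∈ s, g i| ≤ 1 := by
      rw [Finset.abs_prod]
      exact Finset.prod_le_one (fun _ _ => abs_nonneg _) fun i _ => hg i
    have e : f a * ∏ i ∈ s, f i - g a * ∏ i ∈ s, g i =
        f a * (∏ i ∈ s, f i - ∏ i ∈ s, g i) + (f a - g a) * ∏ i ∈ s, g i := by ring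
    rw [e]
    refine (abs_add_le _ _).trans ?_
    rw [abs_mul, abs_mul, add_comm]
    exact add_le_add (mul_le_of_le_one_right (abs_nonneg _) h1)
      ((mul_le_of_le_one_left (abs_nonneg _) (hf a)).trans ih)

theorem abs_cos_sub_exp_le {z : ℝ} (hz : |z| ≤ 1) : |cos z - exp (-(z ^ 2 / 2))| ≤ |z| ^ 4 := by
  have h1 := Real.cos_bound hz
  have h2 : z ^ 2 ≤ 1 := by rw [← sq_abs]; exact pow_le_one₀ (abs_nonneg _) hz
  have h3 : |-(z ^ 2 / 2)| ≤ 1 := by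
    rw [abs_neg, abs_of_nonneg (by positivity)]; linarith
  have h4 := Real.abs_exp_sub_one_sub_id_le h3
  have h5 : cos z - exp (-(z ^ 2 / 2)) = (cos z - (1 - z ^ 2 / 2)) -
    (exp (-(z ^ 2 / 2)) - 1 - -(z ^ 2 / 2)) := by ring
  rw [h5]
  refine (abs_sub _ _).trans ?_
  have h6 : (-(z ^ 2 / 2)) ^ 2 = |z| ^ 4 / 4 := by
    have : |z| ^ 4 = (|z| ^ 2) ^ 2 := by ring
    rw [this, sq_abs]; ring
  have : 0 ≤ |z| ^ 4 := by positivity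
  linarith

theorem expect_prod_bits {ι : Type*} [DecidableEq ι] [Fintype ι] (c : ι → Bool → ℂ) :
    (∑ x : ι → Bool, ∏ i, c i (x i)) / (Fintype.card (ι → Bool) : ℂ) =
      ∏ i, (c i true + c i false) / 2 := by
  have h := Finset.prod_univ_sum (fun _ : ι => (Finset.univ : Finset Bool)) c
  rw [Fintype.piFinset_univ] at h
  rw [← h, Finset.prod_div_distrib]
  simp

theorem integral_uniformOfFintype {α E : Type*} [Fintype α] [Nonempty α] [MeasurableSpace α]
    [MeasurableSingletonClass α] [NormedAddCommGroup E] [NormedSpace ℝ E] [CompleteSpace E]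
    (f : α → E) :
    ∫ x, f x ∂(PMF.uniformOfFintype α).toMeasure = (Fintype.card α : ℝ)⁻¹ • ∑ x, f x := by
  rw [PMF.integral_eq_sum, Finset.smul_sum]
  refine Finset.sum_congr rfl fun x _ => ?_
  simp

/-- The law on Euclidean space of the weighted sign vector. -/
noncomputable def signLaw {n k : ℕ} (a : Fin n × Fin k → ℝ) :
    ProbabilityMeasure (EuclideanSpace ℝ (Fin n)) :=
  ⟨(PMF.uniformOfFintype (Fin n × Fin k → Bool)).toMeasure.map
    (fun x => WithLp.toLp 2 (signVec a x)),
    Measure.isProbabilityMeasure_map (measurable_of_finite _).aemeasurable⟩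

theorem charFun_signLaw {n k : ℕ} (a : Fin n × Fin k → ℝ) (t : EuclideanSpace ℝ (Fin n)) :
    charFun (signLaw a : Measure (EuclideanSpace ℝ (Fin n))) t =
      ((∏ i, cos (t i.1 * a i / √k) : ℝ) : ℂ) := by
  rw [charFun_apply, signLaw, ProbabilityMeasure.coe_mk, integral_map
    (measurable_of_finite _).aemeasurable (by fun_prop), integral_uniformOfFintype]
  have h1 : ∀ x : Fin n × Fin k → Bool,
      Complex.exp (inner ℝ (WithLp.toLp 2 (signVec a x)) t * Complex.I) =
        ∏ i, Complex.exp (bitSign (x i) * ((t i.1 * a i / √k : ℝ) : ℂ) * Complex.I) := by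
    intro x
    rw [← Complex.exp_sum, ← Finset.sum_mul]
    congr 2
    rw [PiLp.inner_apply, Fintype.sum_prod_type, Complex.ofReal_sum]
    refine Finset.sum_congr rfl fun j _ => ?_
    simp only [signVec, RCLike.inner_apply, conj_trivial]
    rw [mul_div_assoc', Finset.mul_sum, Finset.sum_div, Complex.ofReal_sum]
    refine Finset.sum_congr rfl fun l _ => ?_
    push_cast
    ring
  simp only [h1]
  have h2 := expect_prod_bits fun (i : Fin n × Fin k) b =>
    Complex.exp (bitSign b * ((t i.1 * a i / √k : ℝ) : ℂ) * Complex.I)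
  rw [Complex.real_smul, mul_comm, Complex.ofReal_inv, ← div_eq_mul_inv]
  simp only [Complex.ofReal_natCast]
  rw [h2, Complex.ofReal_prod]
  refine Finset.prod_congr rfl fun i _ => ?_
  rw [Complex.ofReal_cos, Complex.cos]
  simp [bitSign]

theorem measurable_toLp_diag {n : ℕ} (s : Fin n → ℝ) :
    Measurable fun y : Fin n → ℝ => WithLp.toLp 2 fun j => √(s j) * y j :=
  Continuous.measurable (by fun_prop)

/-- The law on Euclidean space of a diagonal image of the standard Gaussian. -/
noncomputable def diagGaussian {n : ℕ} (s : Fin n → ℝ) :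
    ProbabilityMeasure (EuclideanSpace ℝ (Fin n)) :=
  ⟨(stdGaussian n).map (fun y => WithLp.toLp 2 fun j => √(s j) * y j),
    Measure.isProbabilityMeasure_map (measurable_toLp_diag s).aemeasurable⟩

theorem charFun_diagGaussian {n : ℕ} {s : Fin n → ℝ} (hs : ∀ j, 0 ≤ s j)
    (t : EuclideanSpace ℝ (Fin n)) :
    charFun (diagGaussian s : Measure (EuclideanSpace ℝ (Fin n))) t =
      ((exp (-(∑ j, t j ^ 2 * s j) / 2) : ℝ) : ℂ) := by
  rw [charFun_apply, diagGaussian, ProbabilityMeasure.coe_mk, integral_map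
    (measurable_toLp_diag s).aemeasurable (by fun_prop)]
  have h1 : ∀ y : Fin n → ℝ,
      Complex.exp (inner ℝ (WithLp.toLp 2 fun j => √(s j) * y j) t * Complex.I) =
        ∏ j, Complex.exp (((t j * √(s j) : ℝ) : ℂ) * y j * Complex.I) := by
    intro y
    rw [← Complex.exp_sum, ← Finset.sum_mul]
    congr 2
    rw [PiLp.inner_apply, Complex.ofReal_sum]
    refine Finset.sum_congr rfl fun j _ => ?_
    simp only [RCLike.inner_apply, conj_trivial]
    push_cast
    ring
  simp only [h1]
  rw [_root_.stdGaussian, integral_fintype_prod_eq_prod (fun j (y : ℝ) =>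
    Complex.exp (((t j * √(s j) : ℝ) : ℂ) * y * Complex.I))]
  simp only [← charFun_apply_real, charFun_gaussianReal]
  rw [← Complex.exp_sum, Complex.ofReal_exp]
  congr 1
  push_cast
  rw [← Finset.sum_neg_distrib, Finset.sum_div]
  refine Finset.sum_congr rfl fun j _ => ?_
  have : ((√(s j) : ℝ) : ℂ) ^ 2 = s j := by
    rw [← Complex.ofReal_pow, Real.sq_sqrt (hs j)]
  rw [mul_pow, this]
  simp
  ring

theorem tendsto_prod_cos {n : ℕ} {φ : ℕ → ℕ} (hφ : Filter.Tendsto φ Filter.atTop Filter.atTop)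
    (a : ∀ m, Fin n × Fin (φ m) → ℝ) (ha : ∀ m i, |a m i| ≤ 1) {s : Fin n → ℝ}
    (hs : ∀ j, Filter.Tendsto (fun m => (∑ l, a m (j, l) ^ 2) / φ m) Filter.atTop (nhds (s j)))
    (t : Fin n → ℝ) :
    Filter.Tendsto (fun m => ∏ i, cos (t i.1 * a m i / √(φ m))) Filter.atTop
      (nhds (exp (-(∑ j, t j ^ 2 * s j) / 2))) := by
  have hφ' : Filter.Tendsto (fun m => (φ m : ℝ)) Filter.atTop Filter.atTop :=
    tendsto_natCast_atTop_atTop.comp hφ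
  have h1 : Filter.Tendsto (fun m => exp (-(∑ j, t j ^ 2 * ((∑ l, a m (j, l) ^ 2) / φ m)) / 2))
      Filter.atTop (nhds (exp (-(∑ j, t j ^ 2 * s j) / 2))) := by
    refine (Real.continuous_exp.tendsto _).comp ?_
    refine Filter.Tendsto.div_const (Filter.Tendsto.neg ?_) _
    exact tendsto_finsetSum _ fun j _ => (hs j).const_mul _
  have h2 : Filter.Tendsto (fun m => (∑ j, |t j| ^ 4) / (φ m : ℝ)) Filter.atTop (nhds 0) :=
    hφ'.const_div_atTop _
  have h3 : ∀ᶠ m in Filter.atTop, dist (exp (-(∑ j, t j ^ 2 * ((∑ l, a m (j, l) ^ 2) / φ m)) / 2))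
      (∏ i, cos (t i.1 * a m i / √(φ m))) ≤ (∑ j, |t j| ^ 4) / (φ m : ℝ) := by
    filter_upwards [hφ'.eventually_ge_atTop (∑ j, |t j| ^ 2), hφ'.eventually_gt_atTop 0]
      with m hm hm0
    have hz : ∀ i, |t i.1 * a m i / √(φ m)| ≤ |t i.1| / √(φ m) := by
      intro i
      rw [abs_div, abs_mul, abs_of_nonneg (Real.sqrt_nonneg _)]
      gcongr
      exact mul_le_of_le_one_right (abs_nonneg _) (ha m i)
    have hz1 : ∀ i, |t i.1 * a m i / √(φ m)| ≤ 1 := by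
      intro i
      refine (hz i).trans ((div_le_one (by positivity)).2 ?_)
      refine Real.le_sqrt_of_sq_le (le_trans ?_ hm)
      exact Finset.single_le_sum (f := fun j => |t j| ^ 2) (fun _ _ => by positivity)
        (Finset.mem_univ i.1)
    have h4 : exp (-(∑ j, t j ^ 2 * ((∑ l, a m (j, l) ^ 2) / φ m)) / 2) =
        ∏ i, exp (-((t i.1 * a m i / √(φ m)) ^ 2 / 2)) := by
      rw [← Real.exp_sum, Fintype.sum_prod_type]
      congr 1
      rw [neg_div, Finset.sum_div, ← Finset.sum_neg_distrib]
      refine Finset.sum_congr rfl fun j _ => ?_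
      simp only [div_pow, mul_pow, Real.sq_sqrt hm0.le]
      rw [Finset.sum_neg_distrib, Finset.sum_div, Finset.mul_sum, Finset.sum_div]
      simp only [mul_div_assoc]
    rw [h4, dist_comm, Real.dist_eq]
    refine (abs_prod_sub_prod_le _ _ _ (fun i => Real.abs_cos_le_one _) fun i => ?_).trans ?_
    · rw [abs_of_pos (exp_pos _)]
      exact Real.exp_le_one_iff.2 (by simp only [Left.neg_nonpos_iff]; positivity)
    · calc _ ≤ ∑ i : Fin n × Fin (φ m), |t i.1| ^ 4 / (φ m : ℝ) ^ 2 := by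
            refine Finset.sum_le_sum fun i _ => (abs_cos_sub_exp_le (hz1 i)).trans ?_
            refine (pow_le_pow_left₀ (abs_nonneg _) (hz i) 4).trans_eq ?_
            rw [div_pow]
            congr 1
            rw [show (4 : ℕ) = 2 * 2 from rfl, pow_mul, Real.sq_sqrt hm0.le]
        _ = (∑ j, |t j| ^ 4) / (φ m : ℝ) := by
            rw [Fintype.sum_prod_type, Finset.sum_div]
            refine Finset.sum_congr rfl fun j _ => ?_
            simp
            field_simp
  have h5 : Filter.Tendsto (fun m => dist
      (exp (-(∑ j, t j ^ 2 * ((∑ l, a m (j, l) ^ 2) / φ m)) / 2))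
      (∏ i, cos (t i.1 * a m i / √(φ m)))) Filter.atTop (nhds 0) :=
    squeeze_zero' (Filter.Eventually.of_forall fun _ => dist_nonneg) h3 h2
  exact (tendsto_iff_of_dist h5).1 h1

theorem tendsto_expect_signVec {n : ℕ} {φ : ℕ → ℕ}
    (hφ : Filter.Tendsto φ Filter.atTop Filter.atTop)
    (a : ∀ m, Fin n × Fin (φ m) → ℝ) (ha : ∀ m i, |a m i| ≤ 1) {s : Fin n → ℝ}
    (hs : ∀ j, Filter.Tendsto (fun m => (∑ l, a m (j, l) ^ 2) / φ m) Filter.atTop (nhds (s j)))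
    (g : BoundedContinuousFunction (Fin n → ℝ) ℝ) :
    Filter.Tendsto (fun m => 𝔼 x, g (signVec (a m) x)) Filter.atTop
      (nhds (∫ y, g (fun j => √(s j) * y j) ∂stdGaussian n)) := by
  have hs0 : ∀ j, 0 ≤ s j := fun j => ge_of_tendsto (hs j) (Filter.Eventually.of_forall
    fun m => by positivity)
  have h1 : Filter.Tendsto (fun m => signLaw (a m)) Filter.atTop (nhds (diagGaussian s)) := by
    rw [ProbabilityMeasure.tendsto_iff_tendsto_charFun]
    intro t
    simp only [charFun_signLaw, charFun_diagGaussian hs0]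
    exact (Complex.continuous_ofReal.tendsto _).comp (tendsto_prod_cos hφ a ha hs t)
  rw [ProbabilityMeasure.tendsto_iff_forall_integral_tendsto] at h1
  have h2 := h1 (g.compContinuous ⟨fun x : EuclideanSpace ℝ (Fin n) => WithLp.ofLp x,
    by fun_prop⟩)
  have h3 : ∀ m, ∫ x, (g.compContinuous ⟨fun x : EuclideanSpace ℝ (Fin n) => WithLp.ofLp x,
    by fun_prop⟩) x ∂(signLaw (a m) : Measure (EuclideanSpace ℝ (Fin n))) =
      𝔼 x, g (signVec (a m) x) := by
    intro m
    rw [signLaw, ProbabilityMeasure.coe_mk, integral_map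
      (measurable_of_finite _).aemeasurable (by fun_prop), integral_uniformOfFintype,
      Fintype.expect_eq_sum_div_card, div_eq_inv_mul]
    rfl
  simp only [h3] at h2
  refine h2.trans_eq ?_
  rw [diagGaussian, ProbabilityMeasure.coe_mk, integral_map
    (measurable_toLp_diag s).aemeasurable (BoundedContinuousFunction.continuous _).aestronglyMeasurable]
  rfl

theorem lintegral_le_of_tendsto_expect {n : ℕ} {φ : ℕ → ℕ}
    (hφ : Filter.Tendsto φ Filter.atTop Filter.atTop)
    (a : ∀ m, Fin n × Fin (φ m) → ℝ) (ha : ∀ m i, |a m i| ≤ 1) {s : Fin n → ℝ}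
    (hs : ∀ j, Filter.Tendsto (fun m => (∑ l, a m (j, l) ^ 2) / φ m) Filter.atTop (nhds (s j)))
    {h : (Fin n → ℝ) → ℝ} (hc : Continuous h) (h0 : ∀ x, 0 ≤ h x) {c : ℕ → ℝ} {c₀ : ℝ}
    (hle : ∀ᶠ m in Filter.atTop, 𝔼 x, h (signVec (a m) x) ≤ c m)
    (hlim : Filter.Tendsto c Filter.atTop (nhds c₀)) :
    ∫⁻ y, ENNReal.ofReal (h (fun j => √(s j) * y j)) ∂(stdGaussian n) ≤ ENNReal.ofReal c₀ := by
  have hK : ∀ K : ℕ, ∫⁻ y, ENNReal.ofReal (min (h (fun j => √(s j) * y j)) K) ∂(stdGaussian n) ≤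
      ENNReal.ofReal c₀ := by
    intro K
    have hb : ∀ x, ‖min (h x) K‖ ≤ K := by
      intro x
      rw [Real.norm_eq_abs, abs_of_nonneg (le_min (h0 x) (Nat.cast_nonneg K))]
      exact min_le_right _ _
    set g : BoundedContinuousFunction (Fin n → ℝ) ℝ :=
      BoundedContinuousFunction.ofNormedAddCommGroup (fun x => min (h x) K)
        (hc.min continuous_const) K hb with hg
    have h1 := tendsto_expect_signVec hφ a ha hs g
    have h2 : ∫ y, g (fun j => √(s j) * y j) ∂(stdGaussian n) ≤ c₀ := by
      refine le_of_tendsto_of_tendsto h1 hlim ?_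
      filter_upwards [hle] with m hm
      exact (Finset.expect_le_expect fun x _ => min_le_left _ _).trans hm
    have hcont : Continuous fun y : Fin n → ℝ => g fun j => √(s j) * y j := by fun_prop
    have h3 : Integrable (fun y => g (fun j => √(s j) * y j)) (stdGaussian n) :=
      Integrable.of_bound hcont.aestronglyMeasurable K
        (Filter.Eventually.of_forall fun y => hb _)
    have h4 := ofReal_integral_eq_lintegral_ofReal h3
      (Filter.Eventually.of_forall fun y => le_min (h0 _) (Nat.cast_nonneg K))
    exact h4.symm.trans_le (ENNReal.ofReal_le_ofReal h2)
  have hmeas : ∀ K : ℕ, Measurable fun y : Fin n → ℝ =>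
      ENNReal.ofReal (min (h (fun j => √(s j) * y j)) K) := fun K =>
    ((hc.comp (by fun_prop)).min continuous_const).measurable.ennreal_ofReal
  have hsup : ∀ y : Fin n → ℝ, ENNReal.ofReal (h (fun j => √(s j) * y j)) =
      ⨆ K : ℕ, ENNReal.ofReal (min (h (fun j => √(s j) * y j)) K) := by
    intro y
    refine le_antisymm ?_ (iSup_le fun K => ENNReal.ofReal_le_ofReal (min_le_left _ _))
    obtain ⟨K, hK⟩ := exists_nat_ge (h fun j => √(s j) * y j)
    refine le_iSup_of_le K ?_
    rw [min_eq_left hK]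
  simp only [hsup]
  rw [lintegral_iSup hmeas]
  · exact iSup_le hK
  · intro K L hKL y
    exact ENNReal.ofReal_le_ofReal (min_le_min_left _ (Nat.cast_le.2 hKL))

theorem signVec_not {n k : ℕ} (a : Fin n × Fin k → ℝ) (x : Fin n × Fin k → Bool) :
    signVec a (fun i => !x i) = -signVec a x := by
  ext j
  simp only [signVec, bitSign_not, neg_mul, Finset.sum_neg_distrib, neg_div, Pi.neg_apply]

theorem expect_not {ι : Type*} [Fintype ι] [DecidableEq ι] (F : (ι → Bool) → ℝ) :
    𝔼 x : ι → Bool, F (fun i => !x i) = 𝔼 x, F x :=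
  Fintype.expect_equiv (Function.Involutive.toPerm (fun (x : ι → Bool) i => !x i)
    (fun x => by ext; simp)) _ _ (fun _ => rfl)

theorem expect_signVec_sq_le {n k : ℕ} {a : Fin n × Fin k → ℝ} (ha : ∀ i, |a i| ≤ 1)
    (j : Fin n) : 𝔼 x, signVec a x j ^ 2 ≤ 10 := by
  have h0 : 𝔼 x, signVec a x j = 0 := by
    have := expect_not fun x => signVec a x j
    simp only [signVec_not, Pi.neg_apply, Finset.expect_neg_distrib] at this
    linarith
  have h1 : ∀ x, ∑ i, posDiff (fun x => signVec a x j) i x ^ 2 ≤ 4 := by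
    intro x
    rcases Nat.eq_zero_or_pos k with rfl | hk
    · simp
    have hd : ∀ i, posDiff (fun x => signVec a x j) i x ^ 2 ≤ if i.1 = j then 4 / (k : ℝ) else 0 := by
      intro i
      have h2 : signVec a x j - signVec a (flipAt x i) j = _ :=
        congrFun (signVec_sub_flipAt a x i) j
      have h3 : posDiff (fun x => signVec a x j) i x ^ 2 ≤
          (signVec a x j - signVec a (flipAt x i) j) ^ 2 := by
        rw [sq_sub_flipAt (fun x => signVec a x j)]
        linarith [sq_nonneg (posDiff (fun x => signVec a x j) i (flipAt x i))]
      refine h3.trans ?_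
      rw [h2]
      by_cases hij : i.1 = j
      · subst hij
        simp only [Pi.smul_apply, Pi.single_eq_same, smul_eq_mul, mul_one, if_true]
        rw [div_pow, Real.sq_sqrt (by positivity), mul_pow, mul_pow, bitSign_sq, ← sq_abs (a i)]
        have h5 : |a i| ^ 2 ≤ 1 := pow_le_one₀ (abs_nonneg _) (ha i)
        gcongr
        linarith
      · have : j ≠ i.1 := fun h => hij h.symm
        simp [hij, this]
    refine (Finset.sum_le_sum fun i _ => hd i).trans ?_
    rw [Fintype.sum_prod_type]
    have : (k : ℝ) ≠ 0 := by positivity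
    rw [Finset.sum_eq_single j (by intro b _ hb; simp [hb]) (by simp)]
    simp only [if_true, Finset.sum_const, Finset.card_univ, Fintype.card_fin, nsmul_eq_mul]
    exact le_of_eq (by field_simp)
  have h2 := cube_variance_le (fun x => signVec a x j) h1
  rw [h0] at h2
  linarith

theorem expect_sq_signVec_le {n k : ℕ} {N : (Fin n → ℝ) → ℝ}
    (hE : ∀ x, N x ^ 2 ≤ ∑ j, x j ^ 2) {a : Fin n × Fin k → ℝ} (ha : ∀ i, |a i| ≤ 1) :
    𝔼 x, N (signVec a x) ^ 2 ≤ 10 * n := by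
  refine (Finset.expect_le_expect fun x _ => hE _).trans ?_
  rw [Finset.expect_sum_comm]
  refine (Finset.sum_le_sum fun j _ => expect_signVec_sq_le ha j).trans_eq ?_
  simp [mul_comm]

theorem sub_min_le_sq_div {u K : ℝ} (hK : 0 < K) : u - min u K ≤ u ^ 2 / K := by
  rcases le_total u K with h | h
  · rw [min_eq_left h]
    have : 0 ≤ u ^ 2 / K := by positivity
    linarith
  · rw [min_eq_right h, le_div_iff₀ hK]
    nlinarith

theorem integrable_sq_norm_diag {n : ℕ} {φ : ℕ → ℕ}
    (hφ : Filter.Tendsto φ Filter.atTop Filter.atTop)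
    (a : ∀ m, Fin n × Fin (φ m) → ℝ) (ha : ∀ m i, |a m i| ≤ 1) {s : Fin n → ℝ}
    (hs : ∀ j, Filter.Tendsto (fun m => (∑ l, a m (j, l) ^ 2) / φ m) Filter.atTop (nhds (s j)))
    {N : (Fin n → ℝ) → ℝ} (hN : IsNormFun N) (hE : ∀ x, N x ^ 2 ≤ ∑ j, x j ^ 2) :
    Integrable (fun y => N (fun j => √(s j) * y j) ^ 2) (stdGaussian n) ∧
      ∫ y, N (fun j => √(s j) * y j) ^ 2 ∂(stdGaussian n) ≤ 10 * n := by
  have hcont : Continuous fun y : Fin n → ℝ => N (fun j => √(s j) * y j) ^ 2 :=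
    (hN.continuous.comp (by fun_prop)).pow 2
  have h1 := lintegral_le_of_tendsto_expect hφ a ha hs (h := fun x => N x ^ 2)
    (hN.continuous.pow 2) (fun x => sq_nonneg _) (c := fun _ => 10 * n) (c₀ := 10 * n)
    (Filter.Eventually.of_forall fun m => expect_sq_signVec_le hE (ha m)) tendsto_const_nhds
  have h2 : Integrable (fun y => N (fun j => √(s j) * y j) ^ 2) (stdGaussian n) := by
    refine ⟨hcont.aestronglyMeasurable, ?_⟩
    rw [hasFiniteIntegral_iff_ofReal (Filter.Eventually.of_forall fun y => sq_nonneg _)]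
    exact h1.trans_lt ENNReal.ofReal_lt_top
  refine ⟨h2, ?_⟩
  rw [← ENNReal.ofReal_le_ofReal_iff (by positivity), ofReal_integral_eq_lintegral_ofReal h2
    (Filter.Eventually.of_forall fun y => sq_nonneg _)]
  exact h1

theorem tendsto_expect_norm_signVec {n : ℕ} {φ : ℕ → ℕ}
    (hφ : Filter.Tendsto φ Filter.atTop Filter.atTop)
    (a : ∀ m, Fin n × Fin (φ m) → ℝ) (ha : ∀ m i, |a m i| ≤ 1) {s : Fin n → ℝ}
    (hs : ∀ j, Filter.Tendsto (fun m => (∑ l, a m (j, l) ^ 2) / φ m) Filter.atTop (nhds (s j)))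
    {N : (Fin n → ℝ) → ℝ} (hN : IsNormFun N) (hE : ∀ x, N x ^ 2 ≤ ∑ j, x j ^ 2) :
    Filter.Tendsto (fun m => 𝔼 x, N (signVec (a m) x)) Filter.atTop
      (nhds (∫ y, N (fun j => √(s j) * y j) ∂(stdGaussian n))) := by
  obtain ⟨hi2, hb2⟩ := integrable_sq_norm_diag hφ a ha hs hN hE
  have hcont : Continuous fun y : Fin n → ℝ => N (fun j => √(s j) * y j) :=
    hN.continuous.comp (by fun_prop)
  have hi : Integrable (fun y => N (fun j => √(s j) * y j)) (stdGaussian n) :=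
    ((memLp_two_iff_integrable_sq hcont.aestronglyMeasurable).2 hi2).integrable one_le_two
  rw [Metric.tendsto_atTop]
  intro ε hε
  set K : ℝ := 40 * (n + 1) / ε with hK
  have hK0 : 0 < K := by positivity
  have hKn : 10 * n / K ≤ ε / 4 := by
    rw [div_le_iff₀ hK0, hK]
    field_simp
    nlinarith
  have hb : ∀ x, ‖min (N x) K‖ ≤ K := by
    intro x
    rw [Real.norm_eq_abs, abs_of_nonneg (le_min (hN.nonneg x) hK0.le)]
    exact min_le_right _ _
  set g : BoundedContinuousFunction (Fin n → ℝ) ℝ :=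
    BoundedContinuousFunction.ofNormedAddCommGroup (fun x => min (N x) K)
      (hN.continuous.min continuous_const) K hb with hg
  have h1 := tendsto_expect_signVec hφ a ha hs g
  obtain ⟨m₀, hm₀⟩ := (Metric.tendsto_atTop.1 h1) (ε / 4) (by positivity)
  refine ⟨m₀, fun m hm => ?_⟩
  have h2 := hm₀ m hm
  rw [Real.dist_eq, abs_lt] at h2 ⊢
  have hgc : Continuous fun y : Fin n → ℝ => g fun j => √(s j) * y j := by fun_prop
  have hgi : Integrable (fun y => g (fun j => √(s j) * y j)) (stdGaussian n) :=
    Integrable.of_bound hgc.aestronglyMeasurable K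
      (Filter.Eventually.of_forall fun y => hb _)
  have h3 : ∫ y, g (fun j => √(s j) * y j) ∂(stdGaussian n) ≤
      ∫ y, N (fun j => √(s j) * y j) ∂(stdGaussian n) :=
    integral_mono hgi hi fun y => min_le_left _ _
  have h4 : ∫ y, N (fun j => √(s j) * y j) ∂(stdGaussian n) -
      ∫ y, g (fun j => √(s j) * y j) ∂(stdGaussian n) ≤ 10 * n / K := by
    rw [← integral_sub hi hgi]
    refine (integral_mono (hi.sub hgi) (hi2.div_const K) fun y =>
      sub_min_le_sq_div hK0).trans ?_
    rw [integral_div]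
    gcongr
  have h5 : 𝔼 x, g (signVec (a m) x) ≤ 𝔼 x, N (signVec (a m) x) :=
    Finset.expect_le_expect fun x _ => min_le_left _ _
  have h6 : 𝔼 x, N (signVec (a m) x) - 𝔼 x, g (signVec (a m) x) ≤ 10 * n / K := by
    rw [← Finset.expect_sub_distrib]
    refine (Finset.expect_le_expect fun x _ => sub_min_le_sq_div hK0).trans ?_
    rw [← Finset.expect_div]
    gcongr
    exact expect_sq_signVec_le hE (ha m)
  constructor <;> linarith

theorem measure_gt_le_of_expect_exp {n : ℕ} {φ : ℕ → ℕ}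
    (hφ : Filter.Tendsto φ Filter.atTop Filter.atTop)
    (a : ∀ m, Fin n × Fin (φ m) → ℝ) (ha : ∀ m i, |a m i| ≤ 1) {s : Fin n → ℝ}
    (hs : ∀ j, Filter.Tendsto (fun m => (∑ l, a m (j, l) ^ 2) / φ m) Filter.atTop (nhds (s j)))
    {N : (Fin n → ℝ) → ℝ} (hN : IsNormFun N) (hE : ∀ x, N x ^ 2 ≤ ∑ j, x j ^ 2) {r c : ℝ}
    (hle : ∀ᶠ m in Filter.atTop, 𝔼 x, exp (r * N (signVec (a m) x)) ≤
      exp (r * (𝔼 x, N (signVec (a m) x)) + c)) (v : ℝ) :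
    stdGaussian n {y | v < r * (N (fun j => √(s j) * y j) -
      ∫ y, N (fun j => √(s j) * y j) ∂(stdGaussian n))} ≤ ENNReal.ofReal (exp (c - v)) := by
  set w := ∫ y, N (fun j => √(s j) * y j) ∂(stdGaussian n) with hw
  have h1 := tendsto_expect_norm_signVec hφ a ha hs hN hE
  have h2 : Filter.Tendsto (fun m => exp (r * (𝔼 x, N (signVec (a m) x)) + c)) Filter.atTop
      (nhds (exp (r * w + c))) :=
    (Real.continuous_exp.tendsto _).comp ((h1.const_mul r).add_const c)
  have h3 := lintegral_le_of_tendsto_expect hφ a ha hs (h := fun x => exp (r * N x))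
    (Real.continuous_exp.comp (hN.continuous.const_mul r)) (fun x => (exp_pos _).le) hle h2
  have hmeas : AEMeasurable (fun y : Fin n → ℝ =>
      ENNReal.ofReal (exp (r * N (fun j => √(s j) * y j)))) (stdGaussian n) := by
    refine Measurable.aemeasurable (Measurable.ennreal_ofReal (Continuous.measurable ?_))
    exact Real.continuous_exp.comp ((hN.continuous.comp (by fun_prop)).const_mul r)
  have h4 := mul_meas_ge_le_lintegral₀ hmeas (ENNReal.ofReal (exp (r * w + v)))
  have h5 : {y : Fin n → ℝ | v < r * (N (fun j => √(s j) * y j) - w)} ⊆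
      {y : Fin n → ℝ | ENNReal.ofReal (exp (r * w + v)) ≤
        ENNReal.ofReal (exp (r * N (fun j => √(s j) * y j)))} := by
    intro y hy
    refine ENNReal.ofReal_le_ofReal (Real.exp_le_exp.2 ?_)
    have : v < r * (N (fun j => √(s j) * y j) - w) := hy
    linarith
  refine (measure_mono h5).trans ?_
  have h6 := h4.trans h3
  have hpos : 0 < exp (r * w + v) := exp_pos _
  rw [mul_comm, ← ENNReal.le_div_iff_mul_le (Or.inl (by simpa using hpos))
    (Or.inl ENNReal.ofReal_ne_top), ← ENNReal.ofReal_div_of_pos hpos, ← Real.exp_sub] at h6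
  refine h6.trans (ENNReal.ofReal_le_ofReal (Real.exp_le_exp.2 ?_))
  linarith

theorem sum_expect_mul_posDiff_sq_le {ι : Type*} [DecidableEq ι] [Fintype ι]
    (f : (ι → Bool) → ℝ) {B : ℝ} (hB : ∀ x, ∑ i, posDiff f i x ^ 2 ≤ B)
    (g : (ι → Bool) → ℝ) : ∑ i, (𝔼 x, g x * posDiff f i x) ^ 2 ≤ B * 𝔼 x, g x ^ 2 := by
  have h0 : 0 ≤ 𝔼 x, g x ^ 2 := Finset.expect_nonneg fun x _ => sq_nonneg _
  calc ∑ i, (𝔼 x, g x * posDiff f i x) ^ 2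
      ≤ ∑ i, (𝔼 x, g x ^ 2) * 𝔼 x, posDiff f i x ^ 2 :=
        Finset.sum_le_sum fun i _ => expect_mul_sq_le _ _
    _ = (𝔼 x, g x ^ 2) * 𝔼 x, ∑ i, posDiff f i x ^ 2 := by
        rw [← Finset.mul_sum, Finset.expect_sum_comm]
    _ ≤ (𝔼 x, g x ^ 2) * B := by
        refine mul_le_mul_of_nonneg_left ?_ h0
        exact Finset.expect_le Finset.univ_nonempty fun x _ => hB x
    _ = _ := mul_comm _ _

theorem measure_abs_gt_le {n : ℕ} {φ : ℕ → ℕ}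
    (hφ : Filter.Tendsto φ Filter.atTop Filter.atTop)
    (a : ∀ m, Fin n × Fin (φ m) → ℝ) (ha : ∀ m i, |a m i| ≤ 1) {s : Fin n → ℝ}
    (hs : ∀ j, Filter.Tendsto (fun m => (∑ l, a m (j, l) ^ 2) / φ m) Filter.atTop (nhds (s j)))
    {N : (Fin n → ℝ) → ℝ} (hN : IsNormFun N) (hE : ∀ x, N x ^ 2 ≤ ∑ j, x j ^ 2) {τ L : ℝ}
    (hτ0 : 0 ≤ τ) (hL : 0 ≤ L)
    (hτ : ∀ᶠ m in Filter.atTop, ∀ g : (Fin n × Fin (φ m) → Bool) → ℝ, (∀ x, 0 ≤ g x) →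
      ∑ i, (𝔼 x, g x * posDiff (fun x => N (signVec (a m) x)) i x) ^ 2 ≤ τ * 𝔼 x, g x ^ 2)
    (u : ℝ) :
    stdGaussian n {y | u < |N (fun j => √(s j) * y j) -
      ∫ y, N (fun j => √(s j) * y j) ∂(stdGaussian n)|} ≤
      ENNReal.ofReal (2 * exp (2 - u / √(2 * ((6 + exp L * τ) / (1 + L))))) := by
  set A := (6 + exp L * τ) / (1 + L) with hA
  have hA0 : 0 < A := by positivity
  set w := ∫ y, N (fun j => √(s j) * y j) ∂(stdGaussian n) with hw
  have hq : 0 < √(2 * A) := Real.sqrt_pos.2 (by positivity)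
  have hq2 : √(2 * A) ^ 2 = 2 * A := Real.sq_sqrt (by positivity)
  have key : ∀ r : ℝ, |r| = 1 / √(2 * A) → ∀ v, stdGaussian n
      {y | v < r * (N (fun j => √(s j) * y j) - w)} ≤ ENNReal.ofReal (exp (2 - v)) := by
    intro r hr v
    have hr2 : r ^ 2 = 1 / (2 * A) := by rw [← sq_abs, hr, div_pow, hq2, one_pow]
    refine measure_gt_le_of_expect_exp hφ a ha hs hN hE ?_ v
    have hlim : Filter.Tendsto (fun m => |r| * (2 / √(φ m))) Filter.atTop (nhds 0) := by
      have h1 : Filter.Tendsto (fun m => √(φ m : ℝ)) Filter.atTop Filter.atTop :=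
        Real.tendsto_sqrt_atTop.comp (tendsto_natCast_atTop_atTop.comp hφ)
      simpa using (h1.const_div_atTop 2).const_mul |r|
    filter_upwards [hτ, hlim.eventually (eventually_le_nhds one_pos)] with m hm hρ
    have h := expect_exp_le_of_posDiff (fun x => N (signVec (a m) x)) (ρ := 2 / √(φ m)) (s := r)
      (hN.sum_posDiff_sq_le hE (ha m)) (fun i x => by
        refine (hN.abs_sub_flipAt_signVec_le hE (a m) i x).trans ?_
        gcongr
        linarith [ha m i]) (by positivity) hτ0 hL hρ hm (by
        rw [← hA, hr2]
        apply le_of_eq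
        field_simp)
    rw [← hA, hr2] at h
    refine h.trans_eq ?_
    congr 2
    field_simp
    norm_num
  have h1 := key (1 / √(2 * A)) (abs_of_pos (by positivity)) (u / √(2 * A))
  have h2 := key (-(1 / √(2 * A))) (by rw [abs_neg, abs_of_pos (by positivity)]) (u / √(2 * A))
  have hsub : {y : Fin n → ℝ | u < |N (fun j => √(s j) * y j) - w|} ⊆
      {y : Fin n → ℝ | u / √(2 * A) < 1 / √(2 * A) * (N (fun j => √(s j) * y j) - w)} ∪
      {y : Fin n → ℝ | u / √(2 * A) < -(1 / √(2 * A)) * (N (fun j => √(s j) * y j) - w)} := by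
    intro y hy
    have hy' : u < |N (fun j => √(s j) * y j) - w| := hy
    rcases lt_abs.1 hy' with h | h
    · left
      show u / √(2 * A) < 1 / √(2 * A) * (N (fun j => √(s j) * y j) - w)
      rw [one_div_mul_eq_div]
      gcongr
    · right
      show u / √(2 * A) < -(1 / √(2 * A)) * (N (fun j => √(s j) * y j) - w)
      rw [neg_mul, ← mul_neg, one_div_mul_eq_div]
      gcongr
  refine (measure_mono hsub).trans ((measure_union_le _ _).trans ((add_le_add h1 h2).trans_eq ?_))
  rw [← ENNReal.ofReal_add (exp_pos _).le (exp_pos _).le, ← two_mul]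

theorem measure_gt_le {n : ℕ} {φ : ℕ → ℕ}
    (hφ : Filter.Tendsto φ Filter.atTop Filter.atTop)
    (a : ∀ m, Fin n × Fin (φ m) → ℝ) (ha : ∀ m i, |a m i| ≤ 1) {s : Fin n → ℝ}
    (hs : ∀ j, Filter.Tendsto (fun m => (∑ l, a m (j, l) ^ 2) / φ m) Filter.atTop (nhds (s j)))
    {N : (Fin n → ℝ) → ℝ} (hN : IsNormFun N) (hE : ∀ x, N x ^ 2 ≤ ∑ j, x j ^ 2) {u : ℝ}
    (hu : 0 ≤ u) :
    stdGaussian n {y | u < N (fun j => √(s j) * y j) -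
      ∫ y, N (fun j => √(s j) * y j) ∂(stdGaussian n)} ≤ ENNReal.ofReal (exp (-(u ^ 2 / 8))) := by
  rcases hu.eq_or_lt with rfl | hu
  · simpa using prob_le_one
  have h := measure_gt_le_of_expect_exp hφ a ha hs hN hE (r := u / 4) (c := 4 / 2 * (u / 4) ^ 2)
    (Filter.Eventually.of_forall fun m => expect_exp_le_herbst (fun x => N (signVec (a m) x))
      (hN.sum_posDiff_sq_le hE (ha m)) (by positivity)) (u / 4 * u)
  have e : 4 / 2 * (u / 4) ^ 2 - u / 4 * u = -(u ^ 2 / 8) := by ring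
  rw [e] at h
  refine (measure_mono fun y hy => ?_).trans h
  have hy' : u < N (fun j => √(s j) * y j) -
    ∫ y, N (fun j => √(s j) * y j) ∂(stdGaussian n) := hy
  exact mul_lt_mul_of_pos_left hy' (show 0 < u / 4 by positivity)

/-- Exponential two-sided and Gaussian upper tails around a large mean give the mixed tail. -/
theorem mixed_tail_of_tails {Ω : Type*} [MeasurableSpace Ω] (μ : Measure Ω) {Z : Ω → ℝ}
    (hZ : ∀ y, 0 ≤ Z y) {w q c ℓ : ℝ} (hw : 0 ≤ w)
    (h1 : ∀ u, μ {y | u < |Z y - w|} ≤ ENNReal.ofReal (2 * exp (2 - u / q)))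
    (h2 : ∀ u, 0 ≤ u → μ {y | u < Z y - w} ≤ ENNReal.ofReal (exp (-(u ^ 2 / 8))))
    (hq : c * ℓ ≤ w / q) (hc : c * ℓ ≤ w ^ 2 / 8) {t : ℝ} (ht : 0 < t) :
    μ {y | t * w < |Z y - w|} ≤
      ENNReal.ofReal (2 * exp 2 * exp (-c * max (t ^ 2) t * ℓ)) := by
  rcases le_total t 1 with ht1 | ht1
  · refine (h1 (t * w)).trans (ENNReal.ofReal_le_ofReal ?_)
    rw [max_eq_right (by nlinarith), mul_assoc, ← Real.exp_add]
    gcongr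
    have := mul_le_mul_of_nonneg_left hq ht.le
    rw [mul_div_assoc]
    linarith
  · refine (measure_mono (t := {y | t * w < Z y - w}) fun y hy => ?_).trans
      ((h2 (t * w) (by positivity)).trans (ENNReal.ofReal_le_ofReal ?_))
    · have hy' : t * w < |Z y - w| := hy
      rcases lt_abs.1 hy' with h | h
      · exact h
      · have := hZ y
        nlinarith
    · rw [max_eq_left (by nlinarith)]
      have e1 : (1 : ℝ) ≤ 2 * exp 2 := by linarith [Real.add_one_le_exp 2]
      have e2 : exp (-((t * w) ^ 2 / 8)) ≤ exp (-c * t ^ 2 * ℓ) := by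
        apply Real.exp_le_exp.2
        nlinarith [sq_nonneg t]
      nlinarith [exp_pos (-c * t ^ 2 * ℓ)]

theorem IsNormFun.exists_pos_mul_norm_le {n : ℕ} {N : (Fin n → ℝ) → ℝ} (hN : IsNormFun N) :
    ∃ c > 0, ∀ x, c * ‖x‖ ≤ N x := by
  rcases (Metric.sphere (0 : Fin n → ℝ) 1).eq_empty_or_nonempty with h | h
  · refine ⟨1, one_pos, fun x => ?_⟩
    rcases eq_or_ne x 0 with rfl | hx
    · simp [hN.zero]
    · exfalso
      have : ‖x‖⁻¹ • x ∈ Metric.sphere (0 : Fin n → ℝ) 1 := by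
        rw [mem_sphere_zero_iff_norm, norm_smul, norm_inv, norm_norm,
          inv_mul_cancel₀ (norm_ne_zero_iff.2 hx)]
      rw [h] at this
      exact this
  · obtain ⟨z, hz, hmin⟩ := (isCompact_sphere (0 : Fin n → ℝ) 1).exists_isMinOn h
      hN.continuous.continuousOn
    have hz0 : z ≠ 0 := by
      rintro rfl
      simp at hz
    refine ⟨N z, (hN.nonneg z).lt_of_ne fun h => hz0 (hN.eq_zero z h.symm), fun x => ?_⟩
    rcases eq_or_ne x 0 with rfl | hx
    · simp [hN.zero]
    have hx' : 0 < ‖x‖ := norm_pos_iff.2 hx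
    have h1 := hmin (a := ‖x‖⁻¹ • x) (by
      rw [mem_sphere_zero_iff_norm, norm_smul, norm_inv, norm_norm,
        inv_mul_cancel₀ hx'.ne'])
    have h2 : N z ≤ N (‖x‖⁻¹ • x) := h1
    rw [hN.smul_eq, abs_of_pos (inv_pos.2 hx')] at h2
    rwa [← le_div_iff₀ hx', div_eq_inv_mul]

/-- The matrices whose image of the Euclidean ball lies in the unit ball of `N`. -/
def contractions {n : ℕ} (N : (Fin n → ℝ) → ℝ) : Set (Matrix (Fin n) (Fin n) ℝ) :=
  {A | ∀ x, N (A.mulVec x) ^ 2 ≤ ∑ j, x j ^ 2}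

theorem IsNormFun.isCompact_contractions {n : ℕ} {N : (Fin n → ℝ) → ℝ} (hN : IsNormFun N) :
    IsCompact (contractions N) := by
  obtain ⟨c, hc, hcN⟩ := hN.exists_pos_mul_norm_le
  have hcl : IsClosed (contractions N) := by
    have : contractions N = ⋂ x : Fin n → ℝ, {A | N (A.mulVec x) ^ 2 ≤ ∑ j, x j ^ 2} := by
      ext A
      simp [contractions]
    rw [this]
    refine isClosed_iInter fun x => isClosed_le ?_ continuous_const
    exact (hN.continuous.comp (continuous_id.matrix_mulVec continuous_const)).pow 2
  have hK : IsCompact (Set.pi Set.univ fun _ : Fin n => Set.pi Set.univ fun _ : Fin n =>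
      Set.Icc (-(1 / c)) (1 / c)) :=
    isCompact_univ_pi fun _ => isCompact_univ_pi fun _ => isCompact_Icc
  refine hK.of_isClosed_subset hcl fun (A : Matrix (Fin n) (Fin n) ℝ) hA i _ j _ => ?_
  have h1 : N (A.mulVec (Pi.single j 1)) ^ 2 ≤ 1 := by
    refine (hA _).trans_eq ?_
    rw [Finset.sum_eq_single j (by intro b _ hb; simp [hb]) (by simp)]
    simp
  have h2 : N (A.mulVec (Pi.single j 1)) ≤ 1 := by
    nlinarith [hN.nonneg (A.mulVec (Pi.single j 1))]
  have h3 := (hcN _).trans h2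
  have h4 := norm_le_pi_norm (A.mulVec (Pi.single j 1)) i
  rw [Matrix.mulVec_single_one, Real.norm_eq_abs] at h4
  rw [Matrix.mulVec_single_one] at h3
  refine abs_le.1 ((le_div_iff₀' hc).2 ?_)
  exact (mul_le_mul_of_nonneg_left h4 hc.le).trans h3

theorem IsNormFun.sq_le {n : ℕ} {N : (Fin n → ℝ) → ℝ} (hN : IsNormFun N) (x : Fin n → ℝ) :
    N x ^ 2 ≤ (∑ j, N (Pi.single j 1) ^ 2) * ∑ j, x j ^ 2 := by
  have h := hN.le_sum_single x
  have h1 := Finset.sum_mul_sq_le_sq_mul_sq univ (fun j => |x j|) (fun j => N (Pi.single j 1))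
  simp only [sq_abs] at h1
  rw [mul_comm]
  exact (pow_le_pow_left₀ (hN.nonneg x) h 2).trans h1

theorem IsNormFun.exists_maximal_contraction {n : ℕ} {N : (Fin n → ℝ) → ℝ} (hN : IsNormFun N) :
    ∃ A ∈ contractions N, A.det ≠ 0 ∧ ∀ B ∈ contractions N, |B.det| ≤ |A.det| := by
  set Q := 1 + ∑ j, N (Pi.single j 1) ^ 2 with hQ
  have hQ1 : 1 ≤ Q := by
    have : 0 ≤ ∑ j, N (Pi.single j 1) ^ 2 := Finset.sum_nonneg fun _ _ => sq_nonneg _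
    linarith
  have h0 : (Q⁻¹ • (1 : Matrix (Fin n) (Fin n) ℝ)) ∈ contractions N := by
    intro x
    rw [Matrix.smul_mulVec, Matrix.one_mulVec, hN.smul_eq, mul_pow, sq_abs]
    have h1 := hN.sq_le x
    have h2 : 0 ≤ ∑ j, x j ^ 2 := Finset.sum_nonneg fun _ _ => sq_nonneg _
    have h3 : N x ^ 2 ≤ Q * ∑ j, x j ^ 2 := h1.trans (by gcongr; linarith)
    rw [inv_pow, inv_mul_le_iff₀ (by positivity)]
    refine h3.trans ?_
    gcongr
    nlinarith
  obtain ⟨A, hA, hmax⟩ := hN.isCompact_contractions.exists_isMaxOn ⟨_, h0⟩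
    (f := fun A : Matrix (Fin n) (Fin n) ℝ => |A.det|)
    (continuous_id.matrix_det.abs).continuousOn
  refine ⟨A, hA, fun h => ?_, fun B hB => hmax hB⟩
  have h1 : |(Q⁻¹ • (1 : Matrix (Fin n) (Fin n) ℝ)).det| ≤ |A.det| := hmax h0
  rw [h, Matrix.det_smul, Matrix.det_one, abs_zero, mul_one] at h1
  have h2 : (0 : ℝ) < Q⁻¹ ^ Fintype.card (Fin n) := by positivity
  linarith [abs_pos.2 h2.ne']

/-- The Householder reflection in the hyperplane orthogonal to `v`. -/
noncomputable def householder {n : ℕ} (v : Fin n → ℝ) : Matrix (Fin n) (Fin n) ℝ :=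
  1 - (2 / (∑ j, v j ^ 2)) • Matrix.vecMulVec v v

theorem householder_mulVec {n : ℕ} (v x : Fin n → ℝ) :
    (householder v).mulVec x = x - (2 / (∑ j, v j ^ 2) * ∑ j, v j * x j) • v := by
  rw [householder, Matrix.sub_mulVec, Matrix.one_mulVec, Matrix.smul_mulVec,
    Matrix.vecMulVec_mulVec]
  ext i
  simp [dotProduct]
  ring

theorem sum_householder_sq {n : ℕ} {v : Fin n → ℝ} (hv : ∑ j, v j ^ 2 ≠ 0) (x : Fin n → ℝ) :
    ∑ j, (householder v).mulVec x j ^ 2 = ∑ j, x j ^ 2 := by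
  rw [householder_mulVec]
  simp only [Pi.sub_apply, Pi.smul_apply, smul_eq_mul]
  set V := ∑ j, v j ^ 2 with hV
  set P := ∑ j, v j * x j with hP
  have : ∀ j, (x j - 2 / V * P * v j) ^ 2 =
      x j ^ 2 - (4 / V * P) * (v j * x j) + (2 / V * P) ^ 2 * v j ^ 2 := fun j => by ring
  simp only [this, Finset.sum_add_distrib, Finset.sum_sub_distrib, ← Finset.mul_sum]
  rw [← hV, ← hP]
  field_simp
  ring

theorem householder_mul_self {n : ℕ} {v : Fin n → ℝ} (hv : ∑ j, v j ^ 2 ≠ 0) :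
    householder v * householder v = 1 := by
  refine Matrix.ext_of_mulVec_single fun i => ?_
  rw [← Matrix.mulVec_mulVec, Matrix.one_mulVec]
  generalize (Pi.single i 1 : Fin n → ℝ) = x
  rw [householder_mulVec v (Matrix.mulVec _ _)]
  have h : ∑ j, v j * (householder v).mulVec x j = - ∑ j, v j * x j := by
    rw [householder_mulVec]
    simp only [Pi.sub_apply, Pi.smul_apply, smul_eq_mul]
    set V := ∑ j, v j ^ 2 with hV
    set P := ∑ j, v j * x j with hP
    have : ∀ j, v j * (x j - 2 / V * P * v j) = v j * x j - (2 / V * P) * v j ^ 2 :=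
      fun j => by ring
    simp only [this, Finset.sum_sub_distrib, ← Finset.mul_sum]
    rw [← hV, ← hP]
    field_simp
    ring
  rw [h, householder_mulVec]
  simp

theorem abs_det_householder {n : ℕ} {v : Fin n → ℝ} (hv : ∑ j, v j ^ 2 ≠ 0) :
    |(householder v).det| = 1 := by
  have h := congrArg Matrix.det (householder_mul_self hv)
  rw [Matrix.det_mul, Matrix.det_one] at h
  exact (abs_eq one_pos.le).2 (mul_self_eq_one_iff.1 h)

theorem IsNormFun.exists_large_vector {n : ℕ} {N : (Fin n → ℝ) → ℝ} (hN : IsNormFun N)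
    {A : Matrix (Fin n) (Fin n) ℝ} (hA : A ∈ contractions N) (hdet : A.det ≠ 0)
    (hmax : ∀ B ∈ contractions N, |B.det| ≤ |A.det|) (I : Finset (Fin n)) (hI : 2 * #I < n) :
    ∃ y : Fin n → ℝ, (∀ i ∈ I, y i = 0) ∧ ∑ j, y j ^ 2 = 1 ∧ 1 / 2 ≤ N (A.mulVec y) := by
  by_contra! hcon
  have hsmall : ∀ y : Fin n → ℝ, (∀ i ∈ I, y i = 0) →
      N (A.mulVec y) ^ 2 ≤ 1 / 4 * ∑ j, y j ^ 2 := by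
    intro y hy
    have hnn : 0 ≤ ∑ j, y j ^ 2 := Finset.sum_nonneg fun _ _ => sq_nonneg _
    rcases hnn.eq_or_lt with h | h
    · have := hA y
      rw [← h] at this ⊢
      simpa using this
    · have hq : 0 < √(∑ j, y j ^ 2) := Real.sqrt_pos.2 h
      have hq2 : √(∑ j, y j ^ 2) ^ 2 = ∑ j, y j ^ 2 := Real.sq_sqrt hnn
      have h1 := hcon ((√(∑ j, y j ^ 2))⁻¹ • y) (fun i hi => by simp [hy i hi]) (by
        simp only [Pi.smul_apply, smul_eq_mul, mul_pow, ← Finset.mul_sum]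
        rw [inv_pow, hq2, inv_mul_cancel₀ h.ne'])
      rw [Matrix.mulVec_smul, hN.smul_eq, abs_of_pos (inv_pos.2 hq), inv_mul_lt_iff₀ hq] at h1
      have h2 := pow_le_pow_left₀ (hN.nonneg _) h1.le 2
      rw [mul_pow, hq2] at h2
      linarith
  set d : Fin n → ℝ := fun j => if j ∈ I then (√2)⁻¹ else √2 with hd
  have hs2 : √2 ^ 2 = (2 : ℝ) := Real.sq_sqrt (by norm_num)
  have hs0 : 0 < √2 := Real.sqrt_pos.2 (by norm_num)
  have hprod : 1 < ∏ j, d j := by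
    rw [hd, Finset.prod_ite, Finset.prod_const, Finset.prod_const, inv_pow,
      Finset.filter_mem_eq_inter, Finset.univ_inter, Finset.filter_not,
      Finset.filter_mem_eq_inter, Finset.univ_inter, ← Finset.compl_eq_univ_sdiff,
      Finset.card_compl, Fintype.card_fin, inv_mul_eq_div, one_lt_div (by positivity)]
    apply pow_lt_pow_right₀ _ (by omega)
    rw [Real.lt_sqrt (by norm_num)]
    norm_num
  have hmem : A * Matrix.diagonal d ∈ contractions N := by
    intro x
    rw [← Matrix.mulVec_mulVec]
    set u : Fin n → ℝ := fun j => if j ∈ I then x j else 0 with hu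
    set z : Fin n → ℝ := fun j => if j ∈ I then 0 else x j with hz
    have hx : (Matrix.diagonal d).mulVec x = (√2)⁻¹ • u + √2 • z := by
      ext j
      rw [Matrix.mulVec_diagonal]
      by_cases hj : j ∈ I <;> simp [hd, hu, hz, hj]
    have hsq : ∑ j, x j ^ 2 = ∑ j, u j ^ 2 + ∑ j, z j ^ 2 := by
      rw [← Finset.sum_add_distrib]
      refine Finset.sum_congr rfl fun j _ => ?_
      by_cases hj : j ∈ I <;> simp [hu, hz, hj]
    rw [hx, Matrix.mulVec_add, Matrix.mulVec_smul, Matrix.mulVec_smul, hsq]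
    have h1 := hN.add_le ((√2)⁻¹ • A.mulVec u) (√2 • A.mulVec z)
    rw [hN.smul_eq, hN.smul_eq, abs_of_pos (inv_pos.2 hs0), abs_of_pos hs0] at h1
    have h2 := hA u
    have h3 := hsmall z (fun i hi => by simp [hz, hi])
    have h4 := pow_le_pow_left₀ (hN.nonneg _) h1 2
    have h5 : ((√2)⁻¹ * N (A.mulVec u) + √2 * N (A.mulVec z)) ^ 2 ≤
        N (A.mulVec u) ^ 2 + 4 * N (A.mulVec z) ^ 2 := by
      have e : (√2)⁻¹ = √2 / 2 := by
        field_simp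
        linarith
      rw [e]
      have : (√2 / 2 * N (A.mulVec u) + √2 * N (A.mulVec z)) ^ 2 =
          √2 ^ 2 * (N (A.mulVec u) / 2 + N (A.mulVec z)) ^ 2 := by ring
      rw [this, hs2]
      nlinarith [sq_nonneg (N (A.mulVec u) - 2 * N (A.mulVec z))]
    linarith
  have h := hmax _ hmem
  rw [Matrix.det_mul, Matrix.det_diagonal, abs_mul] at h
  have h1 : 0 < |A.det| := abs_pos.2 hdet
  have h2 := le_abs_self (∏ j, d j)
  nlinarith

theorem IsNormFun.exists_position {n : ℕ} {N : (Fin n → ℝ) → ℝ} (hN : IsNormFun N) :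
    ∃ S : (Fin n → ℝ) ≃ₗ[ℝ] (Fin n → ℝ), (∀ x, N (S x) ^ 2 ≤ ∑ j, x j ^ 2) ∧
      n ≤ 2 * #{j | 1 / 2 ≤ N (S (Pi.single j 1))} := by
  classical
  obtain ⟨A₀, hA₀, hdet₀, hmax₀⟩ := hN.exists_maximal_contraction
  set I : Matrix (Fin n) (Fin n) ℝ → Finset (Fin n) :=
    fun A => {j | 1 / 2 ≤ N (A.mulVec (Pi.single j 1))} with hIdef
  set V : Set ℕ := {k | ∃ A ∈ contractions N, |A.det| = |A₀.det| ∧ #(I A) = k} with hV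
  have hbdd : BddAbove V := by
    refine ⟨n, ?_⟩
    rintro k ⟨A, -, -, rfl⟩
    exact (Finset.card_le_univ _).trans_eq (Fintype.card_fin n)
  obtain ⟨A, hA, hdA, hkA⟩ := Nat.sSup_mem (s := V) ⟨_, A₀, hA₀, rfl, rfl⟩ hbdd
  have hbest : ∀ B ∈ contractions N, |B.det| = |A₀.det| → #(I B) ≤ #(I A) :=
    fun B hB hdB => (le_csSup hbdd ⟨B, hB, hdB, rfl⟩).trans_eq hkA.symm
  have hdet : A.det ≠ 0 := abs_ne_zero.1 (hdA ▸ abs_ne_zero.2 hdet₀)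
  refine ⟨Matrix.toLinearEquiv' A (Matrix.invertibleOfIsUnitDet A hdet.isUnit), fun x => ?_, ?_⟩
  · exact hA x
  by_contra! hcard
  have hcard' : 2 * #(I A) < n := hcard
  obtain ⟨y, hy0, hy1, hy2⟩ := hN.exists_large_vector hA hdet
    (fun B hB => (hmax₀ B hB).trans_eq hdA.symm) (I A) hcard'
  obtain ⟨j₀, hj₀⟩ : ∃ j₀, j₀ ∉ I A := by
    by_contra! h
    have : I A = univ := Finset.eq_univ_iff_forall.2 h
    rw [this, Finset.card_univ, Fintype.card_fin] at hcard'
    omega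
  set v : Fin n → ℝ := Pi.single j₀ 1 - y with hv
  have hsing : ∑ j, (Pi.single j₀ (1 : ℝ) : Fin n → ℝ) j ^ 2 = 1 := by
    rw [Finset.sum_eq_single j₀ (by intro b _ hb; simp [hb]) (by simp)]
    simp
  have hsing2 : ∑ j, y j * (Pi.single j₀ (1 : ℝ) : Fin n → ℝ) j = y j₀ := by
    rw [Finset.sum_eq_single j₀ (by intro b _ hb; simp [hb]) (by simp)]
    simp
  have hvv : ∑ j, v j ^ 2 = 2 - 2 * y j₀ := by
    have : ∀ j, v j ^ 2 = (Pi.single j₀ (1 : ℝ) : Fin n → ℝ) j ^ 2 -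
        2 * (y j * (Pi.single j₀ (1 : ℝ) : Fin n → ℝ) j) + y j ^ 2 := fun j => by
      simp only [hv, Pi.sub_apply]
      ring
    simp only [this, Finset.sum_add_distrib, Finset.sum_sub_distrib, ← Finset.mul_sum]
    rw [hsing, hsing2, hy1]
    ring
  have hv0 : ∑ j, v j ^ 2 ≠ 0 := by
    intro h
    have h1 : ∀ j, v j = 0 := fun j => by
      have := (Finset.sum_eq_zero_iff_of_nonneg fun j _ => sq_nonneg (v j)).1 h j (by simp)
      simpa using this
    have h2 : y = Pi.single j₀ 1 := by
      ext j
      have := h1 j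
      simp only [hv, Pi.sub_apply] at this
      linarith
    refine hj₀ ?_
    rw [h2] at hy2
    simpa [hIdef] using hy2
  have hB : A * householder v ∈ contractions N := by
    intro x
    rw [← Matrix.mulVec_mulVec, ← sum_householder_sq hv0 x]
    exact hA _
  have hBd : |(A * householder v).det| = |A₀.det| := by
    rw [Matrix.det_mul, abs_mul, abs_det_householder hv0, mul_one, hdA]
  have hsub : insert j₀ (I A) ⊆ I (A * householder v) := by
    intro i hi
    simp only [hIdef, Finset.mem_filter, Finset.mem_univ, true_and]
    rw [← Matrix.mulVec_mulVec, householder_mulVec]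
    have hvi : ∑ j, v j * (Pi.single i (1 : ℝ) : Fin n → ℝ) j = v i := by
      rw [Finset.sum_eq_single i (by intro b _ hb; simp [hb]) (by simp)]
      simp
    rw [hvi]
    rcases Finset.mem_insert.1 hi with rfl | hi
    · have h1 : v i = 1 - y i := by simp [hv]
      have h2 : 2 / (∑ j, v j ^ 2) * v i = 1 := by
        rw [hvv] at hv0 ⊢
        rw [h1, div_mul_eq_mul_div, div_eq_one_iff_eq hv0]
        ring
      rw [h2, one_smul, hv, sub_sub_cancel]
      exact hy2
    · have h1 : v i = 0 := by
        have : i ≠ j₀ := fun h => hj₀ (h ▸ hi)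
        simp [hv, this, hy0 i hi]
      rw [h1, mul_zero, zero_smul, sub_zero]
      simpa [hIdef] using hi
  have h1 := Finset.card_le_card hsub
  rw [Finset.card_insert_of_notMem hj₀] at h1
  have h2 := hbest _ hB hBd
  omega

/-- The vector `x` with its coordinates multiplied by the signs `e`. -/
def signMul {n : ℕ} (e : Fin n → Bool) (x : Fin n → ℝ) : Fin n → ℝ := fun j => bitSign (e j) * x j

theorem expect_signMul_abs {n : ℕ} (F : (Fin n → ℝ) → ℝ) (x : Fin n → ℝ) :
    𝔼 e, F (signMul e fun j => |x j|) = 𝔼 e, F (signMul e x) := by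
  refine Finset.expect_equiv
    (Equiv.piCongrRight fun j => if 0 ≤ x j then Equiv.refl Bool else Equiv.boolNot)
    (by simp) fun e _ => ?_
  congr 1
  ext j
  simp only [signMul, Equiv.piCongrRight_apply, Pi.map_apply]
  split_ifs with h
  · simp [abs_of_nonneg h]
  · rw [abs_of_neg (not_le.1 h), Equiv.boolNot_apply, bitSign_not]
    ring

theorem measurePreserving_signMul {n : ℕ} (e : Fin n → Bool) :
    MeasurePreserving (signMul e) (stdGaussian n) (stdGaussian n) := by
  refine measurePreserving_pi (fun _ => gaussianReal 0 1) (fun _ => gaussianReal 0 1)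
    (f := fun j y => bitSign (e j) * y) fun j => ⟨measurable_const_mul _, ?_⟩
  rw [gaussianReal_map_const_mul]
  congr
  · simp
  · ext
    simp [bitSign_sq]

theorem integral_signMul {n : ℕ} (e : Fin n → Bool) {F : (Fin n → ℝ) → ℝ} (hF : Continuous F) :
    ∫ x, F (signMul e x) ∂(stdGaussian n) = ∫ x, F x ∂(stdGaussian n) := by
  have h := measurePreserving_signMul e
  rw [← h.map_eq, integral_map h.measurable.aemeasurable
    hF.aestronglyMeasurable, h.map_eq]

theorem integral_expect_signMul {n : ℕ} {F : (Fin n → ℝ) → ℝ} (hF : Continuous F)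
    (hi : Integrable F (stdGaussian n)) :
    Integrable (fun x => 𝔼 e, F (signMul e x)) (stdGaussian n) ∧
    ∫ x, 𝔼 e, F (signMul e x) ∂(stdGaussian n) = ∫ x, F x ∂(stdGaussian n) := by
  have h : ∀ e : Fin n → Bool, Integrable (fun x => F (signMul e x)) (stdGaussian n) :=
    fun e => (measurePreserving_signMul e).integrable_comp_of_integrable hi
  simp only [Fintype.expect_eq_sum_div_card]
  refine ⟨(integrable_finsetSum _ fun e _ => h e).div_const _, ?_⟩
  rw [integral_div, integral_finsetSum _ fun e _ => h e]
  simp only [integral_signMul _ hF, Finset.sum_const, Finset.card_univ, nsmul_eq_mul]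
  field_simp

theorem expect_bitSign_mul {n : ℕ} (i j : Fin n) :
    𝔼 e : Fin n → Bool, bitSign (e i) * bitSign (e j) = if i = j then 1 else 0 := by
  split_ifs with h
  · subst h
    simp [← sq, bitSign_sq]
  · have h1 := expect_flipAt (fun e : Fin n → Bool => bitSign (e i) * bitSign (e j)) i
    have h2 : ∀ e : Fin n → Bool, bitSign (flipAt e i i) * bitSign (flipAt e i j) =
        -(bitSign (e i) * bitSign (e j)) := fun e => by
      simp [flipAt, bitSign_not, Ne.symm h]
    simp only [h2, Finset.expect_neg_distrib] at h1
    linarith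

theorem IsNormFun.abs_mul_le_expect_signMul {n : ℕ} {N : (Fin n → ℝ) → ℝ} (hN : IsNormFun N)
    (x : Fin n → ℝ) (j : Fin n) :
    |x j| * N (Pi.single j 1) ≤ 𝔼 e, N (signMul e x) := by
  have h := hN.expect_le fun e : Fin n → Bool => bitSign (e j) • signMul e x
  have h1 : (fun i => 𝔼 e : Fin n → Bool, (bitSign (e j) • signMul e x) i) =
      x j • (Pi.single j 1 : Fin n → ℝ) := by
    ext i
    have : ∀ e : Fin n → Bool, (bitSign (e j) • signMul e x) i =
        (bitSign (e j) * bitSign (e i)) * x i := fun e => by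
      simp [signMul, mul_assoc]
    simp only [this]
    rw [← Finset.expect_mul, expect_bitSign_mul]
    by_cases hij : j = i
    · subst hij
      simp
    · simp [hij, Ne.symm hij]
  rw [h1, hN.smul_eq] at h
  refine h.trans_eq ?_
  refine Finset.expect_congr rfl fun e _ => ?_
  rw [hN.smul_eq, abs_bitSign, one_mul]

/-- The first absolute moment of a standard Gaussian variable. -/
noncomputable def gaussAbs : ℝ := ∫ x, |x| ∂gaussianReal 0 1

theorem integrable_abs_gaussianReal : Integrable (fun x : ℝ => |x|) (gaussianReal 0 1) := by
  have h : MemLp id 1 (gaussianReal 0 1) := memLp_id_gaussianReal 1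
  exact (memLp_one_iff_integrable.1 h).abs

theorem gaussAbs_pos : 0 < gaussAbs := by
  unfold gaussAbs
  rw [integral_pos_iff_support_of_nonneg (fun x => abs_nonneg x) integrable_abs_gaussianReal]
  have : Function.support (fun x : ℝ => |x|) = {0}ᶜ := by
    ext x
    simp
  rw [this]
  have := nonempty_of_isProbabilityMeasure (gaussianReal 0 1)
  have h0 := nullSingletonClass_gaussianReal (μ := 0) (v := 1) one_ne_zero
  rw [prob_compl_eq_one_sub (measurableSet_singleton 0), measure_singleton]
  simp

theorem integral_abs_eval {n : ℕ} (j : Fin n) :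
    Integrable (fun x : Fin n → ℝ => |x j|) (stdGaussian n) ∧
    ∫ x, |x j| ∂(stdGaussian n) = gaussAbs := by
  have h : MeasurePreserving (Function.eval j) (stdGaussian n) (gaussianReal 0 1) :=
    measurePreserving_eval (fun _ => gaussianReal 0 1) j
  refine ⟨h.integrable_comp_of_integrable integrable_abs_gaussianReal, ?_⟩
  unfold gaussAbs
  rw [← h.map_eq, integral_map h.measurable.aemeasurable
    continuous_abs.aestronglyMeasurable]

theorem IsNormFun.gaussAbs_mul_le {n : ℕ} {N : (Fin n → ℝ) → ℝ} (hN : IsNormFun N)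
    (hi : Integrable N (stdGaussian n)) (j : Fin n) :
    gaussAbs * N (Pi.single j 1) ≤ ∫ x, N x ∂(stdGaussian n) := by
  obtain ⟨h1, h2⟩ := integral_expect_signMul hN.continuous hi
  rw [← h2, ← (integral_abs_eval j).2, ← integral_mul_const]
  exact integral_mono ((integral_abs_eval j).1.mul_const _) h1
    fun x => hN.abs_mul_le_expect_signMul x j

theorem IsNormFun.gaussAbs_mul_expect_le {n : ℕ} {N : (Fin n → ℝ) → ℝ} (hN : IsNormFun N)
    (hi : Integrable N (stdGaussian n)) :
    gaussAbs * 𝔼 e : Fin n → Bool, N (signMul e fun _ => 1) ≤ ∫ x, N x ∂(stdGaussian n) := by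
  obtain ⟨h1, h2⟩ := integral_expect_signMul hN.continuous hi
  rw [← h2]
  choose θ hθ1 hθ2 using fun e : Fin n → Bool => hN.exists_norming (signMul e fun _ => 1)
  have h3 : gaussAbs * 𝔼 e : Fin n → Bool, N (signMul e fun _ => 1) =
      ∫ x, 𝔼 e : Fin n → Bool, ∑ j, θ e j * (bitSign (e j) * |x j|) ∂(stdGaussian n) := by
    have hint : ∀ (e : Fin n → Bool) (j : Fin n),
        Integrable (fun x : Fin n → ℝ => θ e j * (bitSign (e j) * |x j|)) (stdGaussian n) :=
      fun e j => ((integral_abs_eval j).1.const_mul _).const_mul _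
    have hint2 : ∀ e : Fin n → Bool, Integrable (fun x : Fin n → ℝ =>
        ∑ j, θ e j * (bitSign (e j) * |x j|)) (stdGaussian n) :=
      fun e => integrable_finsetSum _ fun j _ => hint e j
    simp only [Fintype.expect_eq_sum_div_card]
    rw [integral_div, integral_finsetSum _ fun e _ => hint2 e, mul_div_assoc', Finset.mul_sum]
    congr 1
    refine Finset.sum_congr rfl fun e _ => ?_
    rw [integral_finsetSum _ fun j _ => hint e j, ← hθ2 e, Finset.mul_sum]
    refine Finset.sum_congr rfl fun j _ => ?_
    rw [integral_const_mul, integral_const_mul, (integral_abs_eval j).2]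
    simp [signMul]
    ring
  rw [h3]
  refine integral_mono ?_ h1 fun x => ?_
  · simp only [Fintype.expect_eq_sum_div_card]
    exact (integrable_finsetSum _ fun e _ => integrable_finsetSum _ fun j _ =>
      ((integral_abs_eval j).1.const_mul _).const_mul _).div_const _
  · show _ ≤ 𝔼 e, N (signMul e x)
    rw [← expect_signMul_abs]
    exact Finset.expect_le_expect fun e _ => hθ1 e _

theorem IsNormFun.integrable {n : ℕ} {N : (Fin n → ℝ) → ℝ} (hN : IsNormFun N) :
    Integrable N (stdGaussian n) := by
  refine Integrable.mono' (g := fun x => ∑ j, |x j| * N (Pi.single j 1))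
    (integrable_finsetSum _ fun j _ => (integral_abs_eval j).1.mul_const _)
    hN.continuous.aestronglyMeasurable (Filter.Eventually.of_forall fun x => ?_)
  rw [Real.norm_eq_abs, abs_of_nonneg (hN.nonneg x)]
  exact hN.le_sum_single x

/-- A lower bound for `P(|g| ≥ u)`. -/
noncomputable def gaussTail (u : ℝ) : ℝ := (√(2 * π))⁻¹ * exp (-((u + 1) ^ 2 / 2))

theorem gaussTail_le {u : ℝ} (hu : 0 ≤ u) :
    ENNReal.ofReal (gaussTail u) ≤ gaussianReal 0 1 {x | u ≤ |x|} := by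
  have h1 : gaussianReal 0 1 (Set.Icc u (u + 1)) ≤ gaussianReal 0 1 {x | u ≤ |x|} :=
    measure_mono fun x hx => hx.1.trans (le_abs_self x)
  refine le_trans ?_ h1
  rw [gaussianReal_apply 0 one_ne_zero]
  have h2 : ∀ x ∈ Set.Icc u (u + 1), ENNReal.ofReal (gaussTail u) ≤ gaussianPDF 0 1 x := by
    intro x hx
    refine ENNReal.ofReal_le_ofReal ?_
    rw [gaussTail, gaussianPDFReal]
    simp only [NNReal.coe_one, mul_one, sub_zero]
    gcongr
    rw [neg_div]
    have : x ^ 2 ≤ (u + 1) ^ 2 := pow_le_pow_left₀ (hu.trans hx.1) hx.2 2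
    linarith
  calc ENNReal.ofReal (gaussTail u)
      = ∫⁻ _ in Set.Icc u (u + 1), ENNReal.ofReal (gaussTail u) := by
        rw [setLIntegral_const, Real.volume_Icc]
        simp
    _ ≤ _ := setLIntegral_mono_ae (measurable_gaussianPDF 0 1).aemeasurable
        (Filter.Eventually.of_forall h2)

theorem measure_forall_abs_lt_le {n : ℕ} (J : Finset (Fin n)) {u : ℝ} (hu : 0 ≤ u) :
    stdGaussian n {x | ∀ j ∈ J, |x j| < u} ≤ ENNReal.ofReal (exp (-(#J * gaussTail u))) := by
  have hset : {x : Fin n → ℝ | ∀ j ∈ J, |x j| < u} =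
      Set.pi Set.univ fun j => if j ∈ J then {y : ℝ | |y| < u} else Set.univ := by
    ext x
    simp only [Set.mem_ofPred_eq, Set.mem_pi, Set.mem_univ, true_implies]
    refine forall_congr' fun j => ?_
    by_cases hj : j ∈ J <;> simp [hj]
  have h1 : gaussianReal 0 1 {y : ℝ | |y| < u} ≤ ENNReal.ofReal (exp (-gaussTail u)) := by
    have hc : {y : ℝ | |y| < u} = {y : ℝ | u ≤ |y|}ᶜ := by
      ext y
      simp
    have hm : MeasurableSet {y : ℝ | u ≤ |y|} :=
      measurableSet_le measurable_const continuous_abs.measurable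
    rw [hc, prob_compl_eq_one_sub hm]
    refine (tsub_le_tsub_left (gaussTail_le hu) 1).trans ?_
    rw [← ENNReal.ofReal_one, ← ENNReal.ofReal_sub _ (by unfold gaussTail; positivity)]
    refine ENNReal.ofReal_le_ofReal ?_
    linarith [Real.add_one_le_exp (-gaussTail u)]
  rw [hset, _root_.stdGaussian, Measure.pi_pi]
  have h2 : ∀ j, gaussianReal 0 1 (if j ∈ J then {y : ℝ | |y| < u} else Set.univ) ≤
      if j ∈ J then ENNReal.ofReal (exp (-gaussTail u)) else 1 := by
    intro j
    split_ifs
    · exact h1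
    · exact prob_le_one
  refine (Finset.prod_le_prod' fun j _ => h2 j).trans_eq ?_
  rw [Finset.prod_ite_mem, Finset.univ_inter, Finset.prod_const,
    ← ENNReal.ofReal_pow (exp_pos _).le, ← Real.exp_nat_mul]
  congr 2
  ring

theorem IsNormFun.le_integral_of_card {n : ℕ} {N : (Fin n → ℝ) → ℝ} (hN : IsNormFun N)
    {b u : ℝ} (hb : 0 ≤ b) (hu : 0 ≤ u) (J : Finset (Fin n))
    (hJ : ∀ j ∈ J, b ≤ N (Pi.single j 1)) (hcard : 1 ≤ #J * gaussTail u) :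
    b * u / 2 ≤ ∫ x, N x ∂(stdGaussian n) := by
  obtain ⟨h1, h2⟩ := integral_expect_signMul hN.continuous hN.integrable
  rw [← h2]
  set T : Set (Fin n → ℝ) := {x | ∃ j ∈ J, u ≤ |x j|} with hT
  have hTc : Tᶜ = {x | ∀ j ∈ J, |x j| < u} := by
    ext x
    simp [hT]
  have hTm : MeasurableSet T := by
    have : T = ⋃ j ∈ J, {x | u ≤ |x j|} := by
      ext x
      simp [hT]
    rw [this]
    exact Finset.measurableSet_biUnion _ fun j _ =>
      measurableSet_le measurable_const (by fun_prop)
  have h3 : (stdGaussian n).real Tᶜ ≤ 1 / 2 := by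
    rw [hTc]
    refine ENNReal.toReal_le_of_le_ofReal (by norm_num) ((measure_forall_abs_lt_le J hu).trans
      (ENNReal.ofReal_le_ofReal ?_))
    refine (Real.exp_le_exp.2 (neg_le_neg hcard)).trans ?_
    rw [Real.exp_neg, one_div]
    exact inv_anti₀ (by norm_num) (by linarith [Real.add_one_le_exp 1])
  have h4 : 1 / 2 ≤ (stdGaussian n).real T := by
    have := probReal_add_probReal_compl (μ := _root_.stdGaussian n) hTm
    linarith
  calc b * u / 2 ≤ b * u * (stdGaussian n).real T := by nlinarith [mul_nonneg hb hu]
    _ = ∫ x, T.indicator (fun _ => b * u) x ∂(stdGaussian n) := by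
        rw [integral_indicator hTm, setIntegral_const, smul_eq_mul, mul_comm]
    _ ≤ _ := by
        refine integral_mono ((integrable_const _).indicator hTm) h1 fun x => ?_
        by_cases hx : x ∈ T
        · rw [Set.indicator_of_mem hx]
          obtain ⟨j, hj, hju⟩ := hx
          refine le_trans ?_ (hN.abs_mul_le_expect_signMul x j)
          rw [mul_comm]
          exact mul_le_mul hju (hJ j hj) hb (abs_nonneg _)
        · rw [Set.indicator_of_notMem hx]
          exact Finset.expect_nonneg fun e _ => hN.nonneg _

/-- `θ` lies in the unit ball of the norm dual to `N`. -/
def DualLe {n : ℕ} (N : (Fin n → ℝ) → ℝ) (θ : Fin n → ℝ) : Prop := ∀ y, ∑ j, θ j * y j ≤ N y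

theorem expect_le_expect_of_pair {n : ℕ} {F G : (Fin n → Bool) → ℝ} (i : Fin n)
    (h : ∀ e, F e + F (flipAt e i) ≤ G e + G (flipAt e i)) : 𝔼 e, F e ≤ 𝔼 e, G e := by
  have h1 : 𝔼 e, (F e + F (flipAt e i)) ≤ 𝔼 e, (G e + G (flipAt e i)) :=
    Finset.expect_le_expect fun e _ => h e
  rw [Finset.expect_add_distrib, Finset.expect_add_distrib, expect_flipAt F, expect_flipAt G] at h1
  linarith

theorem expect_signMul_indicator_le {n : ℕ} {N : (Fin n → ℝ) → ℝ} (hN : IsNormFun N)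
    (J : Finset (Fin n)) :
    𝔼 e, N (signMul e fun j => if j ∈ J then 1 else 0) ≤ 𝔼 e, N (signMul e fun _ => 1) := by
  classical
  set J' : (Fin n → Bool) → Fin n → Bool := fun e j => if j ∈ J then e j else !e j with hJ'
  have hinv : Function.Involutive J' := by
    intro e
    ext j
    by_cases hj : j ∈ J <;> simp [hJ', hj]
  have h1 : 𝔼 e, N (signMul (J' e) fun _ => 1) = 𝔼 e, N (signMul e fun _ => 1) :=
    Fintype.expect_equiv hinv.toPerm _ _ fun _ => rfl
  have h2 : 𝔼 e, N (signMul e fun j => if j ∈ J then 1 else 0) ≤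
      𝔼 e, (1 / 2 * N (signMul e fun _ => 1) + 1 / 2 * N (signMul (J' e) fun _ => 1)) := by
    refine Finset.expect_le_expect fun e _ => ?_
    have : signMul e (fun j => if j ∈ J then 1 else 0) =
        (1 / 2 : ℝ) • signMul e (fun _ => 1) + (1 / 2 : ℝ) • signMul (J' e) (fun _ => 1) := by
      ext j
      by_cases hj : j ∈ J
      · simp [signMul, hJ', hj]
        ring
      · simp [signMul, hJ', hj, bitSign_not]
    rw [this]
    refine (hN.add_le _ _).trans_eq ?_
    rw [hN.smul_eq, hN.smul_eq, abs_of_pos (by norm_num)]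
  rw [Finset.expect_add_distrib, ← Finset.mul_expect, ← Finset.mul_expect, h1] at h2
  linarith

/-- Removing absolute values one coordinate at a time (a contraction principle). -/
theorem expect_sum_abs_le {n : ℕ} {N : (Fin n → ℝ) → ℝ}
    (J T : Finset (Fin n)) (θ : (Fin n → Bool) → Fin n → ℝ) (hθ : ∀ e, DualLe N (θ e)) :
    𝔼 e, ∑ j ∈ J, bitSign (e j) * (if j ∈ T then |θ e j| else θ e j) ≤
      𝔼 e, N (signMul e fun j => if j ∈ J then 1 else 0) := by
  classical
  induction T using Finset.induction_on generalizing θ with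
  | empty =>
    refine Finset.expect_le_expect fun e _ => ?_
    refine le_trans (le_of_eq ?_) (hθ e _)
    rw [← Finset.sum_subset (Finset.subset_univ J)]
    · exact Finset.sum_congr rfl fun j hj => by simp [signMul, hj, mul_comm]
    · intro j _ hj
      simp [signMul, hj]
  | insert i T hi ih =>
    by_cases hiJ : i ∈ J
    swap
    · refine le_trans (le_of_eq ?_) (ih θ hθ)
      refine Finset.expect_congr rfl fun e _ => Finset.sum_congr rfl fun j hj => ?_
      have : j ≠ i := fun h => hiJ (h ▸ hj)
      simp [this]
    set keep : (Fin n → Bool) → Prop :=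
      fun e => 0 ≤ bitSign (e i) * (θ e i - θ (flipAt e i) i) with hkeep
    have hflip : ∀ e, bitSign (flipAt e i i) = -bitSign (e i) := fun e => by
      simp [flipAt, bitSign_not]
    have hkf : ∀ e, keep (flipAt e i) ↔ keep e := by
      intro e
      simp only [hkeep, hflip, flipAt_flipAt]
      constructor <;> intro h <;> linarith
    set θ' : (Fin n → Bool) → Fin n → ℝ :=
      fun e => if keep e then θ e else θ (flipAt e i) with hθ'
    refine le_trans ?_ (ih θ' fun e => by
      simp only [hθ']
      split_ifs
      · exact hθ _
      · exact hθ _)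
    refine expect_le_expect_of_pair i fun e => ?_
    have hrest : ∀ e : Fin n → Bool, ∀ η : Fin n → ℝ, ∀ U : Finset (Fin n),
        ∑ j ∈ J, bitSign (e j) * (if j ∈ U then |η j| else η j) =
        bitSign (e i) * (if i ∈ U then |η i| else η i) +
        ∑ j ∈ J.erase i, bitSign (e j) * (if j ∈ U then |η j| else η j) := fun e η U =>
      (Finset.add_sum_erase J _ hiJ).symm
    have hrest2 : ∀ e : Fin n → Bool, ∀ η : Fin n → ℝ,
        ∑ j ∈ J.erase i, bitSign (e j) * (if j ∈ insert i T then |η j| else η j) =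
        ∑ j ∈ J.erase i, bitSign (e j) * (if j ∈ T then |η j| else η j) := fun e η =>
      Finset.sum_congr rfl fun j hj => by simp [(Finset.mem_erase.1 hj).1]
    have hrest3 : ∀ η : Fin n → ℝ,
        ∑ j ∈ J.erase i, bitSign (flipAt e i j) * (if j ∈ T then |η j| else η j) =
        ∑ j ∈ J.erase i, bitSign (e j) * (if j ∈ T then |η j| else η j) := fun η =>
      Finset.sum_congr rfl fun j hj => by simp [flipAt, (Finset.mem_erase.1 hj).1]
    rw [hrest e (θ e), hrest (flipAt e i) (θ (flipAt e i)), hrest e (θ' e),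
      hrest (flipAt e i) (θ' (flipAt e i)), hrest2, hrest2, hrest3, hrest3, hflip]
    simp only [Finset.mem_insert_self, if_true, hi, if_false]
    have hab := abs_abs_sub_abs_le (θ e i) (θ (flipAt e i) i)
    have hab2 := abs_le.1 hab
    by_cases hk : keep e
    · have e1 : θ' e = θ e := by simp only [hθ', hk, if_true]
      have e2 : θ' (flipAt e i) = θ (flipAt e i) := by
        simp only [hθ', (hkf e).2 hk, if_true]
      rw [e1, e2]
      have : bitSign (e i) * (|θ e i| - |θ (flipAt e i) i|) ≤
          bitSign (e i) * (θ e i - θ (flipAt e i) i) := by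
        calc _ ≤ |bitSign (e i) * (|θ e i| - |θ (flipAt e i) i|)| := le_abs_self _
          _ ≤ |bitSign (e i) * (θ e i - θ (flipAt e i) i)| := by
            rw [abs_mul, abs_mul, abs_bitSign, one_mul, one_mul]
            exact hab
          _ = _ := abs_of_nonneg hk
      linarith
    · have e1 : θ' e = θ (flipAt e i) := by simp only [hθ', hk, if_false]
      have e2 : θ' (flipAt e i) = θ e := by
        simp only [hθ', mt (hkf e).1 hk, if_false, flipAt_flipAt]
      rw [e1, e2]
      have : bitSign (e i) * (|θ e i| - |θ (flipAt e i) i|) ≤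
          -(bitSign (e i) * (θ e i - θ (flipAt e i) i)) := by
        calc _ ≤ |bitSign (e i) * (|θ e i| - |θ (flipAt e i) i|)| := le_abs_self _
          _ ≤ |bitSign (e i) * (θ e i - θ (flipAt e i) i)| := by
            rw [abs_mul, abs_mul, abs_bitSign, one_mul, one_mul]
            exact hab
          _ = _ := abs_of_neg (not_le.1 hk)
      linarith

theorem IsNormFun.exists_half {n : ℕ} {N : (Fin n → ℝ) → ℝ} (hN : IsNormFun N) {M s : ℝ}
    (hM : 𝔼 e : Fin n → Bool, N (signMul e fun _ => 1) < M)
    (J : Finset (Fin n)) (hs : ∀ θ, DualLe N θ → ∑ j ∈ J, |θ j| ≤ s) :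
    ∃ J' ⊆ J, #J ≤ 2 * #J' ∧ ∀ θ, DualLe N θ → ∑ j ∈ J', |θ j| ≤ s / 2 + M := by
  classical
  have hM0 : 0 < M :=
    (Finset.expect_nonneg fun e _ => hN.nonneg (signMul e fun _ => (1 : ℝ))).trans_lt hM
  set bal : (Fin n → Bool) → Prop := fun e => #J ≤ 2 * #{j ∈ J | e j = true} with hbal
  by_cases hex : ∃ e, bal e ∧ ∀ θ, DualLe N θ → ∑ j ∈ J, bitSign (e j) * |θ j| ≤ 2 * M
  · obtain ⟨e, he, hθ⟩ := hex
    refine ⟨{j ∈ J | e j = true}, Finset.filter_subset _ _, he, fun θ h => ?_⟩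
    have h1 := hθ θ h
    have h2 := hs θ h
    have h3 : ∑ j ∈ J with e j = true, |θ j| =
        1 / 2 * (∑ j ∈ J, |θ j| + ∑ j ∈ J, bitSign (e j) * |θ j|) := by
      rw [Finset.sum_filter, ← Finset.sum_add_distrib, Finset.mul_sum]
      refine Finset.sum_congr rfl fun j _ => ?_
      cases e j <;> simp [bitSign]
      ring
    rw [h3]
    linarith
  · exfalso
    push Not at hex
    have hsel : ∀ e, ∃ θ, DualLe N θ ∧
        (if bal e then 2 * M else 0) ≤ ∑ j ∈ J, bitSign (e j) * |θ j| := by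
      intro e
      by_cases he : bal e
      · obtain ⟨θ, h1, h2⟩ := hex e he
        exact ⟨θ, h1, by simpa [he] using h2.le⟩
      · exact ⟨0, fun y => by simpa using hN.nonneg y, by simp [he]⟩
    choose θ hθ1 hθ2 using hsel
    have h1 := expect_sum_abs_le J univ θ hθ1
    simp only [Finset.mem_univ, if_true] at h1
    have h2 : 𝔼 e, (if bal e then 2 * M else 0) ≤ _ :=
      (Finset.expect_le_expect fun e _ => hθ2 e).trans
        (h1.trans (expect_signMul_indicator_le hN J))
    have h3 : 2 * M ≤ 𝔼 e, ((if bal e then 2 * M else 0) +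
        (if bal (fun j => !e j) then 2 * M else 0)) := by
      refine Finset.le_expect Finset.univ_nonempty fun e _ => ?_
      have : bal e ∨ bal (fun j => !e j) := by
        have hc := Finset.card_filter_add_card_filter_not (s := J) (fun j => e j = true)
        simp only [hbal, Bool.not_eq_true'] at hc ⊢
        simp only [Bool.not_eq_true] at hc
        omega
      rcases this with h | h
      · rw [if_pos h]
        split_ifs <;> linarith
      · rw [if_pos h]
        split_ifs <;> linarith
    rw [Finset.expect_add_distrib, expect_not fun e => if bal e then 2 * M else 0] at h3
    linarith

theorem IsNormFun.exists_subset_dual_sum_le {n : ℕ} {N : (Fin n → ℝ) → ℝ} (hN : IsNormFun N)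
    {M s : ℝ} (hM : 𝔼 e : Fin n → Bool, N (signMul e fun _ => 1) < M)
    (I : Finset (Fin n)) (hs : ∀ θ, DualLe N θ → ∑ j ∈ I, |θ j| ≤ s) (r : ℕ) :
    ∃ J ⊆ I, #I ≤ 2 ^ r * #J ∧ ∀ θ, DualLe N θ → ∑ j ∈ J, |θ j| ≤ s / 2 ^ r + 2 * M := by
  have hM0 : 0 < M :=
    (Finset.expect_nonneg fun e _ => hN.nonneg (signMul e fun _ => (1 : ℝ))).trans_lt hM
  induction r with
  | zero => exact ⟨I, subset_rfl, by simp, fun θ h => by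
      have := hs θ h
      simp only [pow_zero, div_one]
      linarith⟩
  | succ r ih =>
    obtain ⟨J, hJI, hcard, hJ⟩ := ih
    obtain ⟨J', hJ', hcard', hs'⟩ := hN.exists_half hM J hJ
    refine ⟨J', hJ'.trans hJI, ?_, fun θ h => (hs' θ h).trans (le_of_eq ?_)⟩
    · calc #I ≤ 2 ^ r * #J := hcard
        _ ≤ 2 ^ r * (2 * #J') := by gcongr
        _ = _ := by ring
    · rw [pow_succ]
      field_simp
      ring

theorem IsNormFun.exists_sqrt_subset {n : ℕ} {N : (Fin n → ℝ) → ℝ} (hN : IsNormFun N)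
    (hE : ∀ x, N x ^ 2 ≤ ∑ j, x j ^ 2) (hn : n ≠ 0)
    {M : ℝ} (hM : 𝔼 e : Fin n → Bool, N (signMul e fun _ => 1) < M)
    (I : Finset (Fin n)) (hI : n ≤ 2 * #I) :
    ∃ J ⊆ I, √n ≤ 2 * #J ∧ ∀ θ, DualLe N θ → ∑ j ∈ J, |θ j| ≤ 2 + 2 * M := by
  have hs : ∀ θ, DualLe N θ → ∑ j ∈ I, |θ j| ≤ √n := by
    intro θ h
    have h1 := IsNormFun.sum_sq_le_one hE h
    have h2 := Finset.sum_mul_sq_le_sq_mul_sq univ (fun _ => (1 : ℝ)) fun j => |θ j|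
    simp only [one_mul, one_pow, sq_abs, Finset.sum_const, Finset.card_univ, Fintype.card_fin,
      nsmul_eq_mul, mul_one] at h2
    have h3 : ∑ j ∈ I, |θ j| ≤ ∑ j, |θ j| :=
      Finset.sum_le_sum_of_subset_of_nonneg (Finset.subset_univ I) fun _ _ _ => abs_nonneg _
    refine h3.trans (Real.le_sqrt_of_sq_le (h2.trans ?_))
    have : (0 : ℝ) ≤ n := Nat.cast_nonneg n
    nlinarith
  set q := Nat.sqrt n with hq
  have hq0 : q ≠ 0 := by
    rw [hq, Ne, Nat.sqrt_eq_zero]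
    exact hn
  obtain ⟨J, hJI, hcard, hJ⟩ := hN.exists_subset_dual_sum_le hM I hs (Nat.log 2 q)
  have h1 : 2 ^ Nat.log 2 q ≤ q := Nat.pow_log_le_self 2 hq0
  have h2 : q < 2 ^ (Nat.log 2 q + 1) := Nat.lt_pow_succ_log_self (by norm_num) q
  set R := 2 ^ Nat.log 2 q with hR
  have h1' : (R : ℝ) ≤ √n := by
    refine Real.le_sqrt_of_sq_le ?_
    have : R ^ 2 ≤ n := (Nat.pow_le_pow_left h1 2).trans (by rw [sq]; exact Nat.sqrt_le n)
    exact_mod_cast this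
  have h2' : √n ≤ 2 * R := by
    rw [Real.sqrt_le_left (by positivity)]
    have h3 : q + 1 ≤ 2 * R := by
      rw [pow_succ] at h2
      omega
    have : n ≤ (2 * R) ^ 2 :=
      (Nat.lt_succ_sqrt n).le.trans (by rw [sq]; exact Nat.mul_le_mul h3 h3)
    exact_mod_cast this
  have hR0 : (0 : ℝ) < R := by positivity
  refine ⟨J, hJI, ?_, fun θ h => (hJ θ h).trans ?_⟩
  · have h3 : n ≤ 2 * (R * #J) := hI.trans (by gcongr)
    have h4 : (n : ℝ) ≤ 2 * (R * #J) := by exact_mod_cast h3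
    have h5 : √n * √n = (n : ℝ) := Real.mul_self_sqrt (Nat.cast_nonneg n)
    have h6 : 0 < √(n : ℝ) := Real.sqrt_pos.2 (by positivity)
    have h7 : √n * √n ≤ √n * (2 * #J) := by
      rw [h5]
      refine h4.trans ?_
      have : (0 : ℝ) ≤ 2 * #J := by positivity
      nlinarith
    exact le_of_mul_le_mul_left h7 h6
  · have : (2 : ℝ) ^ Nat.log 2 q = R := by
      rw [hR]
      push_cast
      rfl
    rw [this]
    have h3 : √n / R ≤ 2 := by
      rw [div_le_iff₀ hR0]
      exact h2'
    linarith

theorem signVec_update {n k : ℕ} (a : Fin n × Fin k → ℝ) (x : Fin n × Fin k → Bool)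
    (i : Fin n × Fin k) (η : ℝ) :
    signVec (Function.update a i (η * a i)) x =
      ((1 + η) / 2) • signVec a x + ((1 - η) / 2) • signVec a (flipAt x i) := by
  ext j
  simp only [signVec, Pi.add_apply, Pi.smul_apply, smul_eq_mul]
  rw [mul_div_assoc', mul_div_assoc', ← add_div, Finset.mul_sum, Finset.mul_sum,
    ← Finset.sum_add_distrib]
  congr 1
  refine Finset.sum_congr rfl fun l _ => ?_
  by_cases h : (j, l) = i
  · subst h
    simp only [Function.update_self, flipAt, bitSign_not]
    ring
  · simp only [Function.update_of_ne h, flipAt]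
    ring

theorem IsNormFun.expect_sq_update_le {n k : ℕ} {N : (Fin n → ℝ) → ℝ} (hN : IsNormFun N)
    (a : Fin n × Fin k → ℝ) (i : Fin n × Fin k) {η : ℝ} (h0 : 0 ≤ η) (h1 : η ≤ 1) :
    𝔼 x, N (signVec (Function.update a i (η * a i)) x) ^ 2 +
      (1 - η ^ 2) / 4 * 𝔼 x, (N (signVec a x) - N (signVec a (flipAt x i))) ^ 2 ≤
    𝔼 x, N (signVec a x) ^ 2 := by
  set f : (Fin n × Fin k → Bool) → ℝ := fun x => N (signVec a x) with hf
  have hpt : ∀ x, N (signVec (Function.update a i (η * a i)) x) ^ 2 +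
      (1 - η ^ 2) / 4 * (f x - f (flipAt x i)) ^ 2 ≤
      (1 + η) / 2 * f x ^ 2 + (1 - η) / 2 * f (flipAt x i) ^ 2 := by
    intro x
    have h2 : N (signVec (Function.update a i (η * a i)) x) ≤
        (1 + η) / 2 * f x + (1 - η) / 2 * f (flipAt x i) := by
      rw [signVec_update]
      refine (hN.add_le _ _).trans_eq ?_
      rw [hN.smul_eq, hN.smul_eq, abs_of_nonneg (by linarith), abs_of_nonneg (by linarith)]
    have h3 := pow_le_pow_left₀ (hN.nonneg _) h2 2
    nlinarith
  have h4 := Finset.expect_le_expect (s := univ) fun x _ => hpt x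
  rw [Finset.expect_add_distrib, Finset.expect_add_distrib, ← Finset.mul_expect,
    ← Finset.mul_expect, ← Finset.mul_expect, expect_flipAt fun x => f x ^ 2] at h4
  linarith

/-- The weights equal to `1` on `B` and to `η` elsewhere. -/
def bitWeight {n k : ℕ} (η : ℝ) (B : Finset (Fin n × Fin k)) (i : Fin n × Fin k) : ℝ :=
  if i ∈ B then 1 else η

theorem bitWeight_erase {n k : ℕ} (η : ℝ) {B : Finset (Fin n × Fin k)} {i : Fin n × Fin k}
    (hi : i ∈ B) : bitWeight η (B.erase i) =
      Function.update (bitWeight η B) i (η * bitWeight η B i) := by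
  ext j
  by_cases h : j = i
  · subst h
    simp [bitWeight, hi]
  · simp [bitWeight, h]

theorem abs_bitWeight_le {n k : ℕ} {η : ℝ} (h0 : 0 ≤ η) (h1 : η ≤ 1)
    (B : Finset (Fin n × Fin k)) (i : Fin n × Fin k) : |bitWeight η B i| ≤ 1 := by
  unfold bitWeight
  split_ifs
  · simp
  · rwa [abs_of_nonneg h0]

theorem IsNormFun.expect_sq_bitWeight_le {n k : ℕ} {N : (Fin n → ℝ) → ℝ} (hN : IsNormFun N)
    {η : ℝ} (h0 : 0 ≤ η) (h1 : η ≤ 1) (B U : Finset (Fin n × Fin k)) :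
    𝔼 x, N (signVec (bitWeight η B) x) ^ 2 ≤ 𝔼 x, N (signVec (bitWeight η (U ∪ B)) x) ^ 2 := by
  induction U using Finset.induction_on with
  | empty => simp
  | insert i U hi ih =>
    by_cases hB : i ∈ U ∪ B
    · rwa [Finset.insert_union, Finset.insert_eq_of_mem hB]
    · refine ih.trans ?_
      have h := hN.expect_sq_update_le (bitWeight η (insert i U ∪ B)) i h0 h1
      rw [← bitWeight_erase η (by simp), Finset.insert_union, Finset.erase_insert hB] at h
      rw [Finset.insert_union]
      refine le_trans ?_ h
      have : 0 ≤ 𝔼 x, (N (signVec (bitWeight η (insert i (U ∪ B))) x) -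
          N (signVec (bitWeight η (insert i (U ∪ B))) (flipAt x i))) ^ 2 :=
        Finset.expect_nonneg fun x _ => sq_nonneg _
      have h2 : 0 ≤ (1 - η ^ 2) / 4 := by nlinarith
      linarith [mul_nonneg h2 this]

theorem IsNormFun.exists_weights {n k : ℕ} {N : (Fin n → ℝ) → ℝ} (hN : IsNormFun N)
    (hk : k ≠ 0) {η δ : ℝ} (h0 : 0 ≤ η) (h1 : η ≤ 1 / 2) (hδ : 0 < δ) (J : Finset (Fin n)) :
    ∃ B : Finset (Fin n × Fin k), B ⊆ J ×ˢ univ ∧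
      (∀ i ∈ B, 𝔼 x, (N (signVec (bitWeight η B) x) -
        N (signVec (bitWeight η B) (flipAt x i))) ^ 2 ≤ 6 * δ / k) ∧
      #J - (𝔼 x, N (signVec (fun _ : Fin n × Fin k => 1) x) ^ 2) / δ ≤ (#B : ℝ) / k := by
  have hk0 : (0 : ℝ) < k := by positivity
  set Φ : Finset (Fin n × Fin k) → ℝ :=
    fun B => 𝔼 x, N (signVec (bitWeight η B) x) ^ 2 with hΦ
  obtain ⟨B, hB, hmin⟩ := Finset.exists_min_image (J ×ˢ univ : Finset (Fin n × Fin k)).powerset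
    (fun B => Φ B - δ * (#B / k)) ⟨_, Finset.mem_powerset_self _⟩
  rw [Finset.mem_powerset] at hB
  refine ⟨B, hB, fun i hi => ?_, ?_⟩
  · have h2 := hmin (B.erase i)
      (Finset.mem_powerset.2 ((Finset.erase_subset _ _).trans hB))
    have h3 := hN.expect_sq_update_le (bitWeight η B) i h0 (by linarith)
    rw [← bitWeight_erase η hi] at h3
    set V := 𝔼 x, (N (signVec (bitWeight η B) x) -
        N (signVec (bitWeight η B) (flipAt x i))) ^ 2 with hV
    have hV0 : 0 ≤ V := Finset.expect_nonneg fun x _ => sq_nonneg _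
    have h4 : (#(B.erase i) : ℝ) = #B - 1 := by
      rw [Finset.card_erase_of_mem hi, Nat.cast_sub (Finset.card_pos.2 ⟨i, hi⟩), Nat.cast_one]
    have h5 : Φ B - Φ (B.erase i) ≤ δ / k := by
      rw [h4, sub_div, mul_sub] at h2
      have : δ * (1 / k) = δ / k := by ring
      linarith
    have h6 : (1 - η ^ 2) / 4 * V ≤ δ / k := le_trans (by simp only [hΦ]; linarith) h5
    have h7 : 6 * δ / k = 6 * (δ / k) := by ring
    rw [h7]
    have h8 : η ^ 2 ≤ 1 / 4 := by nlinarith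
    nlinarith
  · have h2 := hmin _ (Finset.mem_powerset_self _)
    have h3 : (#(J ×ˢ univ : Finset (Fin n × Fin k)) : ℝ) / k = #J := by
      rw [Finset.card_product, Finset.card_univ, Fintype.card_fin]
      push_cast
      field_simp
    rw [h3] at h2
    have h4 : Φ (J ×ˢ univ) ≤ 𝔼 x, N (signVec (fun _ : Fin n × Fin k => 1) x) ^ 2 := by
      have h := hN.expect_sq_bitWeight_le h0 (by linarith) (J ×ˢ univ : Finset (Fin n × Fin k)) univ
      have e : bitWeight η (univ ∪ (J ×ˢ univ : Finset (Fin n × Fin k))) = fun _ => 1 := by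
        ext i
        simp [bitWeight]
      rwa [e] at h
    have h5 : 0 ≤ Φ B := Finset.expect_nonneg fun x _ => sq_nonneg _
    rw [sub_le_iff_le_add, ← sub_le_iff_le_add', le_div_iff₀ hδ]
    nlinarith

theorem IsNormFun.sum_posDiff_bitWeight_le {n k : ℕ} {N : (Fin n → ℝ) → ℝ} (hN : IsNormFun N)
    (hE : ∀ x, N x ^ 2 ≤ ∑ j, x j ^ 2) (hk : k ≠ 0) {η s : ℝ} (h0 : 0 ≤ η) {J : Finset (Fin n)}
    (hs : ∀ θ, DualLe N θ → ∑ j ∈ J, |θ j| ≤ s) {B : Finset (Fin n × Fin k)}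
    (hB : B ⊆ J ×ˢ univ) (x : Fin n × Fin k → Bool) :
    ∑ i, posDiff (fun x => N (signVec (bitWeight η B) x)) i x ≤ 2 * √k * (s + n * η) := by
  obtain ⟨θ, h1, h2⟩ := hN.exists_norming (signVec (bitWeight η B) x)
  have hk0 : (0 : ℝ) < k := by positivity
  have hθ1 : ∀ j, |θ j| ≤ 1 := by
    intro j
    have h := Finset.single_le_sum (f := fun j => θ j ^ 2) (fun j _ => sq_nonneg _)
      (Finset.mem_univ j)
    have := h.trans (IsNormFun.sum_sq_le_one hE h1)
    exact (sq_le_one_iff_abs_le_one _).1 this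
  have hterm : ∀ i, posDiff (fun x => N (signVec (bitWeight η B) x)) i x ≤
      2 / √k * ((if i.1 ∈ J then |θ i.1| else 0) + η) := by
    intro i
    refine (IsNormFun.posDiff_signVec_le _ x h1 h2 i).trans ?_
    have h3 : |θ i.1| * |bitWeight η B i| ≤ (if i.1 ∈ J then |θ i.1| else 0) + η := by
      unfold bitWeight
      by_cases hi : i ∈ B
      · have : i.1 ∈ J := (Finset.mem_product.1 (hB hi)).1
        simp [hi, this, h0]
      · simp only [hi, if_false, abs_of_nonneg h0]
        have : 0 ≤ if i.1 ∈ J then |θ i.1| else 0 := by split_ifs <;> positivity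
        nlinarith [hθ1 i.1]
    calc 2 * |θ i.1| * |bitWeight η B i| / √k = 2 / √k * (|θ i.1| * |bitWeight η B i|) := by ring
      _ ≤ _ := by gcongr
  refine (Finset.sum_le_sum fun i _ => hterm i).trans ?_
  rw [← Finset.mul_sum, Fintype.sum_prod_type]
  simp only [Finset.sum_const, Finset.card_univ, Fintype.card_fin, nsmul_eq_mul]
  rw [← Finset.mul_sum, Finset.sum_add_distrib, Finset.sum_ite_mem, Finset.univ_inter]
  simp only [Finset.sum_const, Finset.card_univ, Fintype.card_fin, nsmul_eq_mul]
  have e : 2 / √k * (k * (∑ j ∈ J, |θ j| + n * η)) = 2 * √k * (∑ j ∈ J, |θ j| + n * η) := by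
    have h3 : √(k : ℝ) ≠ 0 := (Real.sqrt_pos.2 hk0).ne'
    have h4 : √(k : ℝ) * √k = k := Real.mul_self_sqrt hk0.le
    field_simp
    rw [Real.sq_sqrt hk0.le]
  rw [e]
  gcongr
  exact hs θ h1

theorem IsNormFun.sum_expect_mul_bitWeight_le {n k : ℕ} {N : (Fin n → ℝ) → ℝ} (hN : IsNormFun N)
    (hE : ∀ x, N x ^ 2 ≤ ∑ j, x j ^ 2) (hk : k ≠ 0) {η s δ : ℝ} (h0 : 0 ≤ η) (hs0 : 0 ≤ s)
    (hδ : 0 < δ) {J : Finset (Fin n)}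
    (hs : ∀ θ, DualLe N θ → ∑ j ∈ J, |θ j| ≤ s) {B : Finset (Fin n × Fin k)}
    (hB : B ⊆ J ×ˢ univ) (hBδ : ∀ i ∈ B, 𝔼 x, (N (signVec (bitWeight η B) x) -
        N (signVec (bitWeight η B) (flipAt x i))) ^ 2 ≤ 6 * δ / k)
    {g : (Fin n × Fin k → Bool) → ℝ} (hg : ∀ x, 0 ≤ g x) :
    ∑ i, (𝔼 x, g x * posDiff (fun x => N (signVec (bitWeight η B) x)) i x) ^ 2 ≤
      (2 * (s + n * η) * √(6 * δ + 4 * η ^ 2)) * 𝔼 x, g x ^ 2 := by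
  have hk0 : (0 : ℝ) < k := by positivity
  have hsk : 0 < √(k : ℝ) := Real.sqrt_pos.2 hk0
  set f : (Fin n × Fin k → Bool) → ℝ := fun x => N (signVec (bitWeight η B) x) with hf
  set G := 𝔼 x, g x ^ 2 with hG
  have hG0 : 0 ≤ G := Finset.expect_nonneg fun x _ => sq_nonneg _
  have hdiff : ∀ i, 𝔼 x, (f x - f (flipAt x i)) ^ 2 ≤ (6 * δ + 4 * η ^ 2) / k := by
    intro i
    by_cases hi : i ∈ B
    · refine (hBδ i hi).trans ?_
      gcongr
      nlinarith [sq_nonneg η]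
    · refine Finset.expect_le Finset.univ_nonempty fun x _ => ?_
      have h1 := hN.abs_sub_flipAt_signVec_le hE (bitWeight η B) i x
      have h2 : |bitWeight η B i| = η := by simp [bitWeight, hi, abs_of_nonneg h0]
      rw [h2] at h1
      have h3 := pow_le_pow_left₀ (abs_nonneg _) h1 2
      rw [sq_abs, div_pow, Real.sq_sqrt hk0.le] at h3
      refine h3.trans ?_
      gcongr
      nlinarith [sq_nonneg η]
  set κ := √(6 * δ + 4 * η ^ 2) with hκ
  have hmax : ∀ i, 𝔼 x, g x * posDiff f i x ≤ √G * (κ / √k) := by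
    intro i
    refine (le_abs_self _).trans (Real.abs_le_sqrt (expect_mul_sq_le g (posDiff f i)) |>.trans ?_)
    rw [Real.sqrt_mul hG0]
    gcongr
    rw [hκ, ← Real.sqrt_div (by positivity)]
    refine Real.sqrt_le_sqrt (le_trans (Finset.expect_le_expect fun x _ => ?_) (hdiff i))
    rw [sq_sub_flipAt f]
    linarith [sq_nonneg (posDiff f i (flipAt x i))]
  have hnn : ∀ i, 0 ≤ 𝔼 x, g x * posDiff f i x := fun i =>
    Finset.expect_nonneg fun x _ => mul_nonneg (hg x) (posDiff_nonneg _ _ _)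
  have hsum : ∑ i, 𝔼 x, g x * posDiff f i x ≤ √G * (2 * √k * (s + n * η)) := by
    rw [← Finset.expect_sum_comm]
    have hc : 0 ≤ 2 * √k * (s + n * η) := by positivity
    have h1 : 𝔼 x, g x ≤ √G := by
      have := expect_mul_sq_le g fun _ => 1
      simp only [mul_one, one_pow, Finset.expect_const Finset.univ_nonempty] at this
      exact (le_abs_self _).trans (Real.abs_le_sqrt this)
    calc 𝔼 x, ∑ i, g x * posDiff f i x ≤ 𝔼 x, g x * (2 * √k * (s + n * η)) := by
          refine Finset.expect_le_expect fun x _ => ?_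
          rw [← Finset.mul_sum]
          exact mul_le_mul_of_nonneg_left
            (hN.sum_posDiff_bitWeight_le hE hk h0 hs hB x) (hg x)
      _ = (𝔼 x, g x) * (2 * √k * (s + n * η)) := by rw [Finset.expect_mul]
      _ ≤ _ := by gcongr
  calc ∑ i, (𝔼 x, g x * posDiff f i x) ^ 2
      ≤ ∑ i, √G * (κ / √k) * 𝔼 x, g x * posDiff f i x := by
        refine Finset.sum_le_sum fun i _ => ?_
        rw [sq]
        exact mul_le_mul_of_nonneg_right (hmax i) (hnn i)
    _ = √G * (κ / √k) * ∑ i, 𝔼 x, g x * posDiff f i x := by rw [Finset.mul_sum]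
    _ ≤ √G * (κ / √k) * (√G * (2 * √k * (s + n * η))) := by gcongr
    _ = (√G * √G) * (2 * (s + n * η) * κ) := by
        field_simp
    _ = _ := by rw [Real.mul_self_sqrt hG0, mul_comm]

theorem tendsto_sum_one_div {n : ℕ} (j : Fin n) :
    Filter.Tendsto (fun m : ℕ => (∑ l : Fin m, (fun _ : Fin n × Fin m => (1 : ℝ)) (j, l) ^ 2) / m)
      Filter.atTop (nhds 1) := by
  refine tendsto_const_nhds.congr' ?_
  filter_upwards [Filter.eventually_ne_atTop 0] with m hm
  simp [hm]

theorem IsNormFun.eventually_expect_sq_le {n : ℕ} {N : (Fin n → ℝ) → ℝ} (hN : IsNormFun N)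
    (hE : ∀ x, N x ^ 2 ≤ ∑ j, x j ^ 2) :
    ∀ᶠ k : ℕ in Filter.atTop, 𝔼 x, N (signVec (fun _ : Fin n × Fin k => 1) x) ^ 2 ≤
      (∫ y, N y ∂(stdGaussian n) + 1) ^ 2 + 10 := by
  have h := tendsto_expect_norm_signVec Filter.tendsto_id (fun k (_ : Fin n × Fin k) => (1 : ℝ))
    (by simp) tendsto_sum_one_div hN hE
  simp only [Real.sqrt_one, one_mul, id_eq] at h
  filter_upwards [h.eventually_le_const (lt_add_one _)] with k hk
  have h1 := cube_variance_le (fun x => N (signVec (fun _ : Fin n × Fin k => 1) x))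
    (hN.sum_posDiff_sq_le hE (by simp))
  have h2 : 0 ≤ 𝔼 x, N (signVec (fun _ : Fin n × Fin k => 1) x) :=
    Finset.expect_nonneg fun x _ => hN.nonneg _
  have h3 := pow_le_pow_left₀ h2 hk 2
  linarith

theorem sum_bitWeight_sq {n k : ℕ} (η : ℝ) (B : Finset (Fin n × Fin k)) (j : Fin n) :
    ∑ l, bitWeight η B (j, l) ^ 2 = #{l | (j, l) ∈ B} + η ^ 2 * (k - #{l | (j, l) ∈ B}) := by
  have h : ∀ l, bitWeight η B (j, l) ^ 2 = η ^ 2 + (1 - η ^ 2) * (if (j, l) ∈ B then 1 else 0) := by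
    intro l
    unfold bitWeight
    split_ifs <;> ring
  simp only [h, Finset.sum_add_distrib, ← Finset.mul_sum, Finset.sum_boole]
  simp
  ring

theorem card_le_four_mul_card_filter {α : Type*} (J : Finset α) {β : α → ℝ} (h1 : ∀ j, β j ≤ 1)
    (h : (#J : ℝ) / 2 ≤ ∑ j ∈ J, β j) : (#J : ℝ) ≤ 4 * #{j ∈ J | 1 / 4 ≤ β j} := by
  have h2 : ∑ j ∈ J, β j ≤ ∑ j ∈ J, ((if 1 / 4 ≤ β j then 1 else 0) + 1 / 4) := by
    refine Finset.sum_le_sum fun j _ => ?_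
    split_ifs with h3
    · linarith [h1 j]
    · linarith
  rw [Finset.sum_add_distrib, Finset.sum_boole, Finset.sum_const, nsmul_eq_mul] at h2
  linarith

theorem IsNormFun.exists_profile {n : ℕ} {N : (Fin n → ℝ) → ℝ} (hN : IsNormFun N)
    (hE : ∀ x, N x ^ 2 ≤ ∑ j, x j ^ 2) {η s δ : ℝ} (h0 : 0 < η) (h1 : η ≤ 1 / 2) (hs0 : 0 ≤ s)
    (hδ : 0 < δ) {J : Finset (Fin n)}
    (hs : ∀ θ, DualLe N θ → ∑ j ∈ J, |θ j| ≤ s)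
    (hJ : 2 * ((∫ y, N y ∂(stdGaussian n) + 1) ^ 2 + 10) ≤ δ * #J) :
    ∃ φ : ℕ → ℕ, Filter.Tendsto φ Filter.atTop Filter.atTop ∧
      ∃ a : ∀ m, Fin n × Fin (φ m) → ℝ, (∀ m i, |a m i| ≤ 1) ∧
      ∃ r : Fin n → ℝ, (∀ j, 0 < r j) ∧ (#J : ℝ) ≤ 4 * #{j ∈ J | 1 / 4 ≤ r j} ∧
        (∀ j, Filter.Tendsto (fun m => (∑ l, a m (j, l) ^ 2) / φ m) Filter.atTop (nhds (r j))) ∧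
        ∀ᶠ m in Filter.atTop, ∀ g : (Fin n × Fin (φ m) → Bool) → ℝ, (∀ x, 0 ≤ g x) →
          ∑ i, (𝔼 x, g x * posDiff (fun x => N (signVec (a m) x)) i x) ^ 2 ≤
            (2 * (s + n * η) * √(6 * δ + 4 * η ^ 2)) * 𝔼 x, g x ^ 2 := by
  have hex : ∀ k : ℕ, ∃ B : Finset (Fin n × Fin k), B ⊆ J ×ˢ univ ∧ (k ≠ 0 →
      (∀ i ∈ B, 𝔼 x, (N (signVec (bitWeight η B) x) -
        N (signVec (bitWeight η B) (flipAt x i))) ^ 2 ≤ 6 * δ / k) ∧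
      #J - (𝔼 x, N (signVec (fun _ : Fin n × Fin k => 1) x) ^ 2) / δ ≤ (#B : ℝ) / k) := by
    intro k
    rcases eq_or_ne k 0 with rfl | hk
    · exact ⟨∅, by simp, by simp⟩
    · obtain ⟨B, hB, h⟩ := hN.exists_weights hk h0.le h1 hδ J
      exact ⟨B, hB, fun _ => h⟩
  choose B hBJ hB using hex
  set β : ℕ → Fin n → ℝ := fun k j => #{l | (j, l) ∈ B k} / k with hβ
  have hβ01 : ∀ k, β k ∈ Set.Icc (0 : Fin n → ℝ) 1 := by
    intro k
    refine ⟨fun j => by simp only [hβ, Pi.zero_apply]; positivity, fun j => ?_⟩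
    refine div_le_one_of_le₀ ?_ (by positivity)
    exact Nat.cast_le.2 ((Finset.card_le_univ _).trans_eq (Fintype.card_fin k))
  obtain ⟨b, hb, φ, hφ, hlim⟩ := isCompact_Icc.tendsto_subseq hβ01
  have hlimj : ∀ j, Filter.Tendsto (fun m => β (φ m) j) Filter.atTop (nhds (b j)) := fun j =>
    (tendsto_pi_nhds.1 hlim) j
  have hφt := hφ.tendsto_atTop
  have hne : ∀ᶠ m in Filter.atTop, φ m ≠ 0 := hφt.eventually (Filter.eventually_ne_atTop 0)
  have hsum : ∀ k, ∑ j ∈ J, β k j = (#(B k) : ℝ) / k := by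
    intro k
    have h := Finset.card_eq_sum_card_fiberwise (s := B k) (t := J) (f := Prod.fst)
      fun i hi => (Finset.mem_product.1 (hBJ k hi)).1
    rw [h, Nat.cast_sum, Finset.sum_div]
    refine Finset.sum_congr rfl fun j _ => ?_
    simp only [hβ]
    congr 2
    refine Finset.card_bij (fun l _ => (j, l)) ?_ ?_ ?_
    · intro l hl
      simpa using hl
    · intro l _ l' _ h
      simpa using h
    · rintro ⟨j', l⟩ hi
      obtain ⟨h1, h2⟩ := Finset.mem_filter.1 hi
      have h3 : j' = j := h2
      subst h3
      exact ⟨l, by simpa using h1, rfl⟩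
  have hhalf : (#J : ℝ) / 2 ≤ ∑ j ∈ J, b j := by
    refine ge_of_tendsto (tendsto_finsetSum J fun j _ => hlimj j) ?_
    filter_upwards [hne, hφt.eventually (hN.eventually_expect_sq_le hE)] with m hm hm2
    rw [hsum]
    refine le_trans ?_ (hB _ hm).2
    have h5 : (𝔼 x, N (signVec (fun _ : Fin n × Fin (φ m) => 1) x) ^ 2) / δ ≤ (#J : ℝ) / 2 := by
      rw [div_le_iff₀ hδ]
      linarith
    linarith
  refine ⟨φ, hφt, fun m => bitWeight η (B (φ m)),
    fun m => abs_bitWeight_le h0.le (by linarith) _, fun j => b j + η ^ 2 * (1 - b j), ?_, ?_, ?_, ?_⟩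
  · intro j
    have h2 := hb.1 j
    have h3 := hb.2 j
    simp only [Pi.zero_apply, Pi.one_apply] at h2 h3
    have h4 : 0 < η ^ 2 := by positivity
    have h5 : η ^ 2 ≤ 1 / 4 := by nlinarith
    nlinarith
  · refine (card_le_four_mul_card_filter J (fun j => hb.2 j) hhalf).trans ?_
    have hsub : {j ∈ J | 1 / 4 ≤ b j} ⊆ {j ∈ J | 1 / 4 ≤ b j + η ^ 2 * (1 - b j)} := by
      refine Finset.monotone_filter_right J fun j _ hj => ?_
      have h3 : b j ≤ 1 := hb.2 j
      have h4 := mul_nonneg (sq_nonneg η) (sub_nonneg.2 h3)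
      linarith
    have := Finset.card_le_card hsub
    gcongr
  · intro j
    have h2 : Filter.Tendsto (fun m => β (φ m) j + η ^ 2 * (1 - β (φ m) j)) Filter.atTop
        (nhds (b j + η ^ 2 * (1 - b j))) :=
      (hlimj j).add (((hlimj j).const_sub 1).const_mul _)
    refine h2.congr' ?_
    filter_upwards [hne] with m hm
    have : (φ m : ℝ) ≠ 0 := by exact_mod_cast hm
    rw [sum_bitWeight_sq]
    simp only [hβ]
    field_simp
  · filter_upwards [hne] with m hm g hg
    exact hN.sum_expect_mul_bitWeight_le hE hm h0.le hs0 hδ hs (hBJ _) (hB _ hm).1 hg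

theorem IsNormFun.tail_of_large_integral {n : ℕ} {N : (Fin n → ℝ) → ℝ} (hN : IsNormFun N)
    (hE : ∀ x, N x ^ 2 ≤ ∑ j, x j ^ 2) (hn : 2 ≤ n) {κ : ℝ} (hκ0 : 0 ≤ κ) (hκ1 : κ ≤ 1)
    (hw : κ * log n ≤ ∫ y, N y ∂(stdGaussian n)) {t : ℝ} (ht : 0 < t) :
    stdGaussian n {y | t * (∫ y, N y ∂(stdGaussian n)) < |N y - ∫ y, N y ∂(stdGaussian n)|} ≤
      ENNReal.ofReal (2 * exp 2 * exp (-(κ ^ 2 / 16) * max (t ^ 2) t * log n)) := by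
  have hlog : 1 / 2 ≤ log n := by
    have h1 : log 2 ≤ log n := Real.log_le_log (by norm_num) (by exact_mod_cast hn)
    linarith [Real.log_two_gt_d9]
  have h1 := fun u => measure_abs_gt_le Filter.tendsto_id
    (fun k (_ : Fin n × Fin k) => (1 : ℝ)) (by simp) tendsto_sum_one_div hN hE (τ := 4) (L := 0) (by norm_num)
    le_rfl (Filter.Eventually.of_forall fun k g _ => sum_expect_mul_posDiff_sq_le _
      (hN.sum_posDiff_sq_le hE (by simp)) g) u
  have h2 := fun u (hu : 0 ≤ u) => measure_gt_le Filter.tendsto_id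
    (fun k (_ : Fin n × Fin k) => (1 : ℝ)) (by simp) tendsto_sum_one_div hN hE hu
  simp only [Real.sqrt_one, one_mul, Real.exp_zero, add_zero, div_one] at h1 h2
  set w := ∫ y, N y ∂(stdGaussian n) with hwdef
  have hw0 : 0 ≤ w := integral_nonneg fun y => hN.nonneg y
  have h5 : √(2 * (6 + 4) : ℝ) ≤ 5 := by
    rw [Real.sqrt_le_left (by norm_num)]
    norm_num
  have hκ2 : κ ^ 2 ≤ κ := by nlinarith
  refine mixed_tail_of_tails _ (fun y => hN.nonneg y) hw0 h1 h2 ?_ ?_ ht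
  · calc κ ^ 2 / 16 * log n ≤ κ * log n / 5 := by nlinarith
      _ ≤ w / 5 := by gcongr
      _ ≤ _ := by gcongr
  · have h6 : (κ * log n) ^ 2 ≤ w ^ 2 := by gcongr
    nlinarith [mul_nonneg (sq_nonneg κ) (show 0 ≤ log n * (log n - 1 / 2) by nlinarith)]

theorem IsNormFun.diag {n : ℕ} {N : (Fin n → ℝ) → ℝ} (hN : IsNormFun N) {r : Fin n → ℝ}
    (hr : ∀ j, 0 < r j) : IsNormFun fun y => N fun j => √(r j) * y j where
  add_le x y := by
    refine le_of_eq_of_le (congrArg N ?_) (hN.add_le _ _)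
    ext j
    simp [mul_add]
  smul_eq c x := by
    rw [← hN.smul_eq]
    congr 1
    ext j
    simp only [Pi.smul_apply, smul_eq_mul]
    ring
  eq_zero x hx := by
    ext j
    have h := congrFun (hN.eq_zero _ hx) j
    simpa [(Real.sqrt_pos.2 (hr j)).ne'] using h

theorem IsNormFun.exists_tail_of_small_integral {n : ℕ} {N : (Fin n → ℝ) → ℝ} (hN : IsNormFun N)
    (hE : ∀ x, N x ^ 2 ≤ ∑ j, x j ^ 2) (hn : 2 ≤ n)
    (hI : n ≤ 2 * #{j | 1 / 2 ≤ N (Pi.single j 1)})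
    (hw : ∫ y, N y ∂(stdGaussian n) ≤ log n) (h6 : 6 ≤ log n)
    (hA : (10 + 4 * log n / gaussAbs) ^ 2 * (24 * ((log n + 1) ^ 2 + 10) + 4) ≤ exp (log n / 4))
    (hB : 8 * √(2 * π) ≤ exp (log n / 4)) :
    ∃ r : Fin n → ℝ, (∀ j, 0 < r j) ∧ ∀ t > 0,
      stdGaussian n {y | t * (∫ y, N (fun j => √(r j) * y j) ∂(stdGaussian n)) <
          |N (fun j => √(r j) * y j) - ∫ y, N (fun j => √(r j) * y j) ∂(stdGaussian n)|} ≤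
        ENNReal.ofReal (2 * exp 2 * exp (-(1 / 8192) * max (t ^ 2) t * log n)) := by
  set w := ∫ y, N y ∂(stdGaussian n) with hwdef
  set ℓ := log n
  have hg := gaussAbs_pos
  have hw0 : 0 ≤ w := integral_nonneg fun y => hN.nonneg y
  have hn0 : (0 : ℝ) < n := by positivity
  have hn2 : (2 : ℝ) ≤ n := by exact_mod_cast hn
  have hnℓ : (n : ℝ) = exp ℓ := (Real.exp_log hn0).symm
  clear_value ℓ
  have hsn : √(n : ℝ) = exp (ℓ / 2) := by rw [hnℓ, Real.exp_half]
  have hM : 𝔼 e : Fin n → Bool, N (signMul e fun _ => 1) < w / gaussAbs + 1 := by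
    have h := hN.gaussAbs_mul_expect_le hN.integrable
    rw [mul_comm, ← le_div_iff₀ hg] at h
    linarith
  obtain ⟨J, hJI, hJ, hs⟩ := hN.exists_sqrt_subset hE (by omega) hM _ hI
  have hJ0 : (0 : ℝ) < #J := by
    have : 0 < √(n : ℝ) := Real.sqrt_pos.2 hn0
    linarith
  set Φ := (w + 1) ^ 2 + 10 with hΦ
  have hΦ0 : 0 < Φ := by positivity
  obtain ⟨φ, hφ, a, ha, r, hr, hcard, hlim, hτ⟩ := hN.exists_profile hE
    (η := 1 / n) (s := 2 + 2 * (w / gaussAbs + 1)) (δ := 2 * Φ / #J) (by positivity)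
    (one_div_le_one_div_of_le two_pos hn2) (by positivity) (by positivity) hs
    (le_of_eq (by field_simp; exact hΦ.symm))
  set τ := 2 * (2 + 2 * (w / gaussAbs + 1) + n * (1 / n)) *
    √(6 * (2 * Φ / #J) + 4 * (1 / (n : ℝ)) ^ 2) with hτdef
  have hτ0 : 0 ≤ τ := by positivity
  have hexpτ : exp (ℓ / 8) * τ ≤ 1 := by
    have e1 : 6 * (2 * Φ / #J) + 4 * (1 / (n : ℝ)) ^ 2 ≤
        (24 * ((ℓ + 1) ^ 2 + 10) + 4) * exp (-(ℓ / 2)) := by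
      have e2 : Φ / #J ≤ ((ℓ + 1) ^ 2 + 10) * (2 * exp (-(ℓ / 2))) := by
        rw [div_eq_mul_inv]
        refine mul_le_mul (by simp only [hΦ]; gcongr) ?_ (by positivity) (by positivity)
        rw [Real.exp_neg, ← hsn, inv_le_comm₀ hJ0 (by positivity)]
        field_simp
        linarith
      have e3 : (1 / (n : ℝ)) ^ 2 ≤ exp (-(ℓ / 2)) := by
        rw [hnℓ, one_div, ← Real.exp_neg, ← Real.exp_nat_mul]
        refine Real.exp_le_exp.2 ?_
        push_cast
        linarith
      have e4 : 2 * Φ / #J = 2 * (Φ / #J) := by ring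
      rw [e4]
      linarith
    have e5 : 2 * (2 + 2 * (w / gaussAbs + 1) + n * (1 / n)) ≤ 10 + 4 * ℓ / gaussAbs := by
      have e6 : (n : ℝ) * (1 / n) = 1 := by field_simp
      have e7 : w / gaussAbs ≤ ℓ / gaussAbs := by gcongr
      rw [e6]
      have e8 : 4 * ℓ / gaussAbs = 4 * (ℓ / gaussAbs) := by ring
      linarith
    refine (sq_le_one_iff₀ (by positivity)).1 ?_
    rw [hτdef, mul_pow, mul_pow, Real.sq_sqrt (by positivity)]
    calc _ ≤ exp (ℓ / 8) ^ 2 * ((10 + 4 * ℓ / gaussAbs) ^ 2 *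
          ((24 * ((ℓ + 1) ^ 2 + 10) + 4) * exp (-(ℓ / 2)))) := by gcongr
      _ = exp (ℓ / 8) ^ 2 * ((10 + 4 * ℓ / gaussAbs) ^ 2 *
          (24 * ((ℓ + 1) ^ 2 + 10) + 4)) * exp (-(ℓ / 2)) := by ring
      _ ≤ exp (ℓ / 8) ^ 2 * exp (ℓ / 4) * exp (-(ℓ / 2)) := by gcongr
      _ = 1 := by
        rw [← Real.exp_nat_mul, ← Real.exp_add, ← Real.exp_add, ← Real.exp_zero]
        congr 1
        push_cast
        ring
  have hN' := hN.diag hr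
  have hw' : √ℓ / 32 ≤ ∫ y, N (fun j => √(r j) * y j) ∂(stdGaussian n) := by
    have h := hN'.le_integral_of_card (b := 1 / 4) (u := √ℓ / 4) (by norm_num) (by positivity)
      {j ∈ J | 1 / 4 ≤ r j} ?_ ?_
    · linarith
    · intro j hj
      obtain ⟨hj1, hj2⟩ := Finset.mem_filter.1 hj
      have hj3 : 1 / 2 ≤ N (Pi.single j 1) := by simpa using hJI hj1
      have e : (fun i => √(r i) * (Pi.single j 1 : Fin n → ℝ) i) =
          √(r j) • (Pi.single j 1 : Fin n → ℝ) := by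
        ext i
        rcases eq_or_ne i j with rfl | hij
        · simp
        · simp [hij]
      rw [e, hN.smul_eq, abs_of_nonneg (Real.sqrt_nonneg _)]
      have h12 : 1 / 2 ≤ √(r j) := Real.le_sqrt_of_sq_le (by linarith)
      nlinarith
    · have h8 : exp (ℓ / 2) / 8 ≤ #{j ∈ J | 1 / 4 ≤ r j} := by
        rw [← hsn]
        linarith
      have h9 : exp (-(ℓ / 16 + 1)) ≤ exp (-((√ℓ / 4 + 1) ^ 2 / 2)) := by
        refine Real.exp_le_exp.2 ?_
        have := Real.sq_sqrt (show 0 ≤ ℓ by linarith)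
        nlinarith [sq_nonneg (√ℓ / 4 - 1)]
      have h10 : 0 < √(2 * π) := by positivity
      calc (1 : ℝ) = 8 * √(2 * π) * (1 / 8 * (√(2 * π))⁻¹) := by field_simp
        _ ≤ exp (ℓ / 4) * (1 / 8 * (√(2 * π))⁻¹) := by gcongr
        _ ≤ exp (ℓ / 2 + -(ℓ / 16 + 1)) * (1 / 8 * (√(2 * π))⁻¹) := by
          gcongr
          linarith
        _ = exp (ℓ / 2) / 8 * ((√(2 * π))⁻¹ * exp (-(ℓ / 16 + 1))) := by
          rw [Real.exp_add]
          ring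
        _ ≤ _ := by
          unfold gaussTail
          gcongr
  refine ⟨r, hr, fun t ht => ?_⟩
  have hℓ0 : 0 < ℓ := by linarith
  have hsℓ : √ℓ * √ℓ = ℓ := Real.mul_self_sqrt hℓ0.le
  have hsℓ0 : 0 < √ℓ := Real.sqrt_pos.2 hℓ0
  have hw'0 := (show 0 ≤ √ℓ / 32 by positivity).trans hw'
  refine mixed_tail_of_tails _ (fun y => hN.nonneg _) hw'0
    (measure_abs_gt_le hφ a ha hlim hN hE (L := ℓ / 8) hτ0 (by positivity) hτ)
    (fun u hu => measure_gt_le hφ a ha hlim hN hE hu) ?_ ?_ ht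
  · have hq : √(2 * ((6 + exp (ℓ / 8) * τ) / (1 + ℓ / 8))) ≤ 11 / √ℓ := by
      rw [Real.sqrt_le_left (by positivity), div_pow, Real.sq_sqrt hℓ0.le, ← mul_div_assoc,
        div_le_div_iff₀ (by positivity) hℓ0]
      nlinarith
    have hq0 : 0 < √(2 * ((6 + exp (ℓ / 8) * τ) / (1 + ℓ / 8))) := by positivity
    calc 1 / 8192 * ℓ ≤ (√ℓ / 32) / (11 / √ℓ) := by
          rw [div_div_div_eq, hsℓ]
          linarith
      _ ≤ _ := by gcongr
  · have := pow_le_pow_left₀ (show 0 ≤ √ℓ / 32 by positivity) hw' 2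
    rw [div_pow, Real.sq_sqrt hℓ0.le] at this
    linarith

theorem exists_log_threshold : ∃ ℓ₀ : ℝ, ∀ ℓ ≥ ℓ₀, 6 ≤ ℓ ∧
    (10 + 4 * ℓ / gaussAbs) ^ 2 * (24 * ((ℓ + 1) ^ 2 + 10) + 4) ≤ exp (ℓ / 4) ∧
    8 * √(2 * π) ≤ exp (ℓ / 4) := by
  have hd : Filter.Tendsto (fun ℓ : ℝ => ℓ / 4) Filter.atTop Filter.atTop :=
    Filter.tendsto_id.atTop_div_const (by norm_num)
  set P : Polynomial ℝ := (.C 10 + .C (16 / gaussAbs) * .X) ^ 2 *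
    (.C 24 * ((.C 4 * .X + 1) ^ 2 + .C 10) + .C 4) with hP
  have h1 : ∀ᶠ x : ℝ in Filter.atTop, P.eval x / exp x ≤ 1 :=
    P.tendsto_div_exp_atTop.eventually_le_const one_pos
  refine Filter.eventually_atTop.1 ?_
  filter_upwards [Filter.eventually_ge_atTop 6, hd.eventually h1,
    (Real.tendsto_exp_atTop.comp hd).eventually_ge_atTop (8 * √(2 * π))] with ℓ h6 hA hB
  refine ⟨h6, ?_, hB⟩
  rw [div_le_one (exp_pos _)] at hA
  refine le_of_eq_of_le ?_ hA
  simp only [hP, Polynomial.eval_mul, Polynomial.eval_pow, Polynomial.eval_add,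
    Polynomial.eval_C, Polynomial.eval_X, Polynomial.eval_one]
  ring

theorem IsNormFun.comp_linearEquiv {n : ℕ} {N : (Fin n → ℝ) → ℝ} (hN : IsNormFun N)
    (S : (Fin n → ℝ) ≃ₗ[ℝ] (Fin n → ℝ)) : IsNormFun fun x => N (S x) where
  add_le x y := by
    rw [map_add]
    exact hN.add_le _ _
  smul_eq r x := by rw [map_smul, hN.smul_eq]
  eq_zero x hx := S.map_eq_zero_iff.1 (hN.eq_zero _ hx)

end

/-- For every normed space `X = (ℝⁿ, N)`, `n ≥ 2`, there is an invertible linear map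
`S` with `P(| N(SG) − E N(SG) | > t E N(SG)) ≤ C exp(−c max{t²,t} log n)`. -/
theorem statement13 :
    ∃ C > (0 : ℝ), ∃ c > (0 : ℝ), ∀ n : ℕ, 2 ≤ n →
      ∀ N : (Fin n → ℝ) → ℝ,
        (∀ x y, N (x + y) ≤ N x + N y) →
        (∀ (r : ℝ) (x), N (r • x) = |r| * N x) →
        (∀ x, N x = 0 → x = 0) →
        ∃ S : (Fin n → ℝ) ≃ₗ[ℝ] (Fin n → ℝ), ∀ t > (0 : ℝ),
          stdGaussian n
              {x | t * (∫ y, N (S y) ∂stdGaussian n) <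
                    |N (S x) - ∫ y, N (S y) ∂stdGaussian n|}
            ≤ ENNReal.ofReal
                (C * Real.exp (-c * max (t ^ 2) t * Real.log n)) := by
  obtain ⟨ℓ₀, hℓ₀⟩ := exists_log_threshold
  have hg := gaussAbs_pos
  have hℓ6 : 6 ≤ ℓ₀ := (hℓ₀ ℓ₀ le_rfl).1
  set κ := min 1 (gaussAbs / (2 * ℓ₀)) with hκ
  have hκ0 : 0 < κ := lt_min one_pos (by positivity)
  have hκ1 : κ ≤ 1 := min_le_left _ _
  have hc1 : ∀ {c' t : ℝ} {n : ℕ}, min (κ ^ 2 / 16) (1 / 8192) ≤ c' → 0 < t →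
      ENNReal.ofReal (2 * exp 2 * exp (-c' * max (t ^ 2) t * log n)) ≤ ENNReal.ofReal
        (2 * exp 2 * exp (-(min (κ ^ 2 / 16) (1 / 8192)) * max (t ^ 2) t * log n)) := by
    intro c' t n hc ht
    have : 0 ≤ max (t ^ 2) t := ht.le.trans (le_max_right _ _)
    have := Real.log_natCast_nonneg n
    gcongr
  refine ⟨2 * exp 2, by positivity, min (κ ^ 2 / 16) (1 / 8192),
    lt_min (by positivity) (by norm_num), fun n hn N hadd hsmul hzero => ?_⟩
  have hN₀ : IsNormFun N := ⟨hadd, hsmul, hzero⟩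
  obtain ⟨S, hE, hI⟩ := hN₀.exists_position
  have hN := hN₀.comp_linearEquiv S
  by_cases hw : κ * log n ≤ ∫ y, N (S y) ∂stdGaussian n
  · exact ⟨S, fun t ht => (hN.tail_of_large_integral hE hn hκ0.le hκ1 hw ht).trans
      (hc1 (min_le_left _ _) ht)⟩
  · rw [not_le] at hw
    have hlog := Real.log_natCast_nonneg n
    obtain ⟨j, hj⟩ : ({j | 1 / 2 ≤ N (S (Pi.single j 1))} : Finset (Fin n)).Nonempty :=
      Finset.card_pos.1 (by omega)
    have hj2 : 1 / 2 ≤ N (S (Pi.single j 1)) := (Finset.mem_filter.1 hj).2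
    have h1 := hN.gaussAbs_mul_le hN.integrable j
    have h2 : ℓ₀ ≤ log n := by
      have h3 : gaussAbs * (1 / 2) < gaussAbs / (2 * ℓ₀) * log n :=
        calc gaussAbs * (1 / 2) ≤ gaussAbs * N (S (Pi.single j 1)) := by gcongr
          _ ≤ _ := h1
          _ < κ * log n := hw
          _ ≤ _ := by
            gcongr
            exact min_le_right _ _
      have h4 : gaussAbs / (2 * ℓ₀) * log n = gaussAbs * (1 / 2) * (log n / ℓ₀) := by
        field_simp
      rw [h4, lt_mul_iff_one_lt_right (by positivity), one_lt_div (by linarith)] at h3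
      exact h3.le
    obtain ⟨h6, hA, hB⟩ := hℓ₀ _ h2
    obtain ⟨r, hr, h⟩ := hN.exists_tail_of_small_integral hE hn hI
      (hw.le.trans (mul_le_of_le_one_left hlog hκ1)) h6 hA hB
    refine ⟨(LinearEquiv.piCongrRight fun j =>
      LinearEquiv.smulOfNeZero ℝ ℝ (√(r j)) (Real.sqrt_pos.2 (hr j)).ne').trans S,
      fun t ht => (h t ht).trans (hc1 (min_le_right _ _) ht)⟩
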